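/- Cayley–Hamilton theorem for symplectic quantum matrix algebras: Let {R,F} be a compatible pair of R-matrices on V = ℂ^N in which F is strict skew invertible and R is skew invertible of Sp(2k) type (so R has height k and μ = −q^{−1−2k}). Then the N×N matrix M of generators of the quantum matrix algebra M(R,F) satisfies the identity Σ_{i=0}^{2k} (−q)^i · M^{[2k−i]} · ε_i = 0 of N×N matrices over M(R,F), where each coefficient ε_i multiplies the matrix entries on the right, ε_0 := 1, ε_i := Σ_{j=0}^{⌊i/2⌋} a_{i−2j} g^j for 1 ≤ i ≤ k, and ε_{k+i} := ε_{k−i} g^i for 1 ≤ i ≤ k. -/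

import Mathlib

open scoped BigOperators
open Matrix

noncomputable section

namespace QMA

/-- The space of operators on `V^{⊗ n}` (matrices indexed by multi-indices),
    with entries in `A`, where `V = ℂ^N`. -/
abbrev MatV (N n : ℕ) (A : Type*) := Matrix (Fin n → Fin N) (Fin n → Fin N) A

variable {N : ℕ} [NeZero N] {A : Type*}

/-- The `j`-th component of a multi-index (junk value if out of range). -/
def idx {n : ℕ} (a : Fin n → Fin N) (j : ℕ) : Fin N :=
  if h : j < n then a ⟨j, h⟩ else ⟨0, Nat.pos_of_ne_zero (NeZero.ne N)⟩

/-- Place a two-factor operator `X` on the (0-indexed) tensor factors `p, p+1`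
    of `V^{⊗ n}`, acting as the identity elsewhere. -/
def lift2 [Semiring A] {n : ℕ} (p : ℕ) (X : MatV N 2 A) : MatV N n A :=
  fun a b =>
    if ∀ m : Fin n, (m : ℕ) = p ∨ (m : ℕ) = p + 1 ∨ a m = b m then
      X ![idx a p, idx a (p + 1)] ![idx b p, idx b (p + 1)]
    else 0

/-- Place a one-factor operator `X` on the (0-indexed) tensor factor `p`
    of `V^{⊗ n}`, acting as the identity elsewhere. -/
def lift1 [Semiring A] {n : ℕ} (p : ℕ) (X : Matrix (Fin N) (Fin N) A) : MatV N n A :=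
  fun a b =>
    if ∀ m : Fin n, (m : ℕ) = p ∨ a m = b m then X (idx a p) (idx b p) else 0

/-- Extend an operator on `V^{⊗ n}` to `V^{⊗ (n+1)}` by the identity on the last factor. -/
def ext1 [Semiring A] {n : ℕ} (X : MatV N n A) : MatV N (n + 1) A :=
  fun a b =>
    if a (Fin.last n) = b (Fin.last n) then X (fun t => a t.castSucc) (fun t => b t.castSucc)
    else 0

/-- The partial trace over the last tensor factor, weighted by the matrix `D`. -/
def ptrace [NonUnitalNonAssocSemiring A] {n : ℕ} (D : Matrix (Fin N) (Fin N) A)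
    (X : MatV N (n + 1) A) : MatV N n A :=
  fun a b => ∑ m : Fin N, ∑ c : Fin N, D m c * X (Fin.snoc a c) (Fin.snoc b m)

/-- The full `D`-weighted trace over all `n` tensor factors. -/
def trAll [NonUnitalNonAssocSemiring A] (D : Matrix (Fin N) (Fin N) A) :
    (n : ℕ) → MatV N n A → A
  | 0, X => X (fun i => i.elim0) (fun i => i.elim0)
  | n + 1, X => trAll D n (ptrace D X)

/-- The `D`-weighted trace over all tensor factors except the first. -/
def trTail [NonUnitalNonAssocSemiring A] (D : Matrix (Fin N) (Fin N) A) :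
    (j : ℕ) → MatV N (j + 1) A → MatV N 1 A
  | 0, X => X
  | j + 1, X => trTail D j (ptrace D X)

/-- Identify operators on `V^{⊗1}` with `N × N` matrices. -/
def toN (X : MatV N 1 A) : Matrix (Fin N) (Fin N) A := fun i j => X (fun _ => i) (fun _ => j)

/-- Entrywise embedding of complex matrices into matrices over a `ℂ`-algebra. -/
def cmap [Ring A] [Algebra ℂ A] {m : Type*} (X : Matrix m m ℂ) : Matrix m m A :=
  X.map (algebraMap ℂ A)

/-- Multiply all entries of a matrix by `c` on the right. -/
def rmulE [Mul A] {m : Type*} (X : Matrix m m A) (c : A) : Matrix m m A := fun a b => X a b * c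

/-- Multiply all entries of a matrix by `c` on the left. -/
def lmulE [Mul A] {m : Type*} (c : A) (X : Matrix m m A) : Matrix m m A := fun a b => c * X a b

/-- The operator `D` associated with a skew inverse `Ψ`: `D_1 = Tr_(2) Ψ₁₂`. -/
def Dof (Ψ : MatV N 2 ℂ) : Matrix (Fin N) (Fin N) ℂ :=
  fun i j => ∑ m : Fin N, Ψ ![i, m] ![j, m]

/-- `Ψ` is a skew inverse of the R-matrix `R`:
    `Tr_(2)(R₁₂ Ψ₂₃) = Tr_(2)(Ψ₁₂ R₂₃) = P₁₃`. -/
def SkewPair (R Ψ : MatV N 2 ℂ) : Prop :=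
  (∀ a1 a3 b1 b3 : Fin N,
      (∑ m : Fin N, ∑ c : Fin N, R ![a1, m] ![b1, c] * Ψ ![c, a3] ![m, b3]) =
        if a1 = b3 ∧ a3 = b1 then 1 else 0) ∧
  (∀ a1 a3 b1 b3 : Fin N,
      (∑ m : Fin N, ∑ c : Fin N, Ψ ![a1, m] ![b1, c] * R ![c, a3] ![m, b3]) =
        if a1 = b3 ∧ a3 = b1 then 1 else 0)

/-- The `q`-number `j_q = (q^j - q^{-j})/(q - q^{-1})`. -/
def nq (q : ℂ) (j : ℕ) : ℂ := (q ^ (j : ℤ) - q ^ (-(j : ℤ))) / (q - q⁻¹)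

/-- The rank-one projector `K = μ⁻¹ (q-q⁻¹)⁻¹ (qI - R)(q⁻¹I + R)` of a BMW-type R-matrix. -/
def bmwK (q μ : ℂ) (R : MatV N 2 ℂ) : MatV N 2 ℂ :=
  (μ⁻¹ * (q - q⁻¹)⁻¹) • ((q • (1 : MatV N 2 ℂ) - R) * (q⁻¹ • (1 : MatV N 2 ℂ) + R))

/-- The braid relation `R₁ R₂ R₁ = R₂ R₁ R₂`. -/
def IsBraid (R : MatV N 2 ℂ) : Prop :=
  lift2 (n := 3) 0 R * lift2 1 R * lift2 0 R = lift2 1 R * lift2 0 R * lift2 1 R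

/-- `R` is an R-matrix of BMW type with eigenvalues `q, -q⁻¹, μ`. -/
def IsBMW (q μ : ℂ) (R : MatV N 2 ℂ) : Prop :=
  (q • (1 : MatV N 2 ℂ) - R) * (q⁻¹ • (1 : MatV N 2 ℂ) + R) * (μ • (1 : MatV N 2 ℂ) - R) = 0 ∧
  lift2 (n := 3) 1 (bmwK q μ R) * lift2 0 (bmwK q μ R) =
      lift2 1 (bmwK q μ R) * lift2 0 R * lift2 1 R ∧
  lift2 (n := 3) 1 (bmwK q μ R) * lift2 0 (bmwK q μ R) =
      lift2 1 (bmwK q μ R) * lift2 0 R⁻¹ * lift2 1 R⁻¹ ∧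
  lift2 (n := 3) 0 (bmwK q μ R) * lift2 1 (bmwK q μ R) * lift2 0 (bmwK q μ R) =
      lift2 0 (bmwK q μ R)

/-- `{R, F}` is a compatible pair of R-matrices (twist relations). -/
def Compatible (R F : MatV N 2 ℂ) : Prop :=
  lift2 (n := 3) 0 R * lift2 1 F * lift2 0 F = lift2 1 F * lift2 0 F * lift2 1 R ∧
  lift2 (n := 3) 1 R * lift2 0 F * lift2 1 F = lift2 0 F * lift2 1 F * lift2 0 R

/-- The antisymmetrizers `A^{(i)} ∈ End(V^{⊗i})` of a BMW-type R-matrix. -/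
def asym (q μ : ℂ) (R : MatV N 2 ℂ) : (i : ℕ) → MatV N i ℂ
  | 0 => 1
  | 1 => 1
  | i + 2 =>
      (q ^ (i + 1) / nq q (i + 2)) •
        (ext1 (asym q μ R (i + 1)) *
          ((1 : MatV N (i + 2) ℂ) +
              ((q ^ (-(2 * ((i : ℤ) + 1))) - 1) / (q - q⁻¹)) • lift2 i R +
              (μ * (q ^ (-(2 * ((i : ℤ) + 1))) - 1) / (μ + q ^ (1 - 2 * ((i : ℤ) + 1)))) •
                lift2 i (bmwK q μ R)) *
          ext1 (asym q μ R (i + 1)))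

/-- The height-`k` cutting condition
    `A^{(k)} σ⁻_k(q^{-2k}) A^{(k)} = 0` in `End(V^{⊗(k+1)})`. -/
def HeightCut (q μ : ℂ) (R : MatV N 2 ℂ) (k : ℕ) : Prop :=
  ext1 (asym q μ R k) *
      ((1 : MatV N (k + 1) ℂ) +
          ((q ^ (-(2 * (k : ℤ))) - 1) / (q - q⁻¹)) • lift2 (k - 1) R +
          (μ * (q ^ (-(2 * (k : ℤ))) - 1) / (μ + q ^ (1 - 2 * (k : ℤ)))) •
            lift2 (k - 1) (bmwK q μ R)) *
      ext1 (asym q μ R k) = 0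

/-- `R` is an R-matrix of height `k`. -/
def HasHeight (q μ : ℂ) (R : MatV N 2 ℂ) (k : ℕ) : Prop :=
  2 ≤ k ∧ (∀ i, 2 ≤ i → i ≤ k → asym q μ R i ≠ 0) ∧ HeightCut q μ R k

section AlgebraSide

variable [Ring A] [Algebra ℂ A]

/-- The copies `M_{(i+1)}` of the quantum matrix inside `V^{⊗n}`:
    `M_{(1)} = M₁`, `M_{(i+1)} = F_i M_{(i)} F_i⁻¹`. -/
def Mcopy {n : ℕ} (F : MatV N 2 ℂ) (M : Matrix (Fin N) (Fin N) A) : ℕ → MatV N n A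
  | 0 => lift1 0 M
  | j + 1 => cmap (lift2 j F) * Mcopy F M j * cmap (lift2 j F⁻¹)

/-- The product `M_{(1)} M_{(2)} ⋯ M_{(j)}`. -/
def Mprod {n : ℕ} (F : MatV N 2 ℂ) (M : Matrix (Fin N) (Fin N) A) : ℕ → MatV N n A
  | 0 => 1
  | j + 1 => Mprod F M j * Mcopy F M j

/-- The product `M_{(2)} M_{(3)} ⋯ M_{(j+1)}`. -/
def MprodFrom2 {n : ℕ} (F : MatV N 2 ℂ) (M : Matrix (Fin N) (Fin N) A) : ℕ → MatV N n A
  | 0 => 1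
  | j + 1 => MprodFrom2 F M j * Mcopy F M (j + 1)

/-- The defining relation `R₁ M_{(1)} M_{(2)} = M_{(1)} M_{(2)} R₁` of the
    quantum matrix algebra `M(R,F)`. -/
def QMArel (R F : MatV N 2 ℂ) (M : Matrix (Fin N) (Fin N) A) : Prop :=
  cmap (lift2 (n := 2) 0 R) * Mcopy F M 0 * Mcopy F M 1 =
    Mcopy F M 0 * Mcopy F M 1 * cmap (lift2 (n := 2) 0 R)

/-- The 2-contraction `g` of the quantum matrix `M`. -/
def gElt (q μ : ℂ) (R F ΨR : MatV N 2 ℂ) (M : Matrix (Fin N) (Fin N) A) : A :=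
  (μ * (q - q⁻¹) / ((q - μ) * (q⁻¹ + μ))) •
    trAll (cmap (Dof ΨR)) 2 (Mprod F M 2 * cmap (lift2 0 (bmwK q μ R)))

/-- The elementary symmetric functions `a_i` of the quantum matrix `M`. -/
def aElt (q μ : ℂ) (R F ΨR : MatV N 2 ℂ) (M : Matrix (Fin N) (Fin N) A) : ℕ → A
  | 0 => 1
  | i + 1 => trAll (cmap (Dof ΨR)) (i + 1) (Mprod F M (i + 1) * cmap (asym q μ R (i + 1)))

/-- The map `φ(X)₁ = Tr_{R(2)}(F₁ X₁ F₁⁻¹ R₁)`. -/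
def phi (R F ΨR : MatV N 2 ℂ) (X : Matrix (Fin N) (Fin N) A) : Matrix (Fin N) (Fin N) A :=
  toN (ptrace (cmap (Dof ΨR))
    (cmap (lift2 (n := 2) 0 F) * lift1 0 X * cmap (lift2 (n := 2) 0 F⁻¹) *
      cmap (lift2 (n := 2) 0 R)))

/-- The map `ξ(X)₁ = Tr_{R(2)}(F₁ X₁ F₁⁻¹ K₁)`. -/
def xi (q μ : ℂ) (R F ΨR : MatV N 2 ℂ) (X : Matrix (Fin N) (Fin N) A) :
    Matrix (Fin N) (Fin N) A :=
  toN (ptrace (cmap (Dof ΨR))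
    (cmap (lift2 (n := 2) 0 F) * lift1 0 X * cmap (lift2 (n := 2) 0 F⁻¹) *
      cmap (lift2 (n := 2) 0 (bmwK q μ R))))

/-- The map `φ⁻¹(X)₁ = μ⁻² Tr_{R_f(2)}(F₁⁻¹ X₁ R₁⁻¹ F₁)`,
    where the `R_f`-trace has weight `D_{F⁻¹} (D_{R⁻¹})⁻¹ D_F`. -/
def phiInv (μ : ℂ) (R F ΨF ΨFinv ΨRinv : MatV N 2 ℂ) (X : Matrix (Fin N) (Fin N) A) :
    Matrix (Fin N) (Fin N) A :=
  (μ⁻¹) ^ 2 •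
    toN (ptrace (cmap (Dof ΨFinv * (Dof ΨRinv)⁻¹ * Dof ΨF))
      (cmap (lift2 (n := 2) 0 F⁻¹) * lift1 0 X * cmap (lift2 (n := 2) 0 R⁻¹) *
        cmap (lift2 (n := 2) 0 F)))

/-- Star-multiplication by `M`: `L(X) = M ⋆ X = M · φ(X)`. -/
def Lmap (R F ΨR : MatV N 2 ℂ) (M X : Matrix (Fin N) (Fin N) A) : Matrix (Fin N) (Fin N) A :=
  M * phi R F ΨR X

/-- The star-powers `M^{[n]}` of the quantum matrix. -/
def starPow (R F ΨR : MatV N 2 ℂ) (M : Matrix (Fin N) (Fin N) A) : ℕ → Matrix (Fin N) (Fin N) A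
  | 0 => 1
  | n + 1 => M * phi R F ΨR (starPow R F ΨR M n)

/-- The wedge powers `M^{a^{(i)}} = Tr_{R(2,…,i)}(M_{(1)} ⋯ M_{(i)} A^{(i)})`. -/
def Mwedge (q μ : ℂ) (R F ΨR : MatV N 2 ℂ) (M : Matrix (Fin N) (Fin N) A) :
    ℕ → Matrix (Fin N) (Fin N) A
  | 0 => 1
  | i + 1 => toN (trTail (cmap (Dof ΨR)) i (Mprod F M (i + 1) * cmap (asym q μ R (i + 1))))

/-- The descendants `A^{(m,i)} = i_q · M^{[m]} ⋆ M^{a^{(i)}}` (here `m ≥ 0`). -/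
def Ad (q μ : ℂ) (R F ΨR : MatV N 2 ℂ) (M : Matrix (Fin N) (Fin N) A) (m i : ℕ) :
    Matrix (Fin N) (Fin N) A :=
  nq q i • (Lmap R F ΨR M)^[m] (Mwedge q μ R F ΨR M i)

/-- The descendants `B^{(m,i)}`, including the boundary value
    `B^{(0,i)} = i_q φ⁻¹(ξ(M^{a^{(i)}}))`. -/
def Bd (q μ : ℂ) (R F ΨR ΨF ΨFinv ΨRinv : MatV N 2 ℂ) (M : Matrix (Fin N) (Fin N) A) :
    ℕ → ℕ → Matrix (Fin N) (Fin N) A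
  | 0, i => nq q i • phiInv μ R F ΨF ΨFinv ΨRinv (xi q μ R F ΨR (Mwedge q μ R F ΨR M i))
  | m + 1, i => nq q i • (Lmap R F ΨR M)^[m] (M * xi q μ R F ΨR (Mwedge q μ R F ΨR M i))

/-- The boundary descendant
    `A^{(-1,i)} = i_q φ⁻¹(Tr_{R(2,…,i)}(M_{(2)} ⋯ M_{(i)} A^{(i)}))`. -/
def Aneg1 (q μ : ℂ) (R F ΨR ΨF ΨFinv ΨRinv : MatV N 2 ℂ) (M : Matrix (Fin N) (Fin N) A) :
    ℕ → Matrix (Fin N) (Fin N) A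
  | 0 => 0
  | i + 1 =>
      nq q (i + 1) •
        phiInv μ R F ΨF ΨFinv ΨRinv
          (toN (trTail (cmap (Dof ΨR)) i (MprodFrom2 F M i * cmap (asym q μ R (i + 1)))))

/-- The shifted family `AdS m i = A^{(m-1,i)}` (so that `AdS 0 i = A^{(-1,i)}`). -/
def AdS (q μ : ℂ) (R F ΨR ΨF ΨFinv ΨRinv : MatV N 2 ℂ) (M : Matrix (Fin N) (Fin N) A) :
    ℕ → ℕ → Matrix (Fin N) (Fin N) A
  | 0, i => Aneg1 q μ R F ΨR ΨF ΨFinv ΨRinv M i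
  | m + 1, i => Ad q μ R F ΨR M m i

/-- The coefficients `ε_i` of the symplectic Cayley-Hamilton identity. -/
def eps (q μ : ℂ) (R F ΨR : MatV N 2 ℂ) (M : Matrix (Fin N) (Fin N) A) (k i : ℕ) : A :=
  if i ≤ k then
    ∑ j ∈ Finset.range (i / 2 + 1), aElt q μ R F ΨR M (i - 2 * j) * gElt q μ R F ΨR M ^ j
  else
    (∑ j ∈ Finset.range ((2 * k - i) / 2 + 1),
        aElt q μ R F ΨR M (2 * k - i - 2 * j) * gElt q μ R F ΨR M ^ j) *
      gElt q μ R F ΨR M ^ (i - k)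

/-- The map `π(X)₁ = Tr_{R(2)}(R₁ X₁ K₁)`. -/
def piMap (q μ : ℂ) (R ΨR : MatV N 2 ℂ) (X : Matrix (Fin N) (Fin N) A) :
    Matrix (Fin N) (Fin N) A :=
  toN (ptrace (cmap (Dof ΨR))
    (cmap (lift2 (n := 2) 0 R) * lift1 0 X * cmap (lift2 (n := 2) 0 (bmwK q μ R))))

end AlgebraSide

/-- The matrix `G₁ = Tr_(2,3)(K₂ F₁⁻¹ F₂⁻¹)`. -/
def Gmat (q μ : ℂ) (R F : MatV N 2 ℂ) : Matrix (Fin N) (Fin N) ℂ :=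
  toN (trTail (1 : Matrix (Fin N) (Fin N) ℂ) 2
    (lift2 (n := 3) 1 (bmwK q μ R) * lift2 0 F⁻¹ * lift2 1 F⁻¹))

end QMA

end
namespace QMA

set_option linter.unusedSectionVars false

/-! ### Embedding operators into larger tensor powers -/

section Embedding

variable {N : ℕ} {A : Type*} [Ring A] [Algebra ℂ A]

theorem sum_agree_off_range {M : Type*} [AddCommMonoid M] {m n : ℕ} (f : Fin m ↪ Fin n)
    (a : Fin n → Fin N) (φ : (Fin m → Fin N) → M) [DecidablePred fun c : Fin n → Fin N =>
      ∀ i, i ∉ Set.range f → a i = c i] :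
    (∑ c : Fin n → Fin N, if ∀ i, i ∉ Set.range f → a i = c i then φ (c ∘ f) else 0) =
      ∑ y, φ y := by
  classical
  rw [← Finset.sum_filter]
  refine Finset.sum_bij' (fun c _ => c ∘ f) (fun y _ => Function.extend f y a) ?_ ?_ ?_ ?_ ?_
  · simp
  · intro y _
    simp only [Finset.mem_filter, Finset.mem_univ, true_and]
    intro i hi
    rw [Function.extend_apply' _ _ _ (by simpa using hi)]
  · intro c hc
    simp only [Finset.mem_filter, Finset.mem_univ, true_and] at hc
    funext i
    by_cases hi : i ∈ Set.range f
    · obtain ⟨j, rfl⟩ := hi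
      simp [f.injective.extend_apply]
    · rw [Function.extend_apply' _ _ _ (by simpa using hi), hc i hi]
  · intro y _
    funext j
    simp [f.injective.extend_apply]
  · simp

open Classical in
/-- The matrix underlying `emb`. -/
def embFun {m n : ℕ} (f : Fin m ↪ Fin n) (X : MatV N m A) : MatV N n A :=
  Matrix.of fun a b => if ∀ i, i ∉ Set.range f → a i = b i then X (a ∘ f) (b ∘ f) else 0

open Classical in
theorem embFun_apply {m n : ℕ} (f : Fin m ↪ Fin n) (X : MatV N m A) (a b : Fin n → Fin N) :
    embFun f X a b = if ∀ i, i ∉ Set.range f → a i = b i then X (a ∘ f) (b ∘ f) else 0 := rfl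

theorem embFun_one {m n : ℕ} (f : Fin m ↪ Fin n) : embFun f (1 : MatV N m A) = 1 := by
  classical
  ext a b
  rw [embFun_apply, Matrix.one_apply, Matrix.one_apply]
  by_cases h : a = b
  · simp [h]
  · rw [if_neg h]
    split_ifs with h1 h2
    · refine absurd (funext fun i => ?_) h
      by_cases hi : i ∈ Set.range f
      · obtain ⟨j, rfl⟩ := hi
        exact congrFun h2 j
      · exact h1 i hi
    · rfl
    · rfl

theorem embFun_mul {m n : ℕ} (f : Fin m ↪ Fin n) (X Y : MatV N m A) :
    embFun f (X * Y) = embFun f X * embFun f Y := by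
  classical
  ext a b
  simp only [embFun_apply, Matrix.mul_apply]
  by_cases h : ∀ i, i ∉ Set.range f → a i = b i
  · rw [if_pos h, ← sum_agree_off_range f a]
    refine Finset.sum_congr rfl fun c _ => ?_
    by_cases hc : ∀ i, i ∉ Set.range f → a i = c i
    · have : ∀ i, i ∉ Set.range f → c i = b i := fun i hi => (hc i hi).symm.trans (h i hi)
      rw [if_pos hc, if_pos hc, if_pos this]
    · rw [if_neg hc, if_neg hc, zero_mul]
  · rw [if_neg h]
    symm
    refine Finset.sum_eq_zero fun c _ => ?_
    by_cases hc : ∀ i, i ∉ Set.range f → a i = c i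
    · rw [if_neg (c := ∀ i, i ∉ Set.range f → c i = b i), mul_zero]
      exact fun hcb => h fun i hi => (hc i hi).trans (hcb i hi)
    · rw [if_neg hc, zero_mul]

/-- Place an `m`-factor operator on the tensor factors selected by `f`. -/
def emb {m n : ℕ} (f : Fin m ↪ Fin n) : MatV N m A →ₐ[ℂ] MatV N n A :=
  AlgHom.ofLinearMap
    { toFun := embFun f
      map_add' := by
        intro X Y; ext a b; simp only [Matrix.add_apply, embFun_apply]; split_ifs <;> simp
      map_smul' := by
        intro c X; ext a b
        simp only [Matrix.smul_apply, embFun_apply, RingHom.id_apply]; split_ifs <;> simp }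
    (embFun_one f) (embFun_mul f)

open Classical in
theorem emb_apply {m n : ℕ} (f : Fin m ↪ Fin n) (X : MatV N m A) (a b : Fin n → Fin N) :
    emb f X a b = if ∀ i, i ∉ Set.range f → a i = b i then X (a ∘ f) (b ∘ f) else 0 := rfl

theorem emb_emb {l m n : ℕ} (f : Fin m ↪ Fin n) (g : Fin l ↪ Fin m) (X : MatV N l A) :
    emb f (emb g X) = emb (g.trans f) X := by
  classical
  ext a b
  simp only [emb_apply, ← ite_and]
  refine if_congr ?_ rfl rfl
  constructor
  · rintro ⟨h1, h2⟩ i hi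
    by_cases hf : i ∈ Set.range f
    · obtain ⟨j, rfl⟩ := hf
      exact h2 j fun ⟨t, ht⟩ => hi ⟨t, by simp [ht]⟩
    · exact h1 i hf
  · refine fun h => ⟨fun i hi => h i fun ⟨t, ht⟩ => hi ⟨g t, ht⟩, fun j hj => h _ ?_⟩
    rintro ⟨t, ht⟩
    exact hj ⟨t, f.injective ht⟩

open Classical in
theorem emb_mul_emb_apply {m l n : ℕ} (f : Fin m ↪ Fin n) (g : Fin l ↪ Fin n)
    (hfg : ∀ i j, f i ≠ g j) (X : MatV N m A) (Y : MatV N l A) (a b : Fin n → Fin N) :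
    (emb f X * emb g Y) a b =
      if ∀ i, i ∉ Set.range f → i ∉ Set.range g → a i = b i then
        X (a ∘ f) (b ∘ f) * Y (a ∘ g) (b ∘ g) else 0 := by
  rw [Matrix.mul_apply, Finset.sum_eq_single (Function.extend f (b ∘ f) a)]
  · have h1 : ∀ i, i ∉ Set.range f → a i = Function.extend f (b ∘ f) a i := fun i hi => by
      rw [Function.extend_apply' _ _ _ (by simpa using hi)]
    have h2 : Function.extend f (b ∘ f) a ∘ f = b ∘ f := by
      funext j; simp [f.injective.extend_apply]
    have h3 : Function.extend f (b ∘ f) a ∘ g = a ∘ g := by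
      funext j
      exact (h1 (g j) fun ⟨t, ht⟩ => hfg t j ht).symm
    rw [emb_apply, emb_apply, if_pos h1, h2, h3]
    have : (∀ i, i ∉ Set.range g → Function.extend f (b ∘ f) a i = b i) ↔
        ∀ i, i ∉ Set.range f → i ∉ Set.range g → a i = b i := by
      constructor
      · exact fun h i hf hg => (h1 i hf).trans (h i hg)
      · intro h i hg
        by_cases hf : i ∈ Set.range f
        · obtain ⟨t, rfl⟩ := hf
          exact congrFun h2 t
        · exact (h1 i hf).symm.trans (h i hf hg)
    simp only [this, mul_ite, mul_zero]
  · intro c _ hc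
    rw [emb_apply, emb_apply]
    split_ifs with h1 h2
    · refine absurd (funext fun i => ?_) hc
      by_cases hf : i ∈ Set.range f
      · obtain ⟨t, rfl⟩ := hf
        rw [f.injective.extend_apply]
        exact h2 _ fun ⟨s, hs⟩ => hfg t s hs.symm
      · rw [Function.extend_apply' _ _ _ (by simpa using hf)]
        exact (h1 i hf).symm
    all_goals simp
  · simp

theorem emb_commute {m l n : ℕ} (f : Fin m ↪ Fin n) (g : Fin l ↪ Fin n)
    (hfg : ∀ i j, f i ≠ g j) (X : MatV N m A) (Y : MatV N l A)
    (h : ∀ a b c d, Commute (X a b) (Y c d)) : Commute (emb f X) (emb g Y) := by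
  ext a b
  rw [emb_mul_emb_apply f g hfg, emb_mul_emb_apply g f fun i j => (hfg j i).symm]
  exact if_congr ⟨fun h i h1 h2 => h i h2 h1, fun h i h1 h2 => h i h2 h1⟩ (h _ _ _ _) rfl

/-- Inclusion of the adjacent pair `p, p + 1`. -/
def pairEmb {n : ℕ} (p : ℕ) (h : p + 1 < n) : Fin 2 ↪ Fin n :=
  ⟨fun i => ⟨p + i, by omega⟩, fun i j hij => by
    simp only [Fin.mk.injEq] at hij; exact Fin.ext (by omega)⟩

/-- Inclusion of the single position `p`. -/
def oneEmb {n : ℕ} (p : ℕ) (h : p < n) : Fin 1 ↪ Fin n :=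
  ⟨fun _ => ⟨p, h⟩, fun _ _ _ => Subsingleton.elim _ _⟩

theorem pairEmb_apply {n : ℕ} (p : ℕ) (h : p + 1 < n) (i : Fin 2) :
    pairEmb p h i = ⟨p + i, by omega⟩ := rfl

theorem oneEmb_apply {n : ℕ} (p : ℕ) (h : p < n) (i : Fin 1) : oneEmb p h i = ⟨p, h⟩ := rfl

/-- View an `N × N` matrix as an operator on one tensor factor. -/
def ofN (X : Matrix (Fin N) (Fin N) A) : MatV N 1 A := Matrix.of fun a b => X (a 0) (b 0)

theorem mem_range_pairEmb {n p : ℕ} (h : p + 1 < n) (i : Fin n) :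
    i ∈ Set.range (pairEmb p h) ↔ (i : ℕ) = p ∨ (i : ℕ) = p + 1 := by
  constructor
  · rintro ⟨t, rfl⟩
    rw [pairEmb_apply]
    dsimp only
    omega
  · rintro (hi | hi)
    · exact ⟨0, Fin.ext (by simp [pairEmb_apply, hi])⟩
    · exact ⟨1, Fin.ext (by simp [pairEmb_apply, hi])⟩

theorem mem_range_oneEmb {n p : ℕ} (h : p < n) (i : Fin n) :
    i ∈ Set.range (oneEmb p h) ↔ (i : ℕ) = p := by
  constructor
  · rintro ⟨t, rfl⟩
    simp [oneEmb_apply]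
  · rintro hi
    exact ⟨0, Fin.ext (by simp [oneEmb_apply, hi])⟩

theorem ext1_eq_emb {n : ℕ} (X : MatV N n A) : ext1 X = emb Fin.castSuccEmb X := by
  classical
  ext a b
  rw [emb_apply, ext1]
  refine if_congr ?_ rfl rfl
  constructor
  · intro h i hi
    have : i = Fin.last n := by
      by_contra hne
      exact hi ⟨i.castPred hne, by simp⟩
    rw [this, h]
  · intro h
    refine h _ ?_
    rintro ⟨t, ht⟩
    exact (Fin.castSucc_lt_last t).ne ht

variable [NeZero N]

theorem lift2_eq_emb {n : ℕ} {p : ℕ} (h : p + 1 < n) (X : MatV N 2 A) :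
    lift2 (n := n) p X = emb (pairEmb p h) X := by
  classical
  ext a b
  rw [emb_apply, lift2]
  have key : ∀ c : Fin n → Fin N, ![idx c p, idx c (p + 1)] = c ∘ pairEmb p h := by
    intro c
    funext t
    fin_cases t
    · simp [idx, pairEmb_apply, Nat.lt_of_succ_lt h]
    · simp [idx, pairEmb_apply, h]
  rw [key, key]
  refine if_congr ?_ rfl rfl
  simp only [mem_range_pairEmb]
  exact forall_congr' fun i => by tauto

theorem lift1_eq_emb {n : ℕ} {p : ℕ} (h : p < n) (X : Matrix (Fin N) (Fin N) A) :
    lift1 (n := n) p X = emb (oneEmb p h) (ofN X) := by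
  classical
  ext a b
  rw [emb_apply, lift1]
  refine if_congr ?_ ?_ rfl
  · simp only [mem_range_oneEmb]
    exact forall_congr' fun i => by tauto
  · simp [idx, oneEmb_apply, h, ofN]

theorem lift2_self (X : MatV N 2 A) : lift2 (n := 2) 0 X = X := by
  ext a b
  have key : ∀ c : Fin 2 → Fin N, ![idx c 0, idx c 1] = c := by
    intro c; funext t; fin_cases t <;> simp [idx]
  rw [lift2, if_pos (fun m => by omega)]
  simp only [zero_add, key]

theorem ext1_lift2 {n p : ℕ} (h : p + 1 < n) (X : MatV N 2 A) :
    ext1 (lift2 (n := n) p X) = lift2 p X := by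
  rw [ext1_eq_emb, lift2_eq_emb h, lift2_eq_emb (h.trans n.lt_succ_self), emb_emb]
  rfl

theorem ext1_lift1 {n p : ℕ} (h : p < n) (X : Matrix (Fin N) (Fin N) A) :
    ext1 (lift1 (n := n) p X) = lift1 p X := by
  rw [ext1_eq_emb, lift1_eq_emb h, lift1_eq_emb (h.trans n.lt_succ_self), emb_emb]
  rfl

/-- The entrywise scalar embedding as an algebra homomorphism. -/
noncomputable def cmapHom (m A : Type*) [Fintype m] [DecidableEq m] [Ring A] [Algebra ℂ A] :
    Matrix m m ℂ →ₐ[ℂ] Matrix m m A := (Algebra.ofId ℂ A).mapMatrix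

theorem cmap_eq_hom {m : Type*} [Fintype m] [DecidableEq m] (X : Matrix m m ℂ) :
    (cmap X : Matrix m m A) = cmapHom m A X := rfl

theorem cmap_emb {m n : ℕ} (f : Fin m ↪ Fin n) (X : MatV N m ℂ) :
    (cmap (emb f X) : MatV N n A) = emb f (cmap X) := by
  classical
  ext a b
  rw [emb_apply, cmap, Matrix.map_apply, emb_apply]
  split_ifs <;> simp [cmap]

theorem cmap_ext1 {n : ℕ} (X : MatV N n ℂ) : (cmap (ext1 X) : MatV N (n + 1) A) = ext1 (cmap X) := by
  rw [ext1_eq_emb, ext1_eq_emb, cmap_emb]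

theorem cmap_commute_apply {m : Type*} (X : Matrix m m ℂ) (a b : m) (y : A) :
    Commute ((cmap X : Matrix m m A) a b) y := Algebra.commutes _ _

/-- Placement of a scalar two-factor operator on the factors `p, p + 1`, over `A`. -/
abbrev op {n : ℕ} (A : Type*) [Ring A] [Algebra ℂ A] (X : MatV N 2 ℂ) (p : ℕ) : MatV N n A :=
  cmap (lift2 p X)

theorem op_eq_emb {n p : ℕ} (h : p + 1 < n) (X : MatV N 2 ℂ) :
    (op A X p : MatV N n A) = emb (pairEmb p h) (cmap X) := by
  rw [op, lift2_eq_emb h, cmap_emb]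

theorem ext1_op {n p : ℕ} (h : p + 1 < n) (X : MatV N 2 ℂ) :
    ext1 (op A X p : MatV N n A) = op A X p := by
  rw [op, ← cmap_ext1, ext1_lift2 h]

theorem op_mul {n p : ℕ} (h : p + 1 < n) (X Y : MatV N 2 ℂ) :
    (op A (X * Y) p : MatV N n A) = op A X p * op A Y p := by
  simp only [op, lift2_eq_emb h, cmap_eq_hom, map_mul]

theorem op_one {n p : ℕ} (h : p + 1 < n) : (op A (1 : MatV N 2 ℂ) p : MatV N n A) = 1 := by
  simp only [op, lift2_eq_emb h, cmap_eq_hom, map_one]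

theorem op_add {n p : ℕ} (h : p + 1 < n) (X Y : MatV N 2 ℂ) :
    (op A (X + Y) p : MatV N n A) = op A X p + op A Y p := by
  simp only [op, lift2_eq_emb h, cmap_eq_hom, map_add]

theorem op_smul {n p : ℕ} (h : p + 1 < n) (c : ℂ) (X : MatV N 2 ℂ) :
    (op A (c • X) p : MatV N n A) = c • op A X p := by
  simp only [op, lift2_eq_emb h, cmap_eq_hom, map_smul]

theorem op_commute {n p s : ℕ} (hp : p + 1 < s) (hs : s + 1 < n) (X Y : MatV N 2 ℂ) :
    Commute (op A X p : MatV N n A) (op A Y s) := by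
  rw [op_eq_emb (by omega), op_eq_emb hs]
  refine emb_commute _ _ ?_ _ _ fun a b c d => cmap_commute_apply _ _ _ _
  intro i j h
  simp only [pairEmb_apply, Fin.mk.injEq] at h
  omega

theorem lift1_zero_commute_op {n p : ℕ} (hp : 1 ≤ p) (hn : p + 1 < n)
    (M : Matrix (Fin N) (Fin N) A) (X : MatV N 2 ℂ) :
    Commute (lift1 0 M : MatV N n A) (op A X p) := by
  rw [op_eq_emb hn, lift1_eq_emb (by omega)]
  refine emb_commute _ _ ?_ _ _ fun a b c d => (cmap_commute_apply _ _ _ _).symm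
  intro i j h
  simp only [pairEmb_apply, oneEmb_apply, Fin.mk.injEq] at h
  omega

/-- Inclusion of the adjacent triple `p, p + 1, p + 2`. -/
def tripleEmb {n : ℕ} (p : ℕ) (h : p + 2 < n) : Fin 3 ↪ Fin n :=
  ⟨fun i => ⟨p + i, by omega⟩, fun i j hij => by
    simp only [Fin.mk.injEq] at hij; exact Fin.ext (by omega)⟩

theorem tripleEmb_apply {n : ℕ} (p : ℕ) (h : p + 2 < n) (i : Fin 3) :
    tripleEmb p h i = ⟨p + i, by omega⟩ := rfl

theorem emb_triple_op_zero {n p : ℕ} (h : p + 2 < n) (X : MatV N 2 ℂ) :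
    emb (tripleEmb p h) (op A X 0 : MatV N 3 A) = op A X p := by
  rw [op_eq_emb (by omega), op_eq_emb (by omega), emb_emb]
  congr 1
  congr 1
  ext t
  simp [tripleEmb_apply, pairEmb_apply]

theorem emb_triple_op_one {n p : ℕ} (h : p + 2 < n) (X : MatV N 2 ℂ) :
    emb (tripleEmb p h) (op A X 1 : MatV N 3 A) = op A X (p + 1) := by
  rw [op_eq_emb (by omega), op_eq_emb (by omega), emb_emb]
  congr 1
  congr 1
  ext t
  simp [tripleEmb_apply, pairEmb_apply, add_assoc]

end Embedding

/-! ### Partial traces -/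

section PartialTrace

variable {N : ℕ} {A : Type*} [Ring A] [Algebra ℂ A]

theorem sum_snoc {M : Type*} [AddCommMonoid M] {n : ℕ} (φ : (Fin (n + 1) → Fin N) → M) :
    ∑ e, φ e = ∑ e' : Fin n → Fin N, ∑ z : Fin N, φ (Fin.snoc (α := fun _ => Fin N) e' z) := by
  rw [Finset.sum_comm, ← Fintype.sum_prod_type' fun (z : Fin N) (e' : Fin n → Fin N) =>
    φ (Fin.snoc (α := fun _ => Fin N) e' z)]
  exact (Fintype.sum_equiv (Fin.snocEquiv fun _ : Fin (n + 1) => Fin N) _ _ fun _ => rfl).symm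

theorem ext1_snoc {n : ℕ} (X : MatV N n A) (a b : Fin n → Fin N) (c d : Fin N) :
    ext1 X (Fin.snoc (α := fun _ => Fin N) a c) (Fin.snoc (α := fun _ => Fin N) b d) =
      if c = d then X a b else 0 := by
  simp [ext1]

theorem ext1_mul_snoc {n : ℕ} (Y : MatV N n A) (X : MatV N (n + 1) A) (a : Fin n → Fin N)
    (c : Fin N) (β : Fin (n + 1) → Fin N) :
    (ext1 Y * X) (Fin.snoc (α := fun _ => Fin N) a c) β =
      ∑ e, Y a e * X (Fin.snoc (α := fun _ => Fin N) e c) β := by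
  rw [Matrix.mul_apply, sum_snoc]
  simp [ext1_snoc]

theorem mul_ext1_snoc {n : ℕ} (Y : MatV N n A) (X : MatV N (n + 1) A) (a : Fin n → Fin N)
    (c : Fin N) (β : Fin (n + 1) → Fin N) :
    (X * ext1 Y) β (Fin.snoc (α := fun _ => Fin N) a c) =
      ∑ e, X β (Fin.snoc (α := fun _ => Fin N) e c) * Y e a := by
  rw [Matrix.mul_apply, sum_snoc]
  simp [ext1_snoc]

theorem ptrace_cmap_apply {n : ℕ} (D : Matrix (Fin N) (Fin N) ℂ) (X : MatV N (n + 1) A)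
    (a b : Fin n → Fin N) :
    ptrace (cmap D) X a b = ∑ m : Fin N, ∑ c : Fin N, D m c •
      X (Fin.snoc (α := fun _ => Fin N) a c) (Fin.snoc (α := fun _ => Fin N) b m) := by
  simp only [ptrace, cmap, Matrix.map_apply, Algebra.smul_def]

variable (D : Matrix (Fin N) (Fin N) ℂ)

theorem ptrace_add {n : ℕ} (X Y : MatV N (n + 1) A) :
    ptrace (cmap D) (X + Y) = ptrace (cmap D) X + ptrace (cmap D) Y := by
  ext a b
  simp only [ptrace_cmap_apply, Matrix.add_apply, smul_add, Finset.sum_add_distrib]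

theorem ptrace_smul {n : ℕ} (c : ℂ) (X : MatV N (n + 1) A) :
    ptrace (cmap D) (c • X) = c • ptrace (cmap D) X := by
  ext a b
  simp only [ptrace_cmap_apply, Matrix.smul_apply, Finset.smul_sum, smul_comm c]

theorem ptrace_ext1_mul {n : ℕ} (Y : MatV N n A) (X : MatV N (n + 1) A) :
    ptrace (cmap D) (ext1 Y * X) = Y * ptrace (cmap D) X := by
  ext a b
  rw [Matrix.mul_apply]
  simp only [ptrace_cmap_apply, ext1_mul_snoc, Finset.smul_sum, Finset.mul_sum, mul_smul_comm]
  exact (Finset.sum_congr rfl fun m _ => Finset.sum_comm).trans Finset.sum_comm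

theorem ptrace_mul_ext1 {n : ℕ} (Y : MatV N n A) (X : MatV N (n + 1) A) :
    ptrace (cmap D) (X * ext1 Y) = ptrace (cmap D) X * Y := by
  ext a b
  rw [Matrix.mul_apply]
  simp only [ptrace_cmap_apply, mul_ext1_snoc, Finset.smul_sum, Finset.sum_mul, smul_mul_assoc]
  exact (Finset.sum_congr rfl fun m _ => Finset.sum_comm).trans Finset.sum_comm

theorem ptrace_emb {m n : ℕ} (f : Fin m ↪ Fin n) (f' : Fin (m + 1) ↪ Fin (n + 1))
    (h1 : ∀ i : Fin m, f' i.castSucc = (f i).castSucc) (h2 : f' (Fin.last m) = Fin.last n)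
    (X : MatV N (m + 1) A) :
    ptrace (cmap D) (emb f' X) = emb f (ptrace (cmap D) X) := by
  classical
  ext a b
  have hs : ∀ (a : Fin n → Fin N) (c : Fin N), (Fin.snoc (α := fun _ => Fin N) a c) ∘ f' =
      Fin.snoc (α := fun _ => Fin N) (a ∘ f) c := by
    intro a c
    funext i
    refine Fin.lastCases ?_ (fun j => ?_) i
    · simp [h2]
    · simp [h1]
  have hr : ∀ c d, (∀ i, i ∉ Set.range f' → Fin.snoc (α := fun _ => Fin N) a c i =
      Fin.snoc (α := fun _ => Fin N) b d i) ↔ ∀ i, i ∉ Set.range f → a i = b i := by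
    intro c d
    constructor
    · intro h i hi
      have := h i.castSucc ?_
      · simpa using this
      · rintro ⟨t, ht⟩
        revert ht
        refine Fin.lastCases ?_ (fun j => ?_) t
        · rw [h2]
          exact fun h => (Fin.castSucc_lt_last i).ne h.symm
        · rw [h1]
          exact fun h => hi ⟨j, Fin.castSucc_injective _ h⟩
    · intro h i
      refine Fin.lastCases ?_ (fun j => ?_) i
      · exact fun hi => absurd ⟨_, h2⟩ hi
      · intro hi
        simpa using h j fun ⟨t, ht⟩ => hi ⟨t.castSucc, by rw [h1, ht]⟩
  simp only [ptrace_cmap_apply, emb_apply, hr, hs]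
  split_ifs <;> simp

variable [NeZero N]

theorem lift2_snoc {n : ℕ} (X : MatV N 2 A) (a b : Fin n → Fin N) (x c y d : Fin N) :
    lift2 n X (Fin.snoc (α := fun _ => Fin N) (Fin.snoc (α := fun _ => Fin N) a x) c)
      (Fin.snoc (α := fun _ => Fin N) (Fin.snoc (α := fun _ => Fin N) b y) d) =
      if a = b then X ![x, c] ![y, d] else 0 := by
  have h0 : ∀ (a : Fin n → Fin N) (x c : Fin N), idx (Fin.snoc (α := fun _ => Fin N)
      (Fin.snoc (α := fun _ => Fin N) a x) c) n = x := by
    intro a x c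
    have : (⟨n, by omega⟩ : Fin (n + 1 + 1)) = (Fin.last n).castSucc := rfl
    simp only [idx, show n < n + 1 + 1 by omega, dif_pos, this, Fin.snoc_castSucc, Fin.snoc_last]
  have h1 : ∀ (a : Fin n → Fin N) (x c : Fin N), idx (Fin.snoc (α := fun _ => Fin N)
      (Fin.snoc (α := fun _ => Fin N) a x) c) (n + 1) = c := by
    intro a x c
    have : (⟨n + 1, by omega⟩ : Fin (n + 1 + 1)) = Fin.last (n + 1) := rfl
    simp only [idx, show n + 1 < n + 1 + 1 by omega, dif_pos, this, Fin.snoc_last]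
  rw [lift2, h0, h0, h1, h1]
  refine if_congr ⟨fun h => ?_, ?_⟩ rfl rfl
  · funext i
    have := h i.castSucc.castSucc
    simp only [Fin.val_castSucc, Fin.snoc_castSucc] at this
    omega
  · rintro rfl m
    refine Fin.lastCases ?_ (fun j => ?_) m
    · simp
    · refine Fin.lastCases ?_ (fun j => ?_) j
      · simp
      · simp

theorem op_last_mul_snoc {n : ℕ} (F : MatV N 2 ℂ) (Y : MatV N (n + 2) A) (a : Fin n → Fin N)
    (x c : Fin N) (β : Fin (n + 2) → Fin N) :
    ((op A F n : MatV N (n + 2) A) * Y)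
        (Fin.snoc (α := fun _ => Fin N) (Fin.snoc (α := fun _ => Fin N) a x) c) β =
      ∑ y, ∑ d, F ![x, c] ![y, d] •
        Y (Fin.snoc (α := fun _ => Fin N) (Fin.snoc (α := fun _ => Fin N) a y) d) β := by
  rw [Matrix.mul_apply, sum_snoc, sum_snoc]
  simp [op, cmap, lift2_snoc, Algebra.smul_def, apply_ite (algebraMap ℂ A)]

theorem mul_op_last_snoc {n : ℕ} (F : MatV N 2 ℂ) (Y : MatV N (n + 2) A) (a : Fin n → Fin N)
    (x c : Fin N) (β : Fin (n + 2) → Fin N) :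
    (Y * (op A F n : MatV N (n + 2) A)) β
        (Fin.snoc (α := fun _ => Fin N) (Fin.snoc (α := fun _ => Fin N) a x) c) =
      ∑ y, ∑ d, F ![y, d] ![x, c] •
        Y β (Fin.snoc (α := fun _ => Fin N) (Fin.snoc (α := fun _ => Fin N) a y) d) := by
  rw [Matrix.mul_apply, sum_snoc, sum_snoc]
  simp [op, cmap, lift2_snoc, Algebra.smul_def, Algebra.commutes, apply_ite (algebraMap ℂ A)]

/-- Coefficients of the map `X ↦ Tr_{(n+1)} (D F_n X F'_n)`. -/
def conjCoeff (F F' : MatV N 2 ℂ) (x y a' b' : Fin N) : ℂ :=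
  ∑ m, ∑ c, ∑ d, D m c * F ![x, c] ![a', d] * F' ![b', d] ![y, m]

theorem ptrace_conj_snoc {n : ℕ} (F F' : MatV N 2 ℂ) (X : MatV N (n + 1) A) (a b : Fin n → Fin N)
    (x y : Fin N) :
    ptrace (cmap D) ((op A F n : MatV N (n + 2) A) * ext1 X * op A F' n)
        (Fin.snoc (α := fun _ => Fin N) a x) (Fin.snoc (α := fun _ => Fin N) b y) =
      ∑ a', ∑ b', conjCoeff D F F' x y a' b' •
        X (Fin.snoc (α := fun _ => Fin N) a a') (Fin.snoc (α := fun _ => Fin N) b b') := by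
  simp only [ptrace_cmap_apply, mul_op_last_snoc, op_last_mul_snoc, ext1_snoc, conjCoeff,
    Finset.smul_sum, smul_smul, Finset.sum_smul, smul_ite, smul_zero, Finset.sum_ite_eq',
    Finset.mem_univ, if_true]
  simp only [← Fintype.sum_prod_type']
  refine Fintype.sum_equiv
    (⟨fun p => (p.2.2.2.2, p.2.2.1, p.1, p.2.1, p.2.2.2.1),
      fun p => (p.2.2.1, p.2.2.2.1, p.2.1, p.2.2.2.2, p.1), fun _ => rfl, fun _ => rfl⟩ :
      Fin N × Fin N × Fin N × Fin N × Fin N ≃ Fin N × Fin N × Fin N × Fin N × Fin N)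
    _ _ fun p => ?_
  simp only [Equiv.coe_fn_mk]
  congr 1
  ring

theorem ptrace_op_last {n : ℕ} {R Ψ : MatV N 2 ℂ} (hΨ : SkewPair R Ψ) :
    ptrace (cmap (Dof Ψ)) (op A R n : MatV N (n + 2) A) = 1 := by
  ext a b
  obtain ⟨a, x, rfl⟩ : ∃ a' x, a = Fin.snoc (α := fun _ => Fin N) a' x :=
    ⟨_, _, (Fin.snoc_init_self a).symm⟩
  obtain ⟨b, y, rfl⟩ : ∃ a' x, b = Fin.snoc (α := fun _ => Fin N) a' x :=
    ⟨_, _, (Fin.snoc_init_self b).symm⟩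
  have key : ∑ m : Fin N, ∑ c : Fin N, Dof Ψ m c * R ![x, c] ![y, m] = if x = y then 1 else 0 := by
    have h : ∀ s, (∑ m : Fin N, ∑ c : Fin N, R ![x, m] ![y, c] * Ψ ![c, s] ![m, s]) =
        if x = s ∧ s = y then 1 else 0 := fun s => hΨ.1 x s y s
    calc _ = ∑ s, ∑ m : Fin N, ∑ c : Fin N, R ![x, m] ![y, c] * Ψ ![c, s] ![m, s] := by
          simp only [Dof, Finset.sum_mul]
          simp only [← Fintype.sum_prod_type']
          refine Fintype.sum_equiv
            (⟨fun p => (p.2.2, p.2.1, p.1), fun p => (p.2.2, p.2.1, p.1), fun _ => rfl,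
              fun _ => rfl⟩ : Fin N × Fin N × Fin N ≃ Fin N × Fin N × Fin N) _ _ fun p => ?_
          simp only [Equiv.coe_fn_mk]
          ring
      _ = _ := by
          simp only [h, ite_and]
          simp
  have : ∀ c m, (op A R n : MatV N (n + 2) A)
      (Fin.snoc (α := fun _ => Fin N) (Fin.snoc (α := fun _ => Fin N) a x) c)
      (Fin.snoc (α := fun _ => Fin N) (Fin.snoc (α := fun _ => Fin N) b y) m) =
        if a = b then algebraMap ℂ A (R ![x, c] ![y, m]) else 0 := by
    intro c m
    rw [op, cmap, Matrix.map_apply, lift2_snoc, apply_ite (algebraMap ℂ A), map_zero]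
  simp only [ptrace_cmap_apply, this, Matrix.one_apply, Fin.snoc_inj]
  by_cases hab : a = b
  · simp only [hab, if_true, true_and, Algebra.smul_def, ← map_mul, ← map_sum, key]
    split_ifs <;> simp
  · simp [hab]

theorem conjCoeff_eq {R F F' Ψ : MatV N 2 ℂ} (hΨ : SkewPair R Ψ) (hF : F' * F = 1)
    (hF2 : F * F' = 1)
    (hRF : lift2 (n := 3) 1 R * lift2 0 F * lift2 1 F = lift2 0 F * lift2 1 F * lift2 0 R)
    (a b a' b' : Fin N) :
    conjCoeff (Dof Ψ) F F' a b a' b' = if a = b then Dof Ψ b' a' else 0 := by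
  have hRF' : (op ℂ R 1 : MatV N 3 ℂ) * op ℂ F 0 * op ℂ F 1 = op ℂ F 0 * op ℂ F 1 * op ℂ R 0 := hRF
  have h00 : (op ℂ F' 0 : MatV N 3 ℂ) * op ℂ F 0 = 1 := by
    rw [← op_mul (by omega), hF, op_one (by omega)]
  have h11 : (op ℂ F 1 : MatV N 3 ℂ) * op ℂ F' 1 = 1 := by
    rw [← op_mul (by omega), hF2, op_one (by omega)]
  have hconj : (op ℂ F 1 : MatV N 3 ℂ) * ext1 (op ℂ R 0 : MatV N 2 ℂ) * op ℂ F' 1 =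
      ext1 (op ℂ F' 0 : MatV N 2 ℂ) * (op ℂ R 1 * ext1 (op ℂ F 0 : MatV N 2 ℂ)) := by
    rw [ext1_op (by omega), ext1_op (by omega), ext1_op (by omega)]
    calc _ = op ℂ F' 0 * (op ℂ F 0 * op ℂ F 1 * op ℂ R 0) * op ℂ F' 1 := by
          simp only [mul_assoc]
          rw [← mul_assoc (op ℂ F' 0) (op ℂ F 0), h00, one_mul]
      _ = _ := by
          rw [← hRF']
          simp only [mul_assoc]
          rw [h11, mul_one]
  have htr := congrArg (ptrace (cmap (Dof Ψ))) hconj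
  rw [ptrace_ext1_mul, ptrace_mul_ext1, ptrace_op_last hΨ, one_mul, ← op_mul (by omega), hF,
    op_one (by omega)] at htr
  have hent : ∀ x y : Fin N, ∑ s, ∑ t, R ![x, s] ![y, t] * conjCoeff (Dof Ψ) F F' a b s t =
      if x = y ∧ a = b then 1 else 0 := by
    intro x y
    have h := congrFun (congrFun htr (Fin.snoc (α := fun _ => Fin N) (fun _ : Fin 1 => x) a))
      (Fin.snoc (α := fun _ => Fin N) (fun _ : Fin 1 => y) b)
    rw [ptrace_conj_snoc] at h
    have e : ∀ x y : Fin N, (Fin.snoc (α := fun _ => Fin N) (fun _ : Fin 1 => x) y) = ![x, y] := by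
      intro x y
      funext i
      fin_cases i <;> rfl
    have e2 : (op ℂ R 0 : MatV N 2 ℂ) = R := by
      rw [op, lift2_self]
      ext; simp [cmap]
    simp only [e, e2, Matrix.one_apply, smul_eq_mul] at h
    have e3 : (![x, a] = ![y, b]) ↔ x = y ∧ a = b := by
      constructor
      · exact fun h => ⟨congrFun h 0, congrFun h 1⟩
      · rintro ⟨rfl, rfl⟩; rfl
    simp only [e3] at h
    rw [← h]
    exact Finset.sum_congr rfl fun _ _ => Finset.sum_congr rfl fun _ _ => mul_comm _ _
  have hstrip : ∑ y, ∑ x, Ψ ![b', y] ![a', x] *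
      (∑ s, ∑ t, R ![x, s] ![y, t] * conjCoeff (Dof Ψ) F F' a b s t) =
        conjCoeff (Dof Ψ) F F' a b a' b' := by
    calc _ = ∑ s, ∑ t, (∑ y, ∑ x, Ψ ![b', y] ![a', x] * R ![x, s] ![y, t]) *
          conjCoeff (Dof Ψ) F F' a b s t := by
          simp only [Finset.mul_sum, Finset.sum_mul]
          simp only [← Fintype.sum_prod_type']
          refine Fintype.sum_equiv
            (⟨fun p => (p.2.2.1, p.2.2.2, p.1, p.2.1),
              fun p => (p.2.2.1, p.2.2.2, p.1, p.2.1),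
              fun _ => rfl, fun _ => rfl⟩ :
              Fin N × Fin N × Fin N × Fin N ≃ Fin N × Fin N × Fin N × Fin N)
            _ _ fun p => ?_
          simp only [Equiv.coe_fn_mk, mul_assoc]
      _ = _ := by
          simp only [fun s t => hΨ.2 b' s a' t, ite_mul, one_mul, zero_mul, ite_and]
          simp
  rw [← hstrip]
  simp only [hent]
  by_cases hab : a = b
  · simp [hab, Dof]
  · simp [hab]

theorem ptrace_conj {n : ℕ} {R F F' Ψ : MatV N 2 ℂ} (hΨ : SkewPair R Ψ) (hF : F' * F = 1)
    (hF2 : F * F' = 1)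
    (hRF : lift2 (n := 3) 1 R * lift2 0 F * lift2 1 F = lift2 0 F * lift2 1 F * lift2 0 R)
    (X : MatV N (n + 1) A) :
    ptrace (cmap (Dof Ψ)) ((op A F n : MatV N (n + 2) A) * ext1 X * op A F' n) =
      ext1 (ptrace (cmap (Dof Ψ)) X) := by
  ext a b
  obtain ⟨a, x, rfl⟩ : ∃ a' x, a = Fin.snoc (α := fun _ => Fin N) a' x :=
    ⟨_, _, (Fin.snoc_init_self a).symm⟩
  obtain ⟨b, y, rfl⟩ : ∃ a' x, b = Fin.snoc (α := fun _ => Fin N) a' x :=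
    ⟨_, _, (Fin.snoc_init_self b).symm⟩
  rw [ptrace_conj_snoc, ext1_snoc, ptrace_cmap_apply]
  simp only [conjCoeff_eq hΨ hF hF2 hRF]
  split_ifs
  · exact Finset.sum_comm
  · simp

end PartialTrace

section Cyclicity

variable {N : ℕ} {A : Type*} [Ring A] [Algebra ℂ A] [NeZero N]

theorem fun_fin_two_eq (e : Fin 2 → Fin N) : ![e 0, e 1] = e := by
  funext i; fin_cases i <;> rfl

theorem sum_fin_two {M : Type*} [AddCommMonoid M] (φ : (Fin 2 → Fin N) → M) :
    ∑ e, φ e = ∑ u, ∑ v, φ ![u, v] := by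
  rw [← Fintype.sum_prod_type' fun u v => φ ![u, v]]
  exact Fintype.sum_equiv (finTwoArrowEquiv (Fin N)) _ _ fun e => by
    simp [finTwoArrowEquiv, fun_fin_two_eq]

/-- The operator `D ⊗ D`. -/
def tensorSq (D : Matrix (Fin N) (Fin N) ℂ) : MatV N 2 ℂ :=
  Matrix.of fun a b => D (a 0) (b 0) * D (a 1) (b 1)

theorem isBraid_inv {R R' : MatV N 2 ℂ} (h1 : R' * R = 1) (h2 : R * R' = 1) (hR : IsBraid R) :
    lift2 (n := 3) 1 R * lift2 0 R' * lift2 1 R' = lift2 0 R' * lift2 1 R' * lift2 0 R := by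
  have e : ∀ p, p + 1 < 3 → lift2 (n := 3) p R' * lift2 p R = 1 ∧
      lift2 (n := 3) p R * lift2 p R' = 1 := by
    intro p hp
    rw [lift2_eq_emb hp, lift2_eq_emb hp, ← map_mul, ← map_mul, h1, h2, map_one]
    exact ⟨rfl, rfl⟩
  obtain ⟨a1, a2⟩ := e 0 (by omega)
  obtain ⟨b1, b2⟩ := e 1 (by omega)
  unfold IsBraid at hR
  generalize lift2 (n := 3) 0 R = r at *
  generalize lift2 (n := 3) 1 R = s at *
  generalize lift2 (n := 3) 0 R' = r' at *
  generalize lift2 (n := 3) 1 R' = s' at *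
  calc s * r' * s' = (r' * s' * (s * r)) * (s * r' * s') := by
        rw [mul_assoc r' s', ← mul_assoc s' s r, b1, one_mul, a1, one_mul]
    _ = r' * s' * ((s * r * s) * r' * s') := by noncomm_ring
    _ = r' * s' * (r * s * (r * r') * s') := by rw [← hR]; noncomm_ring
    _ = r' * s' * r := by rw [a2, mul_one, mul_assoc r s s', b2, mul_one]

theorem tensorSq_commute {R R' Ψ : MatV N 2 ℂ} (hΨ : SkewPair R Ψ) (h1 : R' * R = 1)
    (h2 : R * R' = 1) (hR : IsBraid R) : tensorSq (Dof Ψ) * R = R * tensorSq (Dof Ψ) := by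
  have H1 : ∀ b' s t y, ∑ m, R' ![b', s] ![y, m] * Dof Ψ m t =
      ∑ a', Dof Ψ b' a' * Ψ ![s, a'] ![t, y] := by
    intro b' s t y
    have hG := conjCoeff_eq hΨ h1 h2 hR.symm
    calc _ = ∑ m, ∑ c, ∑ d, (∑ a', ∑ x, Ψ ![s, a'] ![t, x] * R ![x, c] ![a', d]) *
          (Dof Ψ m c * R' ![b', d] ![y, m]) := by
          simp only [fun c d => hΨ.2 s c t d, ite_and, ite_mul, one_mul, zero_mul]
          simp [mul_comm]
      _ = ∑ a', ∑ x, Ψ ![s, a'] ![t, x] * conjCoeff (Dof Ψ) R R' x y a' b' := by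
          simp only [conjCoeff, Finset.mul_sum, Finset.sum_mul]
          simp only [← Fintype.sum_prod_type']
          refine Fintype.sum_equiv
            (⟨fun p => (p.2.2.2.1, p.2.2.2.2, p.1, p.2.1, p.2.2.1),
              fun p => (p.2.2.1, p.2.2.2.1, p.2.2.2.2, p.1, p.2.1), fun _ => rfl, fun _ => rfl⟩ :
              Fin N × Fin N × Fin N × Fin N × Fin N ≃ Fin N × Fin N × Fin N × Fin N × Fin N)
            _ _ fun p => ?_
          simp only [Equiv.coe_fn_mk]
          ring
      _ = _ := by
          simp [hG, mul_comm]
  have H2 : ∀ x s t a', ∑ c, Dof Ψ s c * R' ![x, c] ![a', t] =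
      ∑ b', Ψ ![s, x] ![t, b'] * Dof Ψ b' a' := by
    intro x s t a'
    have hG := conjCoeff_eq hΨ h2 h1 (isBraid_inv h1 h2 hR)
    calc _ = ∑ m, ∑ c, ∑ d, (∑ y, ∑ b', Ψ ![s, y] ![t, b'] * R ![b', d] ![y, m]) *
          (Dof Ψ m c * R' ![x, c] ![a', d]) := by
          simp only [fun d m => hΨ.2 s d t m, ite_and, ite_mul, one_mul, zero_mul]
          simp
      _ = ∑ y, ∑ b', Ψ ![s, y] ![t, b'] * conjCoeff (Dof Ψ) R' R x y a' b' := by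
          simp only [conjCoeff, Finset.mul_sum, Finset.sum_mul]
          simp only [← Fintype.sum_prod_type']
          refine Fintype.sum_equiv
            (⟨fun p => (p.2.2.2.1, p.2.2.2.2, p.1, p.2.1, p.2.2.1),
              fun p => (p.2.2.1, p.2.2.2.1, p.2.2.2.2, p.1, p.2.1), fun _ => rfl, fun _ => rfl⟩ :
              Fin N × Fin N × Fin N × Fin N × Fin N ≃ Fin N × Fin N × Fin N × Fin N × Fin N)
            _ _ fun p => ?_
          simp only [Equiv.coe_fn_mk]
          ring
      _ = _ := by
          simp [hG]
  have hcomm : tensorSq (Dof Ψ) * R' = R' * tensorSq (Dof Ψ) := by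
    ext α β
    rw [← fun_fin_two_eq α, ← fun_fin_two_eq β]
    generalize α 0 = p; generalize α 1 = r; generalize β 0 = s; generalize β 1 = t
    rw [Matrix.mul_apply, Matrix.mul_apply, sum_fin_two, sum_fin_two]
    simp only [tensorSq, Matrix.of_apply, Matrix.cons_val_zero, Matrix.cons_val_one]
    calc _ = ∑ u, Dof Ψ p u * ∑ b', Ψ ![r, u] ![t, b'] * Dof Ψ b' s := by
          simp only [← H2, Finset.mul_sum, mul_assoc]
      _ = ∑ u, (∑ a', Dof Ψ p a' * Ψ ![r, a'] ![t, u]) * Dof Ψ u s := by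
          simp only [Finset.mul_sum, Finset.sum_mul]
          rw [Finset.sum_comm]
          simp only [mul_assoc]
      _ = _ := by
          simp only [← H1, Finset.sum_mul]
          refine Finset.sum_congr rfl fun _ _ => Finset.sum_congr rfl fun _ _ => ?_
          ring
  calc tensorSq (Dof Ψ) * R = R * (R' * tensorSq (Dof Ψ)) * R := by
        rw [← mul_assoc, h2, one_mul]
    _ = R * tensorSq (Dof Ψ) := by
        rw [← hcomm, mul_assoc, mul_assoc, h1, mul_one]

theorem ptrace_ptrace_op_comm {n : ℕ} {D : Matrix (Fin N) (Fin N) ℂ} {R : MatV N 2 ℂ}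
    (hR : tensorSq D * R = R * tensorSq D) (X : MatV N (n + 2) A) :
    ptrace (cmap D) (ptrace (cmap D) (X * op A R n)) =
      ptrace (cmap D) (ptrace (cmap D) (op A R n * X)) := by
  have key : ∀ s t p r, ∑ u, ∑ v, R ![p, r] ![u, v] * (D u s * D v t) =
      ∑ u, ∑ v, D p u * D r v * R ![u, v] ![s, t] := by
    intro s t p r
    have h := congrFun (congrFun hR ![p, r]) ![s, t]
    rw [Matrix.mul_apply, Matrix.mul_apply, sum_fin_two, sum_fin_two] at h
    simpa [tensorSq] using h.symm
  ext a b
  simp only [ptrace_cmap_apply, mul_op_last_snoc, op_last_mul_snoc]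
  calc _ = ∑ c, ∑ c', ∑ y, ∑ d, (∑ m, ∑ m', R ![y, d] ![m, m'] * (D m c * D m' c')) •
        X (Fin.snoc (α := fun _ => Fin N) (Fin.snoc (α := fun _ => Fin N) a c) c')
          (Fin.snoc (α := fun _ => Fin N) (Fin.snoc (α := fun _ => Fin N) b y) d) := by
        simp only [Finset.smul_sum, smul_smul, Finset.sum_smul]
        simp only [← Fintype.sum_prod_type']
        refine Fintype.sum_equiv
          (⟨fun p => (p.2.1, p.2.2.2.1, p.2.2.2.2.1, p.2.2.2.2.2, p.1, p.2.2.1),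
            fun p => (p.2.2.2.2.1, p.1, p.2.2.2.2.2, p.2.1, p.2.2.1, p.2.2.2.1),
            fun _ => rfl, fun _ => rfl⟩ :
            Fin N × Fin N × Fin N × Fin N × Fin N × Fin N ≃
              Fin N × Fin N × Fin N × Fin N × Fin N × Fin N)
          _ _ fun p => ?_
        simp only [Equiv.coe_fn_mk]
        congr 1
        ring
    _ = _ := by
        simp only [key, Finset.smul_sum, smul_smul, Finset.sum_smul]
        simp only [← Fintype.sum_prod_type']
        refine Fintype.sum_equiv
          (⟨fun p => (p.2.2.1, p.2.2.2.2.1, p.2.2.2.1, p.2.2.2.2.2, p.1, p.2.1),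
            fun p => (p.2.2.2.2.1, p.2.2.2.2.2, p.1, p.2.2.1, p.2.1, p.2.2.2.1),
            fun _ => rfl, fun _ => rfl⟩ :
            Fin N × Fin N × Fin N × Fin N × Fin N × Fin N ≃
              Fin N × Fin N × Fin N × Fin N × Fin N × Fin N)
          _ _ fun p => ?_
        simp only [Equiv.coe_fn_mk]
        congr 1
        ring

/-- The iterated partial trace as a linear map. -/
def trTailL (A : Type*) [Ring A] [Algebra ℂ A] (D : Matrix (Fin N) (Fin N) ℂ) :
    (j : ℕ) → MatV N (j + 1) A →ₗ[ℂ] MatV N 1 A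
  | 0 => LinearMap.id
  | j + 1 => trTailL A D j ∘ₗ
      { toFun := ptrace (cmap D)
        map_add' := ptrace_add D
        map_smul' := ptrace_smul D }

theorem trTailL_apply (D : Matrix (Fin N) (Fin N) ℂ) (j : ℕ) (X : MatV N (j + 1) A) :
    trTailL A D j X = trTail (cmap D) j X := by
  induction j with
  | zero => rfl
  | succ j ih => exact ih _

theorem trTailL_succ (D : Matrix (Fin N) (Fin N) ℂ) (j : ℕ) (X : MatV N (j + 2) A) :
    trTailL A D (j + 1) X = trTailL A D j (ptrace (cmap D) X) := rfl

/-- The elements that can be cycled under a linear map. -/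
def cycAlg {B C : Type*} [Ring B] [Algebra ℂ B] [AddCommGroup C] [Module ℂ C] (τ : B →ₗ[ℂ] C) :
    Subalgebra ℂ B where
  carrier := {Z | ∀ X, τ (X * Z) = τ (Z * X)}
  mul_mem' := by
    intro Z W hZ hW X
    rw [← mul_assoc, hW, ← mul_assoc, hZ, mul_assoc]
  add_mem' := by
    intro Z W hZ hW X
    rw [mul_add, add_mul, map_add, map_add, hZ, hW]
  algebraMap_mem' := by
    intro c X
    rw [Algebra.commutes]

theorem cycAlg_inv_mem {B C : Type*} [Ring B] [Algebra ℂ B] [AddCommGroup C] [Module ℂ C]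
    {τ : B →ₗ[ℂ] C} {Z Z' : B} (hZ : Z ∈ cycAlg τ) (h1 : Z * Z' = 1) (h2 : Z' * Z = 1) :
    Z' ∈ cycAlg τ := by
  intro X
  have := hZ (Z' * X * Z')
  rw [mul_assoc, h2, mul_one, ← mul_assoc, ← mul_assoc, h1, one_mul] at this
  exact this.symm

theorem op_mem_cycAlg {D : Matrix (Fin N) (Fin N) ℂ} {R : MatV N 2 ℂ}
    (hR : tensorSq D * R = R * tensorSq D) {j p : ℕ} (hp : 1 ≤ p) (hpj : p < j) :
    (op A R p : MatV N (j + 1) A) ∈ cycAlg (trTailL A D j) := by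
  induction j with
  | zero => omega
  | succ j ih =>
    intro X
    rcases Nat.lt_or_ge p j with h | h
    · rw [trTailL_succ, trTailL_succ, ← ext1_op (by omega), ptrace_mul_ext1, ptrace_ext1_mul]
      exact ih h _
    · obtain rfl : p = j := by omega
      obtain ⟨j, rfl⟩ := Nat.exists_eq_add_of_le' hp
      rw [trTailL_succ, trTailL_succ, trTailL_succ, trTailL_succ, ptrace_ptrace_op_comm hR]

end Cyclicity

/-! ### Representations of the BMW relations -/

section BMW

variable {B : Type*} [Ring B] [Algebra ℂ B]

/-- Generators `r p`, their inverses `r' p`, and contractors `κ p` satisfying the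
Birman–Murakami–Wenzl relations on `n` strands. -/
structure BMWFam (q μ : ℂ) (n : ℕ) (r r' κ : ℕ → B) : Prop where
  inv : ∀ p, p + 1 < n → r p * r' p = 1
  inv' : ∀ p, p + 1 < n → r' p * r p = 1
  comm : ∀ p s, p + 1 < s → s + 1 < n → Commute (r p) (r s)
  braid : ∀ p, p + 2 < n → r p * r (p + 1) * r p = r (p + 1) * r p * r (p + 1)
  kdef : ∀ p, p + 1 < n → κ p = (μ⁻¹ * (q - q⁻¹)⁻¹) • ((q • 1 - r p) * (q⁻¹ • 1 + r p))
  kr : ∀ p, p + 1 < n → κ p * r p = μ • κ p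
  kk : ∀ p, p + 2 < n → κ (p + 1) * κ p = κ (p + 1) * r p * r (p + 1)
  kk' : ∀ p, p + 2 < n → κ (p + 1) * κ p = κ (p + 1) * r' p * r' (p + 1)
  kkk : ∀ p, p + 2 < n → κ p * κ (p + 1) * κ p = κ p

/-- The loop value of the BMW algebra. -/
noncomputable def loopVal (q μ : ℂ) : ℂ := (q - μ) * (q⁻¹ + μ) / ((q - q⁻¹) * μ)

namespace BMWFam

variable {q μ : ℂ} {n : ℕ} {r r' κ : ℕ → B}

theorem shift {s : ℕ} (h : BMWFam q μ (n + s) r r' κ) :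
    BMWFam q μ n (fun j => r (j + s)) (fun j => r' (j + s)) (fun j => κ (j + s)) where
  inv p hp := h.inv _ (by omega)
  inv' p hp := h.inv' _ (by omega)
  comm p t hp ht := h.comm _ _ (by omega) (by omega)
  braid p hp := by simpa only [add_right_comm p 1 s] using h.braid (p + s) (by omega)
  kdef p hp := h.kdef _ (by omega)
  kr p hp := h.kr _ (by omega)
  kk p hp := by simpa only [add_right_comm p 1 s] using h.kk (p + s) (by omega)
  kk' p hp := by simpa only [add_right_comm p 1 s] using h.kk' (p + s) (by omega)
  kkk p hp := by simpa only [add_right_comm p 1 s] using h.kkk (p + s) (by omega)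

/-- Anything intertwining two `r`'s intertwines the corresponding contractors. -/
theorem intertwine (h : BMWFam q μ n r r' κ) {p s : ℕ} (hp : p + 1 < n) (hs : s + 1 < n) {b : B}
    (hb : b * r p = r s * b) : b * κ p = κ s * b := by
  rw [h.kdef p hp, h.kdef s hs, mul_smul_comm, smul_mul_assoc]
  congr 1
  have h2 : b * (r p * r p) = r s * r s * b := by rw [← mul_assoc, hb, mul_assoc, hb, mul_assoc]
  simp only [mul_add, add_mul, mul_sub, sub_mul, smul_mul_assoc, mul_smul_comm, one_mul, mul_one,
    h2, hb]

theorem intertwine_inv (h : BMWFam q μ n r r' κ) {p s : ℕ} (hp : p + 1 < n) (hs : s + 1 < n) {b : B}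
    (hb : b * r p = r s * b) : b * r' p = r' s * b := by
  calc b * r' p = r' s * (r s * b) * r' p := by rw [← mul_assoc, h.inv' s hs, one_mul]
    _ = r' s * b := by rw [← hb, mul_assoc, mul_assoc, h.inv p hp, mul_one]

theorem commute_kappa (h : BMWFam q μ n r r' κ) {p : ℕ} (hp : p + 1 < n) {b : B}
    (hb : Commute b (r p)) : Commute b (κ p) := h.intertwine hp hp hb

theorem commute_inv (h : BMWFam q μ n r r' κ) {p : ℕ} (hp : p + 1 < n) {b : B}
    (hb : Commute b (r p)) : Commute b (r' p) := h.intertwine_inv hp hp hb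

theorem rk (h : BMWFam q μ n r r' κ) {p : ℕ} (hp : p + 1 < n) : r p * κ p = μ • κ p := by
  rw [h.commute_kappa hp (Commute.refl _), h.kr p hp]

section Two

variable (h : BMWFam q μ n r r' κ) (hμ : μ ≠ 0) (hq : q - q⁻¹ ≠ 0) (hq0 : q ≠ 0)
  {p : ℕ} (hp : p + 1 < n)
include h hμ hp

theorem kr' : κ p * r' p = μ⁻¹ • κ p := by
  have := congrArg (· * r' p) (h.kr p hp)
  simp only [mul_assoc, h.inv p hp, mul_one, smul_mul_assoc] at this
  rw [this, smul_smul, inv_mul_cancel₀ hμ, one_smul, ← this]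

theorem r'k : r' p * κ p = μ⁻¹ • κ p := by
  have hc : Commute (κ p) (r p) := (h.commute_kappa hp (Commute.refl (r p))).symm
  rw [← (h.commute_inv hp hc), h.kr' hμ hp]

include hq hq0

theorem rsq : r p * r p = 1 + (q - q⁻¹) • r p - ((q - q⁻¹) * μ) • κ p := by
  rw [h.kdef p hp, smul_smul, show (q - q⁻¹) * μ * (μ⁻¹ * (q - q⁻¹)⁻¹) = 1 by
    rw [mul_assoc, mul_inv_cancel_left₀ hμ, mul_inv_cancel₀ hq], one_smul]
  simp only [mul_add, sub_mul, smul_mul_assoc, mul_smul_comm, one_mul, mul_one, smul_smul,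
    inv_mul_cancel₀ hq0, sub_smul, one_smul, smul_sub]
  abel

theorem r_eq_r' : r p = r' p + (q - q⁻¹) • 1 - (q - q⁻¹) • κ p := by
  have := congrArg (· * r' p) (h.rsq hμ hq hq0 hp)
  simp only [mul_assoc, h.inv p hp, mul_one, smul_mul_assoc, sub_mul, add_mul, one_mul,
    h.kr' hμ hp, smul_smul, mul_inv_cancel₀ hμ] at this
  exact this

theorem r'_eq : r' p = r p - (q - q⁻¹) • 1 + (q - q⁻¹) • κ p := by
  rw [h.r_eq_r' hμ hq hq0 hp]; abel

theorem ksq : κ p * κ p = loopVal q μ • κ p := by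
  have h1 := congrArg (κ p * ·) (h.rsq hμ hq hq0 hp)
  simp only [← mul_assoc, h.kr p hp, mul_sub, mul_add, mul_one, mul_smul_comm, smul_mul_assoc,
    smul_smul] at h1
  have h2 : ((q - q⁻¹) * μ) • (κ p * κ p) = ((q - μ) * (q⁻¹ + μ)) • κ p := by
    rw [show (q - μ) * (q⁻¹ + μ) = 1 + (q - q⁻¹) * μ - μ * μ by field_simp; ring, sub_smul,
      add_smul, one_smul, h1]
    abel
  rw [loopVal, div_eq_inv_mul, mul_smul, ← h2, smul_smul, inv_mul_cancel₀ (mul_ne_zero hq hμ),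
    one_smul]

end Two

section Three

variable (h : BMWFam q μ n r r' κ) {p : ℕ} (hp : p + 2 < n)
include h hp

theorem r_r_k : r p * r (p + 1) * κ p = κ (p + 1) * (r p * r (p + 1)) :=
  h.intertwine (by omega) (by omega) (by rw [h.braid p hp, ← mul_assoc])

theorem r_r_k_succ : r (p + 1) * r p * κ (p + 1) = κ p * (r (p + 1) * r p) :=
  h.intertwine (by omega) (by omega) (by rw [← h.braid p hp, ← mul_assoc])

theorem r_r_k_eq : r p * r (p + 1) * κ p = κ (p + 1) * κ p := by
  rw [h.r_r_k hp, h.kk p hp, mul_assoc]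

theorem k_r_r : κ p * r (p + 1) * r p = κ p * κ (p + 1) := by
  calc κ p * r (p + 1) * r p = κ p * κ (p + 1) * κ p * r (p + 1) * r p := by rw [h.kkk p hp]
    _ = κ p * (κ (p + 1) * r' p * r' (p + 1)) * r (p + 1) * r p := by
      rw [← h.kk' p hp, mul_assoc (κ p)]
    _ = κ p * (κ (p + 1) * (r' p * (r' (p + 1) * r (p + 1)) * r p)) := by noncomm_ring
    _ = κ p * κ (p + 1) := by
      rw [h.inv' _ (by omega), mul_one, h.inv' _ (by omega), mul_one]

theorem k_r'_r' : κ p * r' (p + 1) * r' p = κ p * κ (p + 1) := by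
  calc κ p * r' (p + 1) * r' p = κ p * κ (p + 1) * κ p * r' (p + 1) * r' p := by rw [h.kkk p hp]
    _ = κ p * (κ (p + 1) * r p * r (p + 1)) * r' (p + 1) * r' p := by
      rw [← h.kk p hp, mul_assoc (κ p)]
    _ = κ p * (κ (p + 1) * (r p * (r (p + 1) * r' (p + 1)) * r' p)) := by noncomm_ring
    _ = κ p * κ (p + 1) := by
      rw [h.inv _ (by omega), mul_one, h.inv _ (by omega), mul_one]

theorem r_r_k_succ_eq : r (p + 1) * r p * κ (p + 1) = κ p * κ (p + 1) := by
  rw [h.r_r_k_succ hp, ← mul_assoc, h.k_r_r hp]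

theorem kkk_succ : κ (p + 1) * κ p * κ (p + 1) = κ (p + 1) := by
  have h1 : r p * r (p + 1) * r p * κ p = κ (p + 1) * (r p * r (p + 1) * r p) :=
    h.intertwine (by omega) (by omega) (by rw [h.braid p hp]; simp only [mul_assoc]
                                           rw [← mul_assoc (r p), h.braid p hp]
                                           simp only [mul_assoc])
  have h2 : r p * r (p + 1) * r p * κ (p + 1) = κ p * (r p * r (p + 1) * r p) :=
    h.intertwine (by omega) (by omega) (by
      rw [mul_assoc, mul_assoc, ← mul_assoc (r (p + 1)), ← h.braid p hp])
  have h3 : κ (p + 1) * κ p * κ (p + 1) * (r p * r (p + 1) * r p)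
      = κ (p + 1) * (r p * r (p + 1) * r p) := by
    rw [mul_assoc, ← h1, mul_assoc (κ (p + 1)), ← mul_assoc (κ p), ← h2, ← mul_assoc, ← mul_assoc,
      ← h1, mul_assoc, mul_assoc, ← mul_assoc (κ p), h.kkk p hp]
  have h4 := congrArg (· * (r' p * (r' (p + 1) * r' p))) h3
  simp only [mul_assoc] at h4
  have h5 : r p * (r (p + 1) * (r p * (r' p * (r' (p + 1) * r' p)))) = 1 := by
    rw [← mul_assoc (r p) (r' p), h.inv p (by omega), one_mul, ← mul_assoc (r (p + 1)),
      h.inv (p + 1) (by omega), one_mul, h.inv p (by omega)]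
  simpa only [h5, mul_one, mul_assoc] using h4

end Three

end BMWFam

end BMW

/-! ### Antisymmetrizers in the BMW algebra -/

section Asym

/-- The coefficient of the braid generator in the baxterized factor. -/
noncomputable def sx (q : ℂ) (n : ℕ) : ℂ := (q ^ (-(2 * (n : ℤ))) - 1) / (q - q⁻¹)

/-- The coefficient of the contractor in the baxterized factor. -/
noncomputable def sy (q μ : ℂ) (n : ℕ) : ℂ :=
  μ * (q ^ (-(2 * (n : ℤ))) - 1) / (μ + q ^ (1 - 2 * (n : ℤ)))

/-- Nondegeneracy of the parameters needed for the first `k` antisymmetrizers. -/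
structure Generic (q μ : ℂ) (k : ℕ) : Prop where
  q0 : q ≠ 0
  lam : q - q⁻¹ ≠ 0
  mu0 : μ ≠ 0
  muq : μ ≠ q
  muq' : μ + q⁻¹ ≠ 0
  nq_ne : ∀ i, 1 ≤ i → i ≤ k → nq q i ≠ 0
  den : ∀ i : ℕ, 1 ≤ i → i ≤ k → μ + q ^ (1 - 2 * (i : ℤ)) ≠ 0

namespace Generic

variable {q μ : ℂ} {k : ℕ} (G : Generic q μ k)
include G

theorem sq_sub_one : q ^ 2 - 1 ≠ 0 := by
  intro h0
  apply G.lam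
  have := G.q0
  field_simp
  rw [h0, mul_zero]

theorem zpow_one_sub (n : ℕ) : q ^ (1 - 2 * (n : ℤ)) = q * q ^ (-(2 * (n : ℤ))) := by
  rw [sub_eq_add_neg, zpow_add₀ G.q0, zpow_one]

theorem sx_one : sx q 1 = -q⁻¹ := by
  have h1 := G.q0
  have h2 := G.lam
  have h2' := G.sq_sub_one
  rw [sx, div_eq_iff h2, show (-(2 * ((1 : ℕ) : ℤ))) = -1 + -1 by norm_num, zpow_add₀ h1,
    _root_.zpow_neg_one]
  field_simp
  ring

theorem sx_succ (n : ℕ) : sx q (n + 1) = -q⁻¹ * (1 - sx q n * q⁻¹) := by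
  have h1 := G.q0
  have h2 := G.lam
  have h2' := G.sq_sub_one
  have h3 : q ^ (-(2 * ((n + 1 : ℕ) : ℤ))) = q ^ (-(2 * (n : ℤ))) * q⁻¹ * q⁻¹ := by
    rw [← _root_.zpow_neg_one, ← zpow_add₀ h1, ← zpow_add₀ h1]; congr 1; push_cast; ring
  rw [sx, sx, h3, div_eq_iff h2]
  generalize q ^ (-(2 * (n : ℤ))) = t
  field_simp
  ring

theorem sy_mul {n : ℕ} (hn : 1 ≤ n) (hk : n ≤ k) :
    sy q μ n * (μ + q ^ (1 - 2 * (n : ℤ))) = (q - q⁻¹) * μ * sx q n := by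
  have h1 := G.den n hn hk
  have h0 := G.q0
  have h2 := G.lam
  have h2' := G.sq_sub_one
  rw [sy, sx, div_mul_cancel₀ _ h1]
  field_simp

theorem sy_one (hk : 1 ≤ k) : sy q μ 1 * (μ + q⁻¹) = (q - q⁻¹) * μ * sx q 1 := by
  have := G.sy_mul le_rfl hk
  rwa [show (1 - 2 * ((1 : ℕ) : ℤ)) = -1 by norm_num, _root_.zpow_neg_one] at this

theorem sy_rel {n : ℕ} (hk : n + 1 ≤ k) :
    sy q μ (n + 1) * (μ + q⁻¹ + (q - q⁻¹) * sx q n * q⁻¹) = (q - q⁻¹) * μ * sx q (n + 1) := by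
  have h2 := G.lam
  have h2' := G.sq_sub_one
  rw [← G.sy_mul (by omega) hk, sx, mul_div_cancel₀ _ h2]
  have h1 := G.q0
  have h3 : q ^ (1 - 2 * ((n + 1 : ℕ) : ℤ)) = q ^ (-(2 * (n : ℤ))) * q⁻¹ := by
    rw [← _root_.zpow_neg_one, ← zpow_add₀ h1]; congr 1; push_cast; ring
  rw [h3]
  ring

theorem sy_rel' {n : ℕ} (hn : 1 ≤ n) (hk : n + 1 ≤ k) :
    -q * sx q (n + 1) * sy q μ n + sy q μ (n + 1) * sy q μ n
      = -(sy q μ (n + 1) * sx q n * q⁻¹) := by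
  have h1 := G.q0
  have h2 := G.lam
  have h2' := G.sq_sub_one
  have d1 := G.den n hn (by omega)
  have d2 := G.den (n + 1) (by omega) hk
  have h3 : q ^ (-(2 * ((n + 1 : ℕ) : ℤ))) = q ^ (-(2 * (n : ℤ))) * q⁻¹ * q⁻¹ := by
    rw [← _root_.zpow_neg_one, ← zpow_add₀ h1, ← zpow_add₀ h1]; congr 1; push_cast; ring
  have e1 := G.sy_mul hn (by omega)
  have e2 := G.sy_mul (n := n + 1) (by omega) hk
  rw [G.zpow_one_sub] at d1 d2 e1 e2
  rw [h3] at d2 e2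
  set t := q ^ (-(2 * (n : ℤ))) with ht
  have e3 : t = 1 + (q - q⁻¹) * sx q n := by rw [sx, mul_div_cancel₀ _ h2]; ring
  apply mul_left_cancel₀ d1
  apply mul_left_cancel₀ d2
  have k1 : sy q μ n = (q - q⁻¹) * μ * sx q n / (μ + q * t) := by rw [← e1]; field_simp
  have k2 : sy q μ (n + 1) = (q - q⁻¹) * μ * sx q (n + 1) / (μ + q * (t * q⁻¹ * q⁻¹)) := by
    rw [← e2, mul_div_cancel_right₀ _ d2]
  rw [k1, k2]
  generalize sx q n = x at *
  generalize sx q (n + 1) = x' at *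
  have d2' : μ * q + t ≠ 0 := by
    intro h0; apply d2; field_simp; linear_combination h0
  field_simp
  ring

/-- Normalisation of the antisymmetrizers. -/
theorem norm_eq {n : ℕ} (hk : n + 1 ≤ k) :
    q ^ n / nq q (n + 1) * (1 - q⁻¹ * sx q n) = 1 := by
  have h0 := G.nq_ne (n + 1) (by omega) hk
  have h1 := G.q0
  have h2 := G.lam
  have h2' := G.sq_sub_one
  rw [div_mul_eq_mul_div, div_eq_one_iff_eq h0, nq, sx]
  have h3 : q ^ ((n + 1 : ℕ) : ℤ) = q ^ n * q := by
    rw [zpow_natCast, pow_succ]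
  have h4 : q ^ (-((n + 1 : ℕ) : ℤ)) = (q ^ n)⁻¹ * q⁻¹ := by
    rw [_root_.zpow_neg, h3, mul_inv]
  have h5 : q ^ (-(2 * (n : ℤ))) = (q ^ n)⁻¹ * (q ^ n)⁻¹ := by
    rw [two_mul, neg_add, zpow_add₀ h1, _root_.zpow_neg, zpow_natCast]
  have h6 : q ^ n ≠ 0 := pow_ne_zero _ h1
  rw [h3, h4, h5]
  generalize q ^ n = s at *
  field_simp
  ring

end Generic

variable {B : Type*} [Ring B] [Algebra ℂ B]

/-- The baxterized factor at the `i`-th pair of strands. -/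
noncomputable def sig (q μ : ℂ) (r κ : ℕ → B) (n i : ℕ) : B :=
  1 + sx q n • r i + sy q μ n • κ i

/-- Antisymmetrizers built from abstract generators. -/
noncomputable def asymB (q μ : ℂ) (r κ : ℕ → B) : ℕ → B
  | 0 => 1
  | 1 => 1
  | i + 2 => (q ^ (i + 1) / nq q (i + 2)) •
      (asymB q μ r κ (i + 1) * sig q μ r κ (i + 1) i * asymB q μ r κ (i + 1))

theorem asymB_succ_succ (q μ : ℂ) (r κ : ℕ → B) (i : ℕ) :
    asymB q μ r κ (i + 2) = (q ^ (i + 1) / nq q (i + 2)) •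
      (asymB q μ r κ (i + 1) * sig q μ r κ (i + 1) i * asymB q μ r κ (i + 1)) := rfl

theorem asymB_congr (q μ : ℂ) {r κ s ν : ℕ → B} (i : ℕ) (hr : ∀ j, j + 1 < i → r j = s j)
    (hκ : ∀ j, j + 1 < i → κ j = ν j) : asymB q μ r κ i = asymB q μ s ν i := by
  induction i using asymB.induct with
  | case1 => rfl
  | case2 => rfl
  | case3 i ih =>
    rw [asymB_succ_succ, asymB_succ_succ, ih (fun j hj => hr j (by omega))
      (fun j hj => hκ j (by omega)), sig, sig, hr i (by omega), hκ i (by omega)]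

theorem map_asymB {C : Type*} [Ring C] [Algebra ℂ C] (f : B →ₐ[ℂ] C) (q μ : ℂ) (r κ : ℕ → B)
    (i : ℕ) : f (asymB q μ r κ i) = asymB q μ (fun j => f (r j)) (fun j => f (κ j)) i := by
  induction i using asymB.induct with
  | case1 => exact map_one f
  | case2 => exact map_one f
  | case3 i ih =>
    rw [asymB_succ_succ, asymB_succ_succ, ← ih, sig, sig]
    simp only [map_mul, map_add, map_smul, map_one]

theorem asymB_op (q μ : ℂ) (r κ : ℕ → B) (i : ℕ) :
    asymB q μ (fun j => MulOpposite.op (r j)) (fun j => MulOpposite.op (κ j)) i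
      = MulOpposite.op (asymB q μ r κ i) := by
  induction i using asymB.induct with
  | case1 => rfl
  | case2 => rfl
  | case3 i ih =>
    rw [asymB_succ_succ, asymB_succ_succ, ih, sig, sig]
    simp only [MulOpposite.op_mul, MulOpposite.op_smul, MulOpposite.op_add, MulOpposite.op_one, mul_assoc]

/-- An element commuting with all the generators commutes with the antisymmetrizer. -/
theorem commute_asymB (q μ : ℂ) {r κ : ℕ → B} {b : B} (i : ℕ)
    (hr : ∀ j, j + 1 < i → Commute b (r j)) (hκ : ∀ j, j + 1 < i → Commute b (κ j)) :
    Commute b (asymB q μ r κ i) := by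
  induction i using asymB.induct with
  | case1 => exact Commute.one_right b
  | case2 => exact Commute.one_right b
  | case3 i ih =>
    rw [asymB_succ_succ]
    have h := ih (fun j hj => hr j (by omega)) (fun j hj => hκ j (by omega))
    refine Commute.smul_right ((h.mul_right ?_).mul_right h) _
    exact (((Commute.one_right b).add_right ((hr i (by omega)).smul_right _))).add_right
      ((hκ i (by omega)).smul_right _)

theorem asymB_mem (q μ : ℂ) {r κ : ℕ → B} (S : Subalgebra ℂ B) (i : ℕ)
    (hr : ∀ j, j + 1 < i → r j ∈ S) (hκ : ∀ j, j + 1 < i → κ j ∈ S) : asymB q μ r κ i ∈ S := by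
  induction i using asymB.induct with
  | case1 => exact S.one_mem
  | case2 => exact S.one_mem
  | case3 i ih =>
    rw [asymB_succ_succ]
    have h := ih (fun j hj => hr j (by omega)) (fun j hj => hκ j (by omega))
    refine S.smul_mem (S.mul_mem (S.mul_mem h ?_) h) _
    exact S.add_mem (S.add_mem S.one_mem (S.smul_mem (hr i (by omega)) _))
      (S.smul_mem (hκ i (by omega)) _)

namespace BMWFam

variable {q μ : ℂ} {n k : ℕ} {r r' κ : ℕ → B}

/-- The BMW relations are invariant under reversing products. -/
theorem opp (h : BMWFam q μ n r r' κ) :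
    BMWFam q μ n (fun j => MulOpposite.op (r j)) (fun j => MulOpposite.op (r' j))
      (fun j => MulOpposite.op (κ j)) where
  inv p hp := by rw [← MulOpposite.op_mul, h.inv' p hp, MulOpposite.op_one]
  inv' p hp := by rw [← MulOpposite.op_mul, h.inv p hp, MulOpposite.op_one]
  comm p s hp hs := (h.comm p s hp hs).op
  braid p hp := by simp only [← MulOpposite.op_mul, ← mul_assoc, h.braid p hp]
  kdef p hp := by
    rw [h.kdef p hp, MulOpposite.op_smul, MulOpposite.op_mul]
    have : Commute (MulOpposite.op (q⁻¹ • 1 + r p)) (MulOpposite.op (q • 1 - r p)) := by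
      refine Commute.op ?_
      refine Commute.add_left (Commute.smul_left (Commute.one_left _) _) ?_
      exact Commute.sub_right (Commute.smul_right (Commute.one_right _) _) (Commute.refl _)
    rw [this.eq]; rfl
  kr p hp := by rw [← MulOpposite.op_mul, h.rk hp, MulOpposite.op_smul]
  kk p hp := by simp only [← MulOpposite.op_mul, ← mul_assoc, ← h.r_r_k_succ_eq hp]
  kk' p hp := by
    have h1 : r' (p + 1) * r' p * κ (p + 1) = κ p * (r' (p + 1) * r' p) :=
      h.intertwine (by omega) (by omega) (by
        have := h.braid p hp
        have e : r' (p + 1) * r' p * (r p * r (p + 1) * r p) * (r' (p + 1) * r' p)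
           = r' (p + 1) * r' p * (r (p + 1) * r p * r (p + 1)) * (r' (p + 1) * r' p) := by rw [this]
        have e1 : r' (p + 1) * r' p * (r p * r (p + 1) * r p) * (r' (p + 1) * r' p)
          = r' (p + 1) * (r' p * r p) * r (p + 1) * r p * (r' (p + 1) * r' p) := by noncomm_ring
        have e2 : r' (p + 1) * r' p * (r (p + 1) * r p * r (p + 1)) * (r' (p + 1) * r' p)
            = r' (p + 1) * r' p * r (p + 1) * (r p * (r (p + 1) * r' (p + 1)) * r' p) := by
          noncomm_ring
        rw [h.inv' p (by omega), mul_one, h.inv' (p + 1) (by omega), one_mul] at e1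
        rw [h.inv (p + 1) (by omega), mul_one, h.inv p (by omega), mul_one] at e2
        rw [← e2, ← e, e1])
    rw [← mul_assoc (κ p), h.k_r'_r' hp] at h1
    simp only [← MulOpposite.op_mul, ← mul_assoc, h1]
  kkk p hp := by simp only [← MulOpposite.op_mul, ← mul_assoc, h.kkk p hp]

end BMWFam
end Asym

section Absorb

variable {B : Type*} [Ring B] [Algebra ℂ B]

namespace BMWFam

variable {q μ : ℂ} {n k : ℕ} {r r' κ : ℕ → B}
variable (h : BMWFam q μ n r r' κ) (G : Generic q μ k)
include h G

theorem kappa_of_absorb {p : ℕ} (hp : p + 1 < n) {b : B} (hb : b * r p = (-q⁻¹) • b) :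
    b * κ p = 0 := by
  have h1 : b * (r p * κ p) = (-q⁻¹) • (b * κ p) := by rw [← mul_assoc, hb, smul_mul_assoc]
  rw [h.rk hp, mul_smul_comm] at h1
  have h2 : (μ + q⁻¹) • (b * κ p) = 0 := by rw [add_smul, h1, ← add_smul]; simp
  exact (smul_eq_zero.mp h2).resolve_left G.muq'

theorem absorb_sig {p : ℕ} (m : ℕ) (hp : p + 1 < n) {b : B} (hb : b * r p = (-q⁻¹) • b) :
    b * sig q μ r κ m p = (1 - q⁻¹ * sx q m) • b := by
  rw [sig, mul_add, mul_add, mul_one, mul_smul_comm, mul_smul_comm, hb, h.kappa_of_absorb G hp hb]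
  module

theorem absorb_asymB {i : ℕ} (hi : i ≤ k) (hn : i ≤ n) {b : B}
    (hb : ∀ j, j + 1 < i → b * r j = (-q⁻¹) • b) : b * asymB q μ r κ i = b := by
  induction i using asymB.induct with
  | case1 => exact mul_one b
  | case2 => exact mul_one b
  | case3 i ih =>
    have h1 := ih (by omega) (by omega) (fun j hj => hb j (by omega))
    rw [asymB_succ_succ, mul_smul_comm, ← mul_assoc, ← mul_assoc, h1,
      h.absorb_sig G _ (by omega) (hb i (by omega)), smul_mul_assoc, h1, smul_smul,
      G.norm_eq (by omega), one_smul]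

theorem absorb_sig_sig {p m : ℕ} (hp : p + 2 < n) (hm : 1 ≤ m) (hk : m + 1 ≤ k) {a : B}
    (ha : a * r p = (-q⁻¹) • a) :
    a * sig q μ r κ (m + 1) (p + 1) * sig q μ r κ m p * r (p + 1)
      = (-q⁻¹) • (a * sig q μ r κ (m + 1) (p + 1) * sig q μ r κ m p) := by
  have q0 := G.q0
  have ak := h.kappa_of_absorb G (by omega) ha
  have p1 : p + 1 + 1 < n := by omega
  have rsq := h.rsq G.mu0 G.lam q0 p1
  have e1 : a * r (p + 1) * r (p + 1)
      = a + (q - q⁻¹) • (a * r (p + 1)) - ((q - q⁻¹) * μ) • (a * κ (p + 1)) := by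
    rw [mul_assoc, rsq, mul_sub, mul_add, mul_one, mul_smul_comm, mul_smul_comm]
  have e2 : a * κ (p + 1) * r (p + 1) = μ • (a * κ (p + 1)) := by
    rw [mul_assoc, h.kr _ p1, mul_smul_comm]
  have e3 : a * r (p + 1) * r p * r (p + 1) = (-q⁻¹) • (a * r (p + 1) * r p) := by
    rw [mul_assoc, mul_assoc, ← mul_assoc (r (p + 1)), ← h.braid p hp, ← mul_assoc, ← mul_assoc, ha]
    simp only [smul_mul_assoc]
  have e4 : a * κ (p + 1) * r p * r (p + 1) = a * κ (p + 1) * κ p := by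
    rw [mul_assoc a, mul_assoc a, ← h.kk p hp, ← mul_assoc]
  have e5 : a * κ (p + 1) * κ p * r (p + 1)
      = a * κ (p + 1) * r p - (q - q⁻¹) • (a * κ (p + 1))
        + (q - q⁻¹) • (a * κ (p + 1) * κ p) := by
    have : κ (p + 1) * κ p * r (p + 1) = κ (p + 1) * r' p := by
      rw [h.kk' p hp, mul_assoc, h.inv' _ p1, mul_one]
    rw [mul_assoc a, mul_assoc a, this, h.r'_eq G.mu0 G.lam q0 (by omega : p + 1 < n)]
    simp only [mul_add, mul_sub, mul_smul_comm, mul_one, mul_assoc]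
  have e6 : a * r (p + 1) * κ p = (-q) • (a * κ (p + 1) * κ p) := by
    have : a * r p * r (p + 1) * κ p = a * κ (p + 1) * κ p := by
      rw [mul_assoc a, mul_assoc a, h.r_r_k_eq hp, ← mul_assoc]
    rw [← this, ha, smul_mul_assoc, smul_mul_assoc, smul_smul, neg_mul_neg, mul_inv_cancel₀ q0,
      one_smul]
  have s1 := G.sx_succ m
  have s2 := G.sy_rel hk
  have s3 := G.sy_rel' hm hk
  have s3' : sx q m * sy q μ (m + 1)
      = -q * (-q * sx q (m + 1) * sy q μ m + sy q μ (m + 1) * sy q μ m) := by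
    rw [s3]; field_simp
  have s1' : 1 - sx q m * q⁻¹ = -q * sx q (m + 1) := by rw [s1]; field_simp
  generalize hx : sx q (m + 1) = x at *
  generalize hy : sy q μ (m + 1) = y at *
  generalize hx' : sx q m = x' at *
  generalize hy' : sy q μ m = y' at *
  have E : a * sig q μ r κ (m + 1) (p + 1) * sig q μ r κ m p
      = (1 - x' * q⁻¹) • a + x • (a * r (p + 1)) + y • (a * κ (p + 1))
        + (x * x') • (a * r (p + 1) * r p) + (y * x') • (a * κ (p + 1) * r p)
        + (-q * x * y' + y * y') • (a * κ (p + 1) * κ p) := by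
    rw [sig, sig, hx, hy, hx', hy']
    simp only [mul_add, add_mul, mul_smul_comm, smul_mul_assoc, mul_one, ha, ak, e6, smul_smul]
    module
  rw [E]
  simp only [add_mul, smul_mul_assoc, e1, e2, e3, e4, e5]
  generalize -q * x * y' + y * y' = z at *
  rw [s1']
  have t3 : z * q = -(y * x') := by rw [s3]; field_simp
  have t2 : y * (μ * q ^ 2 + q + (q ^ 2 - 1) * x') = (q ^ 2 - 1) * q * μ * x := by
    have := congrArg (· * q ^ 2) s2
    field_simp at this
    linear_combination this
  match_scalars
  all_goals try field_simp
  · ring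
  · apply mul_left_cancel₀ q0
    linear_combination t2 - (q ^ 2 - 1) * t3
  · linear_combination q * t3
  · exact t3

theorem asymB_mul_r {i : ℕ} (hi : i ≤ k) (hn : i ≤ n) {j : ℕ} (hj : j + 1 < i) :
    asymB q μ r κ i * r j = (-q⁻¹) • asymB q μ r κ i := by
  induction i using asymB.induct generalizing j with
  | case1 => omega
  | case2 => omega
  | case3 i ih =>
    rw [asymB_succ_succ, smul_mul_assoc, smul_comm]
    congr 1
    rcases Nat.lt_or_ge j i with hji | hji
    · rw [mul_assoc, ih (by omega) (by omega) (by omega), mul_smul_comm]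
    obtain rfl : j = i := by omega
    rcases j with _ | p
    · change 1 * _ * 1 * _ = _ • (1 * _ * 1)
      have hp : 0 + 1 < n := by omega
      have s1 := G.sx_one
      have s2 := G.sy_one (by omega)
      rw [one_mul, mul_one, sig]
      simp only [add_mul, smul_mul_assoc, one_mul, h.kr 0 hp, h.rsq G.mu0 G.lam G.q0 hp]
      have q0 := G.q0
      have t2 : sy q μ 1 * (μ * q + 1) = q * (q - q⁻¹) * μ * sx q 1 := by
        rw [show q * (q - q⁻¹) * μ * sx q 1 = q * ((q - q⁻¹) * μ * sx q 1) by ring, ← s2]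
        field_simp
      change r 0 + sx q 1 • (1 + (q - q⁻¹) • r 0 - ((q - q⁻¹) * μ) • κ 0) + sy q μ 1 • μ • κ 0
        = (-q⁻¹) • (1 + sx q 1 • r 0 + sy q μ 1 • κ 0)
      rw [s1] at t2 ⊢
      generalize sy q μ 1 = y at *
      match_scalars
      all_goals try field_simp
      · ring
      · field_simp at t2
        linear_combination t2
    · set a' := asymB q μ r κ (p + 1) with ha'
      set a := asymB q μ r κ (p + 1 + 1) with ha
      have hc : Commute a' (r (p + 1)) := by
        refine (commute_asymB q μ _ (fun j hj => ?_) fun j hj => ?_).symm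
        · exact (h.comm j (p + 1) (by omega) (by omega)).symm
        · exact h.commute_kappa (by omega) (h.comm j (p + 1) (by omega) (by omega)).symm
      have hck : Commute a' (κ (p + 1)) := h.commute_kappa (by omega) hc
      have hs : a' * sig q μ r κ (p + 1 + 1) (p + 1) = sig q μ r κ (p + 1 + 1) (p + 1) * a' :=
        (((Commute.one_right a').add_right (hc.smul_right _)).add_right (hck.smul_right _)).eq
      have haa : a * a' = a := h.absorb_asymB G (by omega) (by omega) fun j hj =>
        ih (by omega) (by omega) (by omega)
      have har : a * r p = (-q⁻¹) • a := ih (by omega) (by omega) (by omega)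
      have key := h.absorb_sig_sig G (m := p + 1) (by omega) (by omega) (by omega) har
      have e : a * sig q μ r κ (p + 1 + 1) (p + 1) * a
          = (q ^ (p + 1) / nq q (p + 2)) •
            (a * sig q μ r κ (p + 1 + 1) (p + 1) * sig q μ r κ (p + 1) p * a') := by
        have ea : a = (q ^ (p + 1) / nq q (p + 2)) • (a' * sig q μ r κ (p + 1) p * a') := rfl
        refine (congrArg (a * sig q μ r κ (p + 1 + 1) (p + 1) * ·) ea).trans ?_
        rw [mul_smul_comm, ← mul_assoc, ← mul_assoc, mul_assoc a, ← hs, ← mul_assoc a, haa]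
      rw [e, smul_mul_assoc, smul_comm, mul_assoc _ a', hc.eq, ← mul_assoc, key, smul_mul_assoc]

theorem r_mul_asymB {i : ℕ} (hi : i ≤ k) (hn : i ≤ n) {j : ℕ} (hj : j + 1 < i) :
    r j * asymB q μ r κ i = (-q⁻¹) • asymB q μ r κ i := by
  have := h.opp.asymB_mul_r G hi hn hj
  rw [asymB_op] at this
  exact MulOpposite.op_injective this

theorem asymB_mul_asymB {i j : ℕ} (hi : i ≤ k) (hn : i ≤ n) (hj : j ≤ i) :
    asymB q μ r κ i * asymB q μ r κ j = asymB q μ r κ i :=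
  h.absorb_asymB G (by omega) (by omega) fun _ hl => h.asymB_mul_r G hi hn (by omega)

end BMWFam
end Absorb

section Mirror

variable {B : Type*} [Ring B] [Algebra ℂ B]

/-- The product `r 0 * r 1 * ⋯ * r (l - 1)`. -/
def chain (r : ℕ → B) : ℕ → B
  | 0 => 1
  | l + 1 => chain r l * r l

/-- The product `r (l - 1) * ⋯ * r 1 * r 0`. -/
def chainRev (r : ℕ → B) : ℕ → B
  | 0 => 1
  | l + 1 => r l * chainRev r l

theorem chain_succ (r : ℕ → B) (l : ℕ) : chain r (l + 1) = chain r l * r l := rfl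

theorem chain_succ' (r : ℕ → B) (l : ℕ) :
    chain r (l + 1) = r 0 * chain (fun j => r (j + 1)) l := by
  induction l with
  | zero => simp [chain]
  | succ l ih => rw [chain_succ, ih, mul_assoc, chain_succ]

theorem chain_mul_chainRev {r r' : ℕ → B} (l : ℕ) (h : ∀ j < l, r j * r' j = 1) :
    chain r l * chainRev r' l = 1 := by
  induction l with
  | zero => exact one_mul 1
  | succ l ih =>
    rw [chain, chainRev, mul_assoc, ← mul_assoc (r l), h l (by omega), one_mul,
      ih fun j hj => h j (by omega)]

theorem chainRev_mul_chain {r r' : ℕ → B} (l : ℕ) (h : ∀ j < l, r' j * r j = 1) :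
    chainRev r' l * chain r l = 1 := by
  induction l with
  | zero => exact one_mul 1
  | succ l ih =>
    rw [chain, chainRev, mul_assoc, ← mul_assoc _ _ (r l), ih fun j hj => h j (by omega), one_mul,
      h l (by omega)]

theorem chain_commute {r : ℕ → B} {b : B} (l : ℕ) (h : ∀ j < l, Commute b (r j)) :
    Commute b (chain r l) := by
  induction l with
  | zero => exact Commute.one_right b
  | succ l ih => exact (ih fun j hj => h j (by omega)).mul_right (h l (by omega))

theorem chain_intertwine {r s : ℕ → B} {b : B} (l : ℕ) (h : ∀ j < l, b * r j = s j * b) :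
    b * chain r l = chain s l * b := by
  induction l with
  | zero => rw [chain, chain, mul_one, one_mul]
  | succ l ih =>
    rw [chain, chain, ← mul_assoc, ih fun j hj => h j (by omega), mul_assoc, h l (by omega),
      mul_assoc]

theorem mul_chain_of_absorb {r : ℕ → B} {a : B} {z : ℂ} (l : ℕ) (h : ∀ j < l, a * r j = z • a) :
    a * chain r l = z ^ l • a := by
  induction l with
  | zero => rw [chain, mul_one, pow_zero, one_smul]
  | succ l ih =>
    rw [chain, ← mul_assoc, ih fun j hj => h j (by omega), smul_mul_assoc, h l (by omega),
      smul_smul, pow_succ]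

theorem chain_mul_of_absorb {r : ℕ → B} {a : B} {z : ℂ} (l : ℕ) (h : ∀ j < l, r j * a = z • a) :
    chain r l * a = z ^ l • a := by
  induction l with
  | zero => rw [chain, one_mul, pow_zero, one_smul]
  | succ l ih =>
    rw [chain, mul_assoc, h l (by omega), mul_smul_comm, ih fun j hj => h j (by omega),
      smul_smul, pow_succ, mul_comm]

theorem intertwine_asymB (q μ : ℂ) {r κ s ν : ℕ → B} {b : B} (i : ℕ)
    (hr : ∀ j, j + 1 < i → b * r j = s j * b) (hκ : ∀ j, j + 1 < i → b * κ j = ν j * b) :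
    b * asymB q μ r κ i = asymB q μ s ν i * b := by
  induction i using asymB.induct with
  | case1 => exact (mul_one b).trans (one_mul b).symm
  | case2 => exact (mul_one b).trans (one_mul b).symm
  | case3 i ih =>
    have h := ih (fun j hj => hr j (by omega)) (fun j hj => hκ j (by omega))
    have h1 : b * sig q μ r κ (i + 1) i = sig q μ s ν (i + 1) i * b := by
      simp only [sig, mul_add, add_mul, mul_one, one_mul, mul_smul_comm, smul_mul_assoc,
        hr i (by omega), hκ i (by omega)]
    rw [asymB_succ_succ, asymB_succ_succ, mul_smul_comm, smul_mul_assoc, ← mul_assoc, ← mul_assoc,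
      h, mul_assoc _ b, h1, ← mul_assoc, mul_assoc _ b, h, ← mul_assoc]

/-- The product `r 1 ⋯ r l * r 0 ⋯ r (l - 1)` moving two strands past `l` strands. -/
def cross (r : ℕ → B) (l : ℕ) : B := chain (fun j => r (j + 1)) l * chain r l

/-- The inverse of `cross`. -/
def crossRev (r' : ℕ → B) (l : ℕ) : B := chainRev r' l * chainRev (fun j => r' (j + 1)) l

theorem cross_mul_crossRev {r r' : ℕ → B} (l : ℕ) (h : ∀ j ≤ l, r j * r' j = 1) :
    cross r l * crossRev r' l = 1 := by
  rw [cross, crossRev, mul_assoc, ← mul_assoc _ (chainRev r' l),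
    chain_mul_chainRev l fun j hj => h j (by omega), one_mul,
    chain_mul_chainRev l fun j hj => h (j + 1) (by omega)]

theorem crossRev_mul_cross {r r' : ℕ → B} (l : ℕ) (h : ∀ j ≤ l, r' j * r j = 1) :
    crossRev r' l * cross r l = 1 := by
  rw [cross, crossRev, mul_assoc, ← mul_assoc _ _ (chain r l),
    chainRev_mul_chain l fun j hj => h (j + 1) (by omega), one_mul,
    chainRev_mul_chain l fun j hj => h j (by omega)]

namespace BMWFam

variable {q μ : ℂ} {n k : ℕ} {r r' κ : ℕ → B}
variable (h : BMWFam q μ n r r' κ)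
include h

theorem chain_mul_r {l j : ℕ} (hl : l < n) (hj : j + 1 < l) :
    chain r l * r j = r (j + 1) * chain r l := by
  induction l with
  | zero => omega
  | succ l ih =>
    rcases Nat.lt_or_ge (j + 1) l with hjl | hjl
    · rw [chain, mul_assoc, ← (h.comm j l hjl (by omega)).eq, ← mul_assoc, ih (by omega) hjl,
        mul_assoc]
    · obtain rfl : l = j + 1 := by omega
      have hc : Commute (r (j + 1)) (chain r j) :=
        chain_commute j fun s hs => (h.comm s (j + 1) (by omega) (by omega)).symm
      rw [chain, chain, mul_assoc, mul_assoc, ← mul_assoc (r j), h.braid j (by omega),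
        mul_assoc (r (j + 1)), ← mul_assoc, ← hc.eq]
      simp only [mul_assoc]

theorem chain_mul_kappa {l j : ℕ} (hl : l < n) (hj : j + 1 < l) :
    chain r l * κ j = κ (j + 1) * chain r l :=
  h.intertwine (by omega) (by omega) (h.chain_mul_r hl hj)

theorem r_mul_cross {l : ℕ} (hl : l + 1 < n) : r 0 * cross r l = cross r l * r l := by
  rw [cross, ← mul_assoc, ← chain_succ', chain_intertwine (s := fun j => r (j + 1)) l
    fun j hj => h.chain_mul_r hl (by omega), chain_succ, mul_assoc]

theorem kappa_mul_cross {l : ℕ} (hl : l + 1 < n) : κ 0 * cross r l = cross r l * κ l :=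
  (h.intertwine hl (by omega) (h.r_mul_cross hl).symm).symm

theorem cross_mul_r {l j : ℕ} (hl : l + 1 < n) (hj : j + 1 < l) :
    cross r l * r j = r (j + 2) * cross r l := by
  obtain ⟨m, rfl⟩ : ∃ m, n = m + 1 := ⟨n - 1, by omega⟩
  have h2 : chain (fun j => r (j + 1)) l * r (j + 1) = r (j + 2) * chain (fun j => r (j + 1)) l :=
    h.shift.chain_mul_r (l := l) (j := j) (by omega) hj
  rw [cross, mul_assoc, h.chain_mul_r (by omega) hj, ← mul_assoc, h2, mul_assoc]

theorem cross_mul_kappa {l j : ℕ} (hl : l + 1 < n) (hj : j + 1 < l) :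
    cross r l * κ j = κ (j + 2) * cross r l :=
  h.intertwine (by omega) (by omega) (h.cross_mul_r hl hj)

theorem cross_mul_asymB {l : ℕ} (hl : l + 1 < n) :
    cross r l * asymB q μ r κ l
      = asymB q μ (fun j => r (j + 2)) (fun j => κ (j + 2)) l * cross r l :=
  intertwine_asymB q μ l (fun _ hj => h.cross_mul_r hl hj) fun _ hj => h.cross_mul_kappa hl hj

theorem chain_mul_asymB {i : ℕ} (hi : i < n) :
    chain r i * asymB q μ r κ i
      = asymB q μ (fun j => r (j + 1)) (fun j => κ (j + 1)) i * chain r i :=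
  intertwine_asymB q μ i (fun _ hj => h.chain_mul_r hi hj) fun _ hj => h.chain_mul_kappa hi hj

variable (G : Generic q μ k)
include G

/-- Conjugation by a full chain mirrors the recursive product defining the antisymmetrizers. -/
theorem mirror_mul_chain {i : ℕ} (hi1 : 1 ≤ i) (hik : i ≤ k) (hi : i < n) (m : ℕ) :
    asymB q μ (fun j => r (j + 1)) (fun j => κ (j + 1)) i * sig q μ r κ m 0 *
        asymB q μ (fun j => r (j + 1)) (fun j => κ (j + 1)) i * chain r i
      = chain r i * (asymB q μ r κ i * sig q μ r κ m (i - 1) * asymB q μ r κ i) := by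
  obtain ⟨l, rfl⟩ : ∃ l, i = l + 1 := ⟨i - 1, by omega⟩
  set c := chain r (l + 1) with hc
  set c1 := chain (fun j => r (j + 1)) l with hc1
  set c1' := chainRev (fun j => r' (j + 1)) l with hc1'
  set c0 := chain r l with hc0
  set c0' := chainRev r' l with hc0'
  set a := asymB q μ r κ (l + 1) with ha
  set b := asymB q μ (fun j => r (j + 1)) (fun j => κ (j + 1)) (l + 1) with hb
  have hca : c * a = b * c := h.chain_mul_asymB hi
  have e0 : c = r 0 * c1 := chain_succ' r l
  have i1 : c1 * c1' = 1 := chain_mul_chainRev l fun j hj => h.inv (j + 1) (by omega)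
  have i1' : c1' * c1 = 1 := chainRev_mul_chain l fun j hj => h.inv' (j + 1) (by omega)
  have i0 : c0 * c0' = 1 := chain_mul_chainRev l fun j hj => h.inv j (by omega)
  have i0' : c0' * c0 = 1 := chainRev_mul_chain l fun j hj => h.inv' j (by omega)
  have hs0 : sig q μ r κ m 0 * r 0 = r 0 * sig q μ r κ m 0 := by
    simp only [sig, add_mul, mul_add, one_mul, mul_one, smul_mul_assoc, mul_smul_comm,
      h.kr 0 (by omega), h.rk (p := 0) (by omega)]
  have hsx : sig q μ r κ m 0 * (c1 * c0) = c1 * c0 * sig q μ r κ m l := by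
    have hr := h.r_mul_cross (l := l) (by omega)
    have hκ := h.kappa_mul_cross (l := l) (by omega)
    rw [cross, ← hc1, ← hc0] at hr hκ
    simp only [sig, add_mul, mul_add, one_mul, mul_one, smul_mul_assoc, mul_smul_comm, hr, hκ]
  have z0 : (-q⁻¹) ^ l ≠ 0 := pow_ne_zero _ (neg_ne_zero.mpr (inv_ne_zero G.q0))
  have hac : a * c0 = (-q⁻¹) ^ l • a :=
    mul_chain_of_absorb l fun j hj => h.asymB_mul_r G hik (by omega) (by omega)
  have hca0 : c0 * a = (-q⁻¹) ^ l • a :=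
    chain_mul_of_absorb l fun j hj => h.r_mul_asymB G hik (by omega) (by omega)
  have hca' : a = (-q⁻¹) ^ l • (c0' * a) := by
    rw [← mul_smul_comm, ← hca0, ← mul_assoc, i0', one_mul]
  have hsig : c1' * sig q μ r κ m 0 * c1 = c0 * sig q μ r κ m l * c0' := by
    calc c1' * sig q μ r κ m 0 * c1 = c1' * (sig q μ r κ m 0 * (c1 * c0)) * c0' := by
          simp only [mul_assoc, i0, mul_one]
      _ = _ := by rw [hsx, ← mul_assoc, ← mul_assoc, i1', one_mul]
  have hcs : sig q μ r κ m 0 * c = c * (c0 * sig q μ r κ m l * c0') := by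
    rw [← hsig, e0, ← mul_assoc, hs0, mul_assoc, mul_assoc (r 0), ← mul_assoc c1, ← mul_assoc c1,
      i1, one_mul]
  rw [mul_assoc _ b, ← hca, ← mul_assoc, mul_assoc b, hcs, ← mul_assoc, ← hca, mul_assoc c,
    ← mul_assoc a, ← mul_assoc a, hac, Nat.add_sub_cancel]
  have := congrArg (a * sig q μ r κ m l * ·) hca'
  refine Eq.trans ?_ (congrArg (c * ·) this.symm)
  simp only [smul_mul_assoc, mul_smul_comm, mul_assoc]

theorem asymB_mirror {i : ℕ} (hi1 : 1 ≤ i) (hik : i + 1 ≤ k) (hi : i < n) :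
    asymB q μ r κ (i + 1) = (q ^ i / nq q (i + 1)) •
      (asymB q μ (fun j => r (j + 1)) (fun j => κ (j + 1)) i * sig q μ r κ i 0 *
        asymB q μ (fun j => r (j + 1)) (fun j => κ (j + 1)) i) := by
  have inv1 : chain r i * chainRev r' i = 1 :=
    chain_mul_chainRev i fun j _ => h.inv j (by omega)
  have h1 := congrArg (· * chainRev r' i) (h.mirror_mul_chain G hi1 (by omega) hi i)
  simp only [mul_assoc _ (chain r i) (chainRev r' i), inv1, mul_one] at h1
  obtain ⟨l, rfl⟩ : ∃ l, i = l + 1 := ⟨i - 1, by omega⟩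
  rw [h1, Nat.add_sub_cancel]
  have z0 : (-q⁻¹) ^ (l + 1) ≠ 0 := pow_ne_zero _ (neg_ne_zero.mpr (inv_ne_zero G.q0))
  have e1 : chain r (l + 1) * asymB q μ r κ (l + 2) = (-q⁻¹) ^ (l + 1) • asymB q μ r κ (l + 2) :=
    chain_mul_of_absorb _ fun j hj => h.r_mul_asymB G hik (by omega) (by omega)
  have e2 : asymB q μ r κ (l + 2) * chain r (l + 1) = (-q⁻¹) ^ (l + 1) • asymB q μ r κ (l + 2) :=
    mul_chain_of_absorb _ fun j hj => h.asymB_mul_r G hik (by omega) (by omega)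
  have e3 : chain r (l + 1) * asymB q μ r κ (l + 2) * chainRev r' (l + 1)
      = asymB q μ r κ (l + 2) := by
    rw [e1, ← e2, mul_assoc, inv1, mul_one]
  rw [← smul_mul_assoc, ← mul_smul_comm, ← asymB_succ_succ]
  exact e3.symm

theorem mirror_eq_zero {i : ℕ} (hi1 : 1 ≤ i) (hik : i ≤ k) (hi : i < n) (m : ℕ)
    (h0 : asymB q μ r κ i * sig q μ r κ m (i - 1) * asymB q μ r κ i = 0) :
    asymB q μ (fun j => r (j + 1)) (fun j => κ (j + 1)) i * sig q μ r κ m 0 *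
        asymB q μ (fun j => r (j + 1)) (fun j => κ (j + 1)) i = 0 := by
  have inv1 : chain r i * chainRev r' i = 1 :=
    chain_mul_chainRev i fun j _ => h.inv j (by omega)
  have h1 := congrArg (· * chainRev r' i) (h.mirror_mul_chain G hi1 hik hi m)
  simpa only [mul_assoc _ (chain r i) (chainRev r' i), inv1, mul_one, h0, mul_zero,
    zero_mul] using h1

end BMWFam
end Mirror

section Instance

variable {N : ℕ} {A : Type*} [Ring A] [Algebra ℂ A] [NeZero N]

theorem lift2_one_inv {n p : ℕ} (h : p + 1 < n) {R : MatV N 2 ℂ} (hR : IsUnit R.det) :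
    (op A R p : MatV N n A) * op A R⁻¹ p = 1 := by
  rw [← op_mul h, Matrix.mul_nonsing_inv R hR, op_one h]

theorem lift2_inv_one {n p : ℕ} (h : p + 1 < n) {R : MatV N 2 ℂ} (hR : IsUnit R.det) :
    (op A R⁻¹ p : MatV N n A) * op A R p = 1 := by
  rw [← op_mul h, Matrix.nonsing_inv_mul R hR, op_one h]

/-- A relation between operators on three tensor factors holds at every position. -/
theorem op_triple {n p : ℕ} (h : p + 2 < n) {X Y : MatV N 3 ℂ} (hXY : X = Y) :
    emb (tripleEmb p h) (cmap X : MatV N 3 A) = emb (tripleEmb p h) (cmap Y) := by rw [hXY]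

theorem op_braid {n p : ℕ} (h : p + 2 < n) {R : MatV N 2 ℂ} (hR : IsBraid R) :
    (op A R p : MatV N n A) * op A R (p + 1) * op A R p
      = op A R (p + 1) * op A R p * op A R (p + 1) := by
  have := op_triple (A := A) h hR
  simp only [cmap_eq_hom, map_mul] at this
  simpa only [← cmap_eq_hom, emb_triple_op_zero, emb_triple_op_one] using this

theorem bmwFam_op {q μ : ℂ} {R : MatV N 2 ℂ} (hR : IsBraid R) (hdet : IsUnit R.det)
    (hb : IsBMW q μ R) (n : ℕ) :
    BMWFam q μ n (fun j => (op A R j : MatV N n A)) (fun j => op A R⁻¹ j)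
      (fun j => op A (bmwK q μ R) j) := by
  obtain ⟨b1, b2, b3, b4⟩ := hb
  refine ⟨fun p hp => lift2_one_inv hp hdet, fun p hp => lift2_inv_one hp hdet,
    fun p s hp hs => op_commute hp hs R R, fun p hp => op_braid hp hR, fun p hp => ?_,
    fun p hp => ?_, fun p hp => ?_, fun p hp => ?_, fun p hp => ?_⟩
  · rw [op_eq_emb hp, op_eq_emb hp, bmwK]
    simp only [cmap_eq_hom, map_mul, map_sub, map_add, map_smul, map_one]
  · have : bmwK q μ R * R = μ • bmwK q μ R := by
      rw [bmwK, smul_mul_assoc, smul_comm μ]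
      congr 1
      rw [mul_sub, sub_eq_zero, mul_smul_comm, mul_one] at b1
      exact b1.symm
    simp only [← op_mul hp, this, op_smul hp]
  · have := op_triple (A := A) hp b2
    simp only [cmap_eq_hom, map_mul] at this
    simpa only [← cmap_eq_hom, emb_triple_op_zero, emb_triple_op_one] using this
  · have := op_triple (A := A) hp b3
    simp only [cmap_eq_hom, map_mul] at this
    simpa only [← cmap_eq_hom, emb_triple_op_zero, emb_triple_op_one] using this
  · have := op_triple (A := A) hp b4
    simp only [cmap_eq_hom, map_mul] at this
    simpa only [← cmap_eq_hom, emb_triple_op_zero, emb_triple_op_one] using this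

theorem ext1_asymB {q μ : ℂ} {R K : MatV N 2 ℂ} {n i : ℕ} (hi : i ≤ n) :
    ext1 (asymB q μ (fun j => (op A R j : MatV N n A)) (fun j => op A K j) i)
      = asymB q μ (fun j => (op A R j : MatV N (n + 1) A)) (fun j => op A K j) i := by
  rw [ext1_eq_emb, map_asymB]
  refine asymB_congr q μ i (fun j hj => ?_) fun j hj => ?_
  · rw [← ext1_eq_emb, ext1_op (by omega)]
  · rw [← ext1_eq_emb, ext1_op (by omega)]

theorem cmap_asym (q μ : ℂ) (R : MatV N 2 ℂ) (i : ℕ) :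
    (cmap (asym q μ R i) : MatV N i A)
      = asymB q μ (fun j => op A R j) (fun j => op A (bmwK q μ R) j) i := by
  induction i using asymB.induct with
  | case1 => exact map_one (cmapHom _ A)
  | case2 => exact map_one (cmapHom _ A)
  | case3 i ih =>
    rw [asymB_succ_succ, ← ext1_asymB le_rfl, ← ih, asym, sig, sx, sy]
    simp only [cmap_eq_hom, map_mul, map_add, map_smul, map_one]
    simp only [← cmap_eq_hom, cmap_ext1, Nat.cast_add, Nat.cast_one]

theorem ext1_cmap_asym (q μ : ℂ) (R : MatV N 2 ℂ) (i : ℕ) :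
    ext1 (cmap (asym q μ R i) : MatV N i A)
      = asymB q μ (fun j => op A R j) (fun j => op A (bmwK q μ R) j) i := by
  rw [cmap_asym, ext1_asymB le_rfl]

theorem heightCut_asymB {q μ : ℂ} {R : MatV N 2 ℂ} {k : ℕ} (h : HeightCut q μ R k) :
    asymB q μ (fun j => (op A R j : MatV N (k + 1) A)) (fun j => op A (bmwK q μ R) j) k *
      sig q μ (fun j => (op A R j : MatV N (k + 1) A)) (fun j => op A (bmwK q μ R) j) k (k - 1) *
      asymB q μ (fun j => op A R j) (fun j => op A (bmwK q μ R) j) k = 0 := by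
  have := congrArg (cmapHom _ A) h
  simp only [map_mul, map_add, map_smul, map_one, map_zero] at this
  simp only [← cmap_eq_hom, cmap_ext1, ext1_cmap_asym] at this
  exact this

end Instance

section ChainTransport

variable {B : Type*} [Ring B] [Algebra ℂ B]

theorem chain_mul_of_twist {n : ℕ} {f r : ℕ → B}
    (h1 : ∀ p s, p + 1 < s → s + 1 < n → Commute (r p) (f s))
    (h2 : ∀ p s, p + 1 < s → s + 1 < n → Commute (f p) (r s))
    (ht : ∀ p, p + 2 < n → r (p + 1) * f p * f (p + 1) = f p * f (p + 1) * r p)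
    {l j : ℕ} (hl : l < n) (hj : j + 1 < l) :
    chain f l * r j = r (j + 1) * chain f l := by
  induction l with
  | zero => omega
  | succ l ih =>
    rcases Nat.lt_or_ge (j + 1) l with hjl | hjl
    · rw [chain, mul_assoc, ← (h1 j l hjl (by omega)).eq, ← mul_assoc, ih (by omega) hjl, mul_assoc]
    · obtain rfl : l = j + 1 := by omega
      have hc : Commute (r (j + 1)) (chain f j) :=
        chain_commute j fun s hs => (h2 s (j + 1) (by omega) (by omega)).symm
      rw [chain, chain, mul_assoc, mul_assoc, ← mul_assoc (f j), ← ht j (by omega), ← mul_assoc,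
        ← mul_assoc, ← hc.eq]
      simp only [mul_assoc]

end ChainTransport

section Shift

variable {N : ℕ} {A : Type*} [Ring A] [Algebra ℂ A] [NeZero N]

/-- A relation `X₁ Y₂ Z₁ = X'₁ ⋯` between products of three neighbouring two-factor operators
transports to all positions. -/
theorem op_rel_101 {n p : ℕ} (h : p + 2 < n) {X Y Z U V W : MatV N 2 ℂ}
    (hX : lift2 (n := 3) 1 X * lift2 0 Y * lift2 1 Z = lift2 0 U * lift2 1 V * lift2 0 W) :
    (op A X (p + 1) : MatV N n A) * op A Y p * op A Z (p + 1)
      = op A U p * op A V (p + 1) * op A W p := by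
  have := op_triple (A := A) h hX
  simp only [cmap_eq_hom, map_mul] at this
  simpa only [← cmap_eq_hom, emb_triple_op_zero, emb_triple_op_one] using this

/-- The relation saying that conjugation by `F₁ F₂` moves `X` one step to the right. -/
def Movable (F X : MatV N 2 ℂ) : Prop :=
  lift2 (n := 3) 1 X * lift2 0 F * lift2 1 F = lift2 0 F * lift2 1 F * lift2 0 X

variable (A) in
/-- The right shift of operators on `V^{⊗ n}` by conjugation with `F₁ ⋯ F_n`. -/
noncomputable def shiftF {F : MatV N 2 ℂ} (hF : IsUnit F.det) (n : ℕ) :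
    MatV N n A →ₐ[ℂ] MatV N (n + 1) A :=
  AlgHom.ofLinearMap
    { toFun := fun X => chain (fun j => op A F j) n * ext1 X * chainRev (fun j => op A F⁻¹ j) n
      map_add' := fun X Y => by
        rw [ext1_eq_emb, ext1_eq_emb, ext1_eq_emb, map_add, mul_add, add_mul]
      map_smul' := fun c X => by
        rw [ext1_eq_emb, ext1_eq_emb, map_smul, mul_smul_comm, smul_mul_assoc]; rfl }
    (by
      change chain _ n * ext1 (1 : MatV N n A) * chainRev _ n = 1
      rw [ext1_eq_emb, map_one, mul_one]
      exact chain_mul_chainRev n fun j hj => lift2_one_inv (by omega) hF)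
    (fun X Y => by
      change chain _ n * ext1 (X * Y) * chainRev _ n
        = chain _ n * ext1 X * chainRev _ n * (chain _ n * ext1 Y * chainRev _ n)
      have h1 : chainRev (fun j => (op A F⁻¹ j : MatV N (n + 1) A)) n
          * chain (fun j => op A F j) n = 1 :=
        chainRev_mul_chain n fun j hj => lift2_inv_one (by omega) hF
      rw [ext1_eq_emb, ext1_eq_emb, ext1_eq_emb, map_mul]
      simp only [mul_assoc]
      rw [← mul_assoc (chainRev _ n) (chain _ n), h1, one_mul])

variable {F : MatV N 2 ℂ} (hF : IsUnit F.det)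

theorem shiftF_apply (n : ℕ) (X : MatV N n A) :
    shiftF A hF n X = chain (fun j => op A F j) n * ext1 X * chainRev (fun j => op A F⁻¹ j) n :=
  rfl

theorem shiftF_eq_of_intertwine {n : ℕ} {X : MatV N n A} {Y : MatV N (n + 1) A}
    (h : chain (fun j => (op A F j : MatV N (n + 1) A)) n * ext1 X
      = Y * chain (fun j => op A F j) n) : shiftF A hF n X = Y := by
  rw [shiftF_apply, h, mul_assoc, chain_mul_chainRev n fun j hj => lift2_one_inv (by omega) hF,
    mul_one]

theorem shiftF_op {X : MatV N 2 ℂ} (hX : Movable F X) {n j : ℕ} (hj : j + 1 < n) :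
    shiftF A hF n (op A X j) = op A X (j + 1) := by
  refine shiftF_eq_of_intertwine hF ?_
  rw [ext1_op hj]
  exact chain_mul_of_twist (n := n + 1) (f := fun j => (op A F j : MatV N (n + 1) A))
    (r := fun j => op A X j) (fun p s hp hs => op_commute hp hs X F)
    (fun p s hp hs => op_commute hp hs F X) (fun p hp => op_rel_101 hp hX) (by omega) hj

theorem Movable.inv {X : MatV N 2 ℂ} (hX : Movable F X) (hXd : IsUnit X.det) : Movable F X⁻¹ := by
  have h0 : (lift2 (n := 3) 0 X : MatV N 3 ℂ) * lift2 0 X⁻¹ = 1 := by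
    rw [lift2_eq_emb (by omega), lift2_eq_emb (by omega), ← map_mul,
      Matrix.mul_nonsing_inv X hXd, map_one]
  have h1 : (lift2 (n := 3) 1 X⁻¹ : MatV N 3 ℂ) * lift2 1 X = 1 := by
    rw [lift2_eq_emb (by omega), lift2_eq_emb (by omega), ← map_mul,
      Matrix.nonsing_inv_mul X hXd, map_one]
  unfold Movable at *
  calc lift2 (n := 3) 1 X⁻¹ * lift2 0 F * lift2 1 F
      = lift2 1 X⁻¹ * (lift2 0 F * lift2 1 F * lift2 0 X) * lift2 0 X⁻¹ := by
        simp only [mul_assoc, h0, mul_one]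
    _ = lift2 0 F * lift2 1 F * lift2 0 X⁻¹ := by
        rw [← hX]; simp only [← mul_assoc, h1, one_mul]

theorem Movable.bmwK {X : MatV N 2 ℂ} (hX : Movable F X) (q μ : ℂ) :
    Movable F (QMA.bmwK q μ X) := by
  unfold Movable QMA.bmwK at *
  have e0 := lift2_eq_emb (n := 3) (p := 0) (by omega) X
  have e1 := lift2_eq_emb (n := 3) (p := 1) (by omega) X
  rw [e0, e1] at hX
  rw [lift2_eq_emb (n := 3) (p := 0) (by omega) ((μ⁻¹ * (q - q⁻¹)⁻¹) • _),
    lift2_eq_emb (n := 3) (p := 1) (by omega) ((μ⁻¹ * (q - q⁻¹)⁻¹) • _)]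
  simp only [map_smul, map_mul, map_sub, map_add, map_one]
  generalize emb (pairEmb 0 _) X = x0 at *
  generalize emb (pairEmb 1 _) X = x1 at *
  rw [mul_assoc] at hX
  rw [mul_assoc]
  generalize lift2 (n := 3) 0 F * lift2 1 F = C at *
  have hX1 : (q⁻¹ • (1 : MatV N 3 ℂ) + x1) * C = C * (q⁻¹ • 1 + x0) := by
    rw [add_mul, mul_add, hX, smul_mul_assoc, mul_smul_comm, one_mul, mul_one]
  have hX2 : (q • (1 : MatV N 3 ℂ) - x1) * C = C * (q • 1 - x0) := by
    rw [sub_mul, mul_sub, hX, smul_mul_assoc, mul_smul_comm, one_mul, mul_one]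
  rw [smul_mul_assoc, mul_smul_comm, mul_assoc, hX1, ← mul_assoc, hX2, mul_assoc]

theorem Movable.self (hb : IsBraid F) : Movable F F := hb.symm

theorem shiftF_lift1 (n : ℕ) (M : Matrix (Fin N) (Fin N) A) :
    shiftF A hF (n + 1) (lift1 0 M) = Mcopy F M 1 := by
  refine shiftF_eq_of_intertwine hF ?_
  rw [ext1_lift1 (by omega), Mcopy, Mcopy, chain_succ', mul_assoc]
  have hc : Commute (lift1 0 M : MatV N (n + 2) A) (chain (fun j => op A F (j + 1)) n) :=
    chain_commute n fun j hj => lift1_zero_commute_op (by omega) (by omega) M F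
  rw [← hc.eq, ← mul_assoc, ← mul_assoc]
  congr 1
  have := lift2_inv_one (A := A) (n := n + 2) (p := 0) (by omega) hF
  rw [mul_assoc (_ * _), this, mul_one]

theorem shiftF_Mcopy (hb : IsBraid F) (M : Matrix (Fin N) (Fin N) A) {n j : ℕ} (hj : j < n) :
    shiftF A hF n (Mcopy F M j) = Mcopy F M (j + 1) := by
  induction j with
  | zero => obtain ⟨m, rfl⟩ : ∃ m, n = m + 1 := ⟨n - 1, by omega⟩; exact shiftF_lift1 hF m M
  | succ j ih =>
    have e1 := shiftF_op (A := A) hF (Movable.self hb) hj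
    have e2 := shiftF_op (A := A) hF ((Movable.self hb).inv hF) hj
    rw [Mcopy, map_mul, map_mul, ih (by omega), e1, e2]; rfl

theorem Mprod_succ' (hb : IsBraid F) (M : Matrix (Fin N) (Fin N) A) {n j : ℕ} (hj : j ≤ n) :
    (Mprod F M (j + 1) : MatV N (n + 1) A) = lift1 0 M * shiftF A hF n (Mprod F M j) := by
  induction j with
  | zero => rw [Mprod, Mprod, Mprod, Mcopy, map_one, one_mul, mul_one]
  | succ j ih =>
    rw [Mprod, ih (by omega), Mprod, map_mul, shiftF_Mcopy hF hb M (by omega), mul_assoc]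

theorem ext1_Mcopy (M : Matrix (Fin N) (Fin N) A) {n j : ℕ} (hj : j < n) :
    ext1 (Mcopy F M j : MatV N n A) = Mcopy F M j := by
  induction j with
  | zero => exact ext1_lift1 hj M
  | succ j ih =>
    have e1 := ext1_op (A := A) hj F
    have e2 := ext1_op (A := A) hj F⁻¹
    rw [ext1_eq_emb] at e1 e2 ih ⊢
    rw [Mcopy, Mcopy, map_mul, map_mul, ih (by omega), e1, e2]

theorem ext1_Mprod (M : Matrix (Fin N) (Fin N) A) {n j : ℕ} (hj : j ≤ n) :
    ext1 (Mprod F M j : MatV N n A) = Mprod F M j := by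
  induction j with
  | zero => rw [Mprod, Mprod, ext1_eq_emb, map_one]
  | succ j ih =>
    rw [Mprod, Mprod, ← ih (by omega), ← ext1_Mcopy M hj]
    simp only [ext1_eq_emb, map_mul]

theorem op_commute_Mcopy_of_lt (X : MatV N 2 ℂ) (M : Matrix (Fin N) (Fin N) A) {n i j : ℕ}
    (hij : j < i) (hi : i + 1 < n) : Commute (op A X i : MatV N n A) (Mcopy F M j) := by
  induction j with
  | zero => exact (lift1_zero_commute_op (by omega) hi M X).symm
  | succ j ih =>
    exact ((op_commute hij hi F X).symm.mul_right (ih (by omega))).mul_right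
      (op_commute hij hi F⁻¹ X).symm

include hF in
theorem op_commute_Mcopy_of_gt {X : MatV N 2 ℂ}
    (hX : lift2 (n := 3) 0 X * lift2 1 F * lift2 0 F = lift2 1 F * lift2 0 F * lift2 1 X)
    (M : Matrix (Fin N) (Fin N) A) {n i j : ℕ}
    (hij : i + 2 ≤ j) (hj : j < n) : Commute (op A X i : MatV N n A) (Mcopy F M j) := by
  induction j, hij using Nat.le_induction with
  | base =>
    have h0 := lift2_inv_one (A := A) (n := n) (p := i) (by omega) hF
    have h0' := lift2_one_inv (A := A) (n := n) (p := i) (by omega) hF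
    have h1 := lift2_inv_one (A := A) (n := n) (p := i + 1) (by omega) hF
    have h1' := lift2_one_inv (A := A) (n := n) (p := i + 1) (by omega) hF
    have e : (op A X i : MatV N n A) * op A F (i + 1) * op A F i
        = op A F (i + 1) * op A F i * op A X (i + 1) := by
      have := op_triple (A := A) (n := n) (p := i) hj hX
      simp only [cmap_eq_hom, map_mul] at this
      simpa only [← cmap_eq_hom, emb_triple_op_zero, emb_triple_op_one] using this
    have hc : Commute (op A X (i + 1) : MatV N n A) (Mcopy F M i) :=
      op_commute_Mcopy_of_lt X M (by omega) hj
    have e' : op A X (i + 1) * (op A F⁻¹ i * op A F⁻¹ (i + 1) : MatV N n A)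
        = op A F⁻¹ i * op A F⁻¹ (i + 1) * op A X i := by
      calc op A X (i + 1) * (op A F⁻¹ i * op A F⁻¹ (i + 1) : MatV N n A)
          = op A F⁻¹ i * op A F⁻¹ (i + 1) * (op A F (i + 1) * op A F i * op A X (i + 1))
              * (op A F⁻¹ i * op A F⁻¹ (i + 1)) := by
            simp only [mul_assoc]
            rw [← mul_assoc (op A F⁻¹ (i + 1)) (op A F (i + 1)), h1, one_mul,
              ← mul_assoc (op A F⁻¹ i) (op A F i), h0, one_mul]
        _ = _ := by
            rw [← e]
            simp only [mul_assoc]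
            rw [← mul_assoc (op A F i) (op A F⁻¹ i), h0', one_mul, h1', mul_one]
    change op A X i * (op A F (i + 1) * (op A F i * Mcopy F M i * op A F⁻¹ i) * op A F⁻¹ (i + 1))
      = op A F (i + 1) * (op A F i * Mcopy F M i * op A F⁻¹ i) * op A F⁻¹ (i + 1) * op A X i
    calc _ = (op A X i * op A F (i + 1) * op A F i) * Mcopy F M i
              * (op A F⁻¹ i * op A F⁻¹ (i + 1)) := by simp only [mul_assoc]
      _ = (op A F (i + 1) * op A F i) * (op A X (i + 1) * Mcopy F M i)
              * (op A F⁻¹ i * op A F⁻¹ (i + 1)) := by rw [e]; simp only [mul_assoc]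
      _ = (op A F (i + 1) * op A F i * Mcopy F M i) * (op A X (i + 1)
              * (op A F⁻¹ i * op A F⁻¹ (i + 1))) := by rw [hc.eq]; simp only [mul_assoc]
      _ = _ := by rw [e']; simp only [mul_assoc]
  | succ j hij ih =>
    exact ((op_commute hij (by omega) X F).mul_right (ih (by omega))).mul_right
      (op_commute hij (by omega) X F⁻¹)

theorem op_mul_Mcopy_zero {R : MatV N 2 ℂ} {M : Matrix (Fin N) (Fin N) A} (hM : QMArel R F M)
    {n : ℕ} (hn : 2 ≤ n) : Commute (op A R 0 : MatV N n A) (Mcopy F M 0 * Mcopy F M 1) := by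
  induction n, hn using Nat.le_induction with
  | base => exact (mul_assoc _ _ _).symm.trans hM
  | succ n hn ih =>
    have := ih.map (emb (A := A) (Fin.castSuccEmb (n := n)))
    simpa only [map_mul, ← ext1_eq_emb, ext1_op (A := A) (show 0 + 1 < n by omega) R,
      ext1_Mcopy M (show 0 < n by omega), ext1_Mcopy M (show 1 < n by omega)] using this

include hF in
theorem op_commute_Mcopy_mul {R : MatV N 2 ℂ} {M : Matrix (Fin N) (Fin N) A} (hM : QMArel R F M)
    (hb : IsBraid F) (hR : Movable F R) {n i : ℕ} (hi : i + 1 < n) :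
    Commute (op A R i : MatV N n A) (Mcopy F M i * Mcopy F M (i + 1)) := by
  induction i generalizing n with
  | zero => exact op_mul_Mcopy_zero hM hi
  | succ i ih =>
    obtain ⟨m, rfl⟩ : ∃ m, n = m + 1 := ⟨n - 1, by omega⟩
    have := (ih (n := m) (by omega)).map (shiftF A hF m)
    rwa [map_mul, shiftF_op hF hR (by omega), shiftF_Mcopy hF hb M (by omega),
      shiftF_Mcopy hF hb M (by omega)] at this

include hF in
theorem op_commute_Mprod {R : MatV N 2 ℂ} {M : Matrix (Fin N) (Fin N) A} (hM : QMArel R F M)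
    (hb : IsBraid F) (hc : Compatible R F) {n i j : ℕ} (hi : i + 1 < j) (hj : j ≤ n) :
    Commute (op A R i : MatV N n A) (Mprod F M j) := by
  induction j, hi using Nat.le_induction with
  | base =>
    have h1 : Commute (op A R i : MatV N n A) (Mprod F M i) := by
      have : ∀ s ≤ i, Commute (op A R i : MatV N n A) (Mprod F M s) := by
        intro s hs
        induction s with
        | zero => exact Commute.one_right _
        | succ s ih =>
          exact (ih (by omega)).mul_right (op_commute_Mcopy_of_lt R M (by omega) (by omega))
      exact this i le_rfl
    change Commute _ (Mprod F M i * Mcopy F M i * Mcopy F M (i + 1))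
    rw [mul_assoc]
    exact h1.mul_right (op_commute_Mcopy_mul hF hM hb hc.2 (by omega))
  | succ j hij ih =>
    exact (ih (by omega)).mul_right (op_commute_Mcopy_of_gt hF hc.1 M (by omega) (by omega))

theorem ptrace_shiftF {R Ψ : MatV N 2 ℂ} (hΨ : SkewPair R Ψ) (hR : Movable F R) {n : ℕ}
    (X : MatV N (n + 1) A) :
    ptrace (cmap (Dof Ψ)) (shiftF A hF (n + 1) X)
      = shiftF A hF n (ptrace (cmap (Dof Ψ)) X) := by
  have e1 : chain (fun j => (op A F j : MatV N (n + 2) A)) n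
      = ext1 (chain (fun j => (op A F j : MatV N (n + 1) A)) n) := by
    have : ∀ l ≤ n, chain (fun j => (op A F j : MatV N (n + 2) A)) l
      = ext1 (chain (fun j => (op A F j : MatV N (n + 1) A)) l) := by
      intro l hl
      induction l with
      | zero => rw [chain, chain, ext1_eq_emb, map_one]
      | succ l ih =>
        rw [chain, chain, ih (by omega), ← ext1_op (A := A) (n := n + 1) (by omega) F]
        simp only [ext1_eq_emb, map_mul]
    exact this n le_rfl
  have e2 : chainRev (fun j => (op A F⁻¹ j : MatV N (n + 2) A)) n
      = ext1 (chainRev (fun j => (op A F⁻¹ j : MatV N (n + 1) A)) n) := by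
    have : ∀ l ≤ n, chainRev (fun j => (op A F⁻¹ j : MatV N (n + 2) A)) l
      = ext1 (chainRev (fun j => (op A F⁻¹ j : MatV N (n + 1) A)) l) := by
      intro l hl
      induction l with
      | zero => rw [chainRev, chainRev, ext1_eq_emb, map_one]
      | succ l ih =>
        rw [chainRev, chainRev, ih (by omega), ← ext1_op (A := A) (n := n + 1) (by omega) F⁻¹]
        simp only [ext1_eq_emb, map_mul]
    exact this n le_rfl
  rw [shiftF_apply, shiftF_apply, chain_succ, chainRev, e1, e2, mul_assoc,
    ← mul_assoc _ (op A F⁻¹ n),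
    ← mul_assoc, ptrace_mul_ext1, mul_assoc (ext1 _), mul_assoc, ptrace_ext1_mul,
    ← mul_assoc (op A F n), ptrace_conj hΨ (Matrix.nonsing_inv_mul F hF)
      (Matrix.mul_nonsing_inv F hF) hR, mul_assoc]

end Shift

section RankOne

variable {N : ℕ} [NeZero N]

theorem lift2_zero_three {A : Type*} [Semiring A] (X : MatV N 2 A) (a b c d e f : Fin N) :
    lift2 (n := 3) 0 X ![a, b, c] ![d, e, f] = if c = f then X ![a, b] ![d, e] else 0 := by
  simp [lift2, idx, Fin.forall_fin_succ]

theorem lift2_one_three {A : Type*} [Semiring A] (X : MatV N 2 A) (a b c d e f : Fin N) :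
    lift2 (n := 3) 1 X ![a, b, c] ![d, e, f] = if a = d then X ![b, c] ![e, f] else 0 := by
  simp [lift2, idx, Fin.forall_fin_succ]

theorem sum_fin_three {M : Type*} [AddCommMonoid M] (φ : (Fin 3 → Fin N) → M) :
    ∑ e, φ e = ∑ u, ∑ v, ∑ w, φ ![u, v, w] := by
  rw [sum_snoc, sum_fin_two]
  refine Finset.sum_congr rfl fun u _ => Finset.sum_congr rfl fun v _ =>
    Finset.sum_congr rfl fun w _ => congrArg φ ?_
  funext i; fin_cases i <;> rfl

theorem contraction_entries {R K : MatV N 2 ℂ}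
    (h : lift2 (n := 3) 1 K * lift2 0 K = lift2 1 K * lift2 0 R * lift2 1 R)
    (x1 x2 x3 y1 y2 y3 : Fin N) :
    ∑ c, K ![x2, x3] ![c, y3] * K ![x1, c] ![y1, y2]
      = ∑ e, ∑ d, ∑ c, K ![x2, x3] ![c, d] * R ![x1, c] ![y1, e] * R ![e, d] ![y2, y3] := by
  have := congrFun (congrFun h ![x1, x2, x3]) ![y1, y2, y3]
  simpa [Matrix.mul_apply, sum_fin_three, lift2_zero_three, lift2_one_three, Finset.sum_mul]
    using this

theorem exists_transport {R K Ψ : MatV N 2 ℂ} (hΨ : SkewPair R Ψ)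
    (h : lift2 (n := 3) 1 K * lift2 0 K = lift2 1 K * lift2 0 R * lift2 1 R) (b1 b2 : Fin N) :
    ∃ W : Matrix (Fin N) (Fin N) ℂ, ∀ (α : Fin 2 → Fin N) (a y : Fin N),
      ∑ c, W a c * K α ![c, y] = if a = y then K α ![b1, b2] else 0 := by
  refine ⟨Matrix.of fun a c => ∑ e, ∑ y2, ∑ x1, ∑ y1,
    Ψ ![e, y1] ![b1, x1] * Ψ ![a, y2] ![b2, e] * K ![x1, c] ![y1, y2], fun α a y => ?_⟩
  rw [← fun_fin_two_eq α]
  generalize α 0 = x2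
  generalize α 1 = x3
  have step1 : ∀ e' y2 y3, ∑ y1, ∑ x1, Ψ ![e', y1] ![b1, x1] *
      (∑ c, K ![x2, x3] ![c, y3] * K ![x1, c] ![y1, y2])
      = ∑ d, K ![x2, x3] ![b1, d] * R ![e', d] ![y2, y3] := by
    intro e' y2 y3
    simp only [contraction_entries h]
    calc _ = ∑ e, ∑ d, ∑ c, (∑ y1, ∑ x1, Ψ ![e', y1] ![b1, x1] * R ![x1, c] ![y1, e]) *
          (K ![x2, x3] ![c, d] * R ![e, d] ![y2, y3]) := by
          simp only [Finset.mul_sum, Finset.sum_mul]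
          simp only [← Fintype.sum_prod_type']
          refine Fintype.sum_equiv
            (⟨fun p => (p.2.2.1, p.2.2.2.1, p.2.2.2.2, p.1, p.2.1),
              fun p => (p.2.2.2.1, p.2.2.2.2, p.1, p.2.1, p.2.2.1),
              fun _ => rfl, fun _ => rfl⟩ :
              Fin N × Fin N × Fin N × Fin N × Fin N ≃ Fin N × Fin N × Fin N × Fin N × Fin N)
            _ _ fun p => ?_
          simp only [Equiv.coe_fn_mk]; ring
      _ = _ := by
          simp only [hΨ.2, ite_mul, one_mul, zero_mul, ite_and]
          simp
  have step2 : ∑ y2, ∑ e, Ψ ![a, y2] ![b2, e] *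
      (∑ d, K ![x2, x3] ![b1, d] * R ![e, d] ![y2, y]) = if a = y then K ![x2, x3] ![b1, b2] else 0 := by
    calc _ = ∑ d, (∑ y2, ∑ e, Ψ ![a, y2] ![b2, e] * R ![e, d] ![y2, y]) * K ![x2, x3] ![b1, d] := by
          simp only [Finset.mul_sum, Finset.sum_mul]
          simp only [← Fintype.sum_prod_type']
          refine Fintype.sum_equiv
            (⟨fun p => (p.2.2, p.1, p.2.1),
              fun p => (p.2.1, p.2.2, p.1),
              fun _ => rfl, fun _ => rfl⟩ :
              Fin N × Fin N × Fin N ≃ Fin N × Fin N × Fin N)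
            _ _ fun p => ?_
          simp only [Equiv.coe_fn_mk]; ring
      _ = _ := by
          simp only [hΨ.2, ite_mul, one_mul, zero_mul, ite_and]
          simp
  rw [← step2]
  simp only [← step1, Matrix.of_apply, Finset.mul_sum, Finset.sum_mul]
  simp only [← Fintype.sum_prod_type']
  refine Fintype.sum_equiv
            (⟨fun p => (p.2.2.1, p.2.1, p.2.2.2.2, p.2.2.2.1, p.1),
              fun p => (p.2.2.2.2, p.2.1, p.1, p.2.2.2.1, p.2.2.1),
              fun _ => rfl, fun _ => rfl⟩ :
              Fin N × Fin N × Fin N × Fin N × Fin N ≃ Fin N × Fin N × Fin N × Fin N × Fin N)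
            _ _ fun p => ?_
  simp only [Equiv.coe_fn_mk]; ring

/-- A nonzero contractor has rank one, and its rows are nondegenerate bilinear forms. -/
theorem contractor_rank_one {R K Ψ : MatV N 2 ℂ} (hΨ : SkewPair R Ψ)
    (h : lift2 (n := 3) 1 K * lift2 0 K = lift2 1 K * lift2 0 R * lift2 1 R) (hK : K ≠ 0) :
    ∃ (e f : (Fin 2 → Fin N) → ℂ) (w : Matrix (Fin N) (Fin N) ℂ),
      (∀ a b, K a b = e a * f b) ∧ (∃ a, e a = 1) ∧
      ∀ a y, ∑ c, w a c * f ![c, y] = if a = y then 1 else 0 := by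
  obtain ⟨α, β, hαβ⟩ : ∃ α β, K α β ≠ 0 := by
    by_contra! hc
    exact hK (by ext a b; exact hc a b)
  rw [← fun_fin_two_eq β] at hαβ
  obtain ⟨W, hW⟩ := exists_transport hΨ h (β 0) (β 1)
  set z := K α ![β 0, β 1] with hz
  have hinv : ∀ γ a y, ∑ c, (z⁻¹ • W) a c * K γ ![c, y]
      = if a = y then z⁻¹ * K γ ![β 0, β 1] else 0 := by
    intro γ a y
    simp only [Matrix.smul_apply, smul_eq_mul, mul_assoc, ← Finset.mul_sum, hW, mul_ite, mul_zero]
  have hm : (z⁻¹ • W) * (Matrix.of fun c y => K α ![c, y]) = 1 := by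
    ext a y
    rw [Matrix.mul_apply, Matrix.one_apply]
    simp only [Matrix.of_apply, hinv, ← hz, inv_mul_cancel₀ hαβ]
  have hm' := mul_eq_one_comm.mp hm
  refine ⟨fun γ => z⁻¹ * K γ ![β 0, β 1], fun b => K α b, z⁻¹ • W, fun γ b => ?_, ⟨α, ?_⟩, ?_⟩
  · have hγ : (z⁻¹ • W) * (Matrix.of fun c y => K γ ![c, y])
        = (z⁻¹ * K γ ![β 0, β 1]) • (1 : Matrix (Fin N) (Fin N) ℂ) := by
      ext a y
      rw [Matrix.mul_apply, Matrix.smul_apply, Matrix.one_apply]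
      simp only [Matrix.of_apply, hinv, smul_eq_mul, mul_ite, mul_one, mul_zero]
    have := congrArg ((Matrix.of fun c y => K α ![c, y]) * ·) hγ
    simp only [← mul_assoc, hm', one_mul, mul_smul_comm, mul_one] at this
    have := congrFun (congrFun this (b 0)) (b 1)
    simpa only [Matrix.of_apply, Matrix.smul_apply, fun_fin_two_eq, smul_eq_mul] using this
  · exact inv_mul_cancel₀ hαβ
  · intro a y
    rw [hinv, ← hz, inv_mul_cancel₀ hαβ]

end RankOne

section Contractor

variable {N : ℕ} {A : Type*} [Ring A] [Algebra ℂ A] [NeZero N]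

theorem cmap_complex {m : Type*} (X : Matrix m m ℂ) : (cmap X : Matrix m m ℂ) = X := by
  ext; simp [cmap]

theorem op_two (X : MatV N 2 ℂ) : (op A X 0 : MatV N 2 A) = cmap X := by rw [op, lift2_self]

theorem ptrace_cmap (D : Matrix (Fin N) (Fin N) ℂ) {n : ℕ} (X : MatV N (n + 1) ℂ) :
    ptrace (cmap D) (cmap X : MatV N (n + 1) A) = cmap (ptrace D X) := by
  ext a b
  simp [ptrace, cmap, map_sum]

theorem ptrace_op_eq_emb (D : Matrix (Fin N) (Fin N) ℂ) (X : MatV N 2 ℂ) (n : ℕ) :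
    ptrace (cmap D) (op A X n : MatV N (n + 2) A)
      = emb (oneEmb n (by omega)) (cmap (ptrace D X)) := by
  rw [op_eq_emb (by omega), ← ptrace_cmap]
  refine ptrace_emb D _ _ (fun i => ?_) ?_ _
  · obtain rfl : i = 0 := Subsingleton.elim _ _
    rfl
  · rfl

theorem emb_one_last_apply (Y : MatV N 1 A) (a b c d : Fin N) :
    emb (oneEmb (n := 2) 1 (by omega)) Y ![a, b] ![c, d]
      = if a = c then Y (fun _ => b) (fun _ => d) else 0 := by
  rw [emb_apply]
  refine if_congr ?_ ?_ rfl
  · constructor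
    · intro h
      refine h 0 ?_
      rw [mem_range_oneEmb]; decide
    · rintro rfl i hi
      rw [mem_range_oneEmb] at hi
      fin_cases i
      · rfl
      · exact absurd rfl hi
  · rfl

variable {q μ : ℂ} {R Ψ : MatV N 2 ℂ}
  (hq0 : q ≠ 0) (hq : q - q⁻¹ ≠ 0) (hμ : μ ≠ 0)
  (hR : IsBraid R) (hdet : IsUnit R.det) (hb : IsBMW q μ R) (hΨ : SkewPair R Ψ)

include hq0 hq hμ hR hdet hb hΨ

theorem ptrace_contractor_base (hK : bmwK q μ R ≠ 0) :
    ptrace (Dof Ψ) (bmwK q μ R) = μ • 1 := by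
  obtain ⟨e, f, w, hef, ⟨α, hα⟩, hw⟩ := contractor_rank_one hΨ hb.2.1 hK
  have fam := bmwFam_op (A := ℂ) hR hdet hb 3
  have h := congrArg (ptrace (cmap (Dof Ψ))) (fam.k_r_r (p := 0) (by omega))
  simp only [zero_add] at h
  rw [← ext1_op (A := ℂ) (n := 2) (p := 0) (by omega) R,
    ← ext1_op (A := ℂ) (n := 2) (p := 0) (by omega) (bmwK q μ R), ptrace_mul_ext1, ptrace_ext1_mul,
    ptrace_ext1_mul, ptrace_op_last hΨ, mul_one, ptrace_op_eq_emb,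
    (bmwFam_op (A := ℂ) hR hdet hb 2).kr 0 (by omega), op_two, cmap_complex, cmap_complex] at h
  ext a b
  have hab := fun c => congrFun (congrFun h α) ![c, b 0]
  have key : ∀ c, μ * f ![c, b 0]
      = ∑ y, f ![c, y] * ptrace (Dof Ψ) (bmwK q μ R) (fun _ => y) (fun _ => b 0) := by
    intro c
    have := hab c
    simpa [Matrix.mul_apply, sum_fin_two, emb_one_last_apply, hef, hα] using this
  have h2 : ∑ c, w (a 0) c * (μ * f ![c, b 0])
      = ∑ y, (∑ c, w (a 0) c * f ![c, y]) *
        ptrace (Dof Ψ) (bmwK q μ R) (fun _ => y) (fun _ => b 0) := by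
    simp only [key, Finset.mul_sum, Finset.sum_mul, mul_assoc]
    exact Finset.sum_comm
  have e1 : ∀ c : Fin 1 → Fin N, (fun _ => c 0) = c := fun c => by
    funext i; rw [Subsingleton.elim i 0]
  simp only [mul_left_comm _ μ, ← Finset.mul_sum, hw, ite_mul, one_mul, zero_mul,
    Finset.sum_ite_eq, Finset.mem_univ, if_true, e1] at h2
  rw [← h2, Matrix.smul_apply, Matrix.one_apply, smul_eq_mul]
  congr 1
  refine if_congr ⟨fun h => ?_, fun h => congrFun h 0⟩ rfl rfl
  rw [← e1 a, ← e1 b, h]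

theorem ptrace_contractor (hK : bmwK q μ R ≠ 0) (n : ℕ) :
    ptrace (cmap (Dof Ψ)) (op A (bmwK q μ R) n : MatV N (n + 2) A) = μ • 1 := by
  rw [ptrace_op_eq_emb, ptrace_contractor_base hq0 hq hμ hR hdet hb hΨ hK]
  simp only [cmap_eq_hom, map_smul, map_one]

theorem ptrace_one (hK : bmwK q μ R ≠ 0) (n : ℕ) :
    ptrace (cmap (Dof Ψ)) (1 : MatV N (n + 1) A) = (μ * loopVal q μ) • 1 := by
  have ext1_one : ∀ m, ext1 (1 : MatV N m A) = 1 := fun m => by rw [ext1_eq_emb, map_one]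
  have hs : ∀ m, ptrace (cmap (Dof Ψ)) (1 : MatV N (m + 1) A)
      = (Dof Ψ).trace • (1 : MatV N m A) := by
    intro m
    ext a b
    rw [ptrace_cmap_apply, ← ext1_one m]
    simp [ext1_snoc, Matrix.trace, Finset.sum_smul]
  have fam := bmwFam_op (A := ℂ) hR hdet hb 3
  have h := congrArg (ptrace (cmap (Dof Ψ))) (fam.kkk 0 (by omega))
  simp only [zero_add] at h
  have e0 := ext1_op (A := ℂ) (n := 2) (p := 0) (by omega) (bmwK q μ R)
  have hs' : ptrace (cmap (Dof Ψ)) (op ℂ (bmwK q μ R) 0 : MatV N 3 ℂ)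
      = (Dof Ψ).trace • op ℂ (bmwK q μ R) 0 := by
    rw [← e0, ← mul_one (ext1 _), ptrace_ext1_mul]
    have : ptrace (cmap (Dof Ψ)) (1 : MatV N 3 ℂ) = (Dof Ψ).trace • (1 : MatV N 2 ℂ) := by
      ext a b
      rw [ptrace_cmap_apply, ← (by rw [ext1_eq_emb, map_one] : ext1 (1 : MatV N 2 ℂ) = 1)]
      simp [ext1_snoc, Matrix.trace, Finset.sum_mul]
    rw [this, mul_smul_comm, mul_one]
  rw [hs', ← e0, ptrace_mul_ext1, ptrace_ext1_mul,
    ptrace_contractor hq0 hq hμ hR hdet hb hΨ hK, mul_smul_comm, mul_one, smul_mul_assoc,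
    (bmwFam_op (A := ℂ) hR hdet hb 2).ksq hμ hq hq0 (p := 0) (by omega), op_two, cmap_complex,
    smul_smul] at h
  have : (Dof Ψ).trace = μ * loopVal q μ := by
    by_contra hne
    apply hK
    have h3 := sub_eq_zero.mpr h
    rw [← sub_smul, smul_eq_zero] at h3
    exact h3.resolve_left fun h4 => hne (sub_eq_zero.mp h4).symm
  rw [hs, this]

end Contractor

section Contraction

variable {N : ℕ} {A : Type*} [Ring A] [Algebra ℂ A] [NeZero N]

/-- The scalar operator with (possibly noncommuting) scalar `g`. -/
def scM {n : ℕ} (g : A) : MatV N n A := Matrix.scalar _ g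

theorem mul_scM_apply {n : ℕ} (X : MatV N n A) (g : A) (a b : Fin n → Fin N) :
    (X * (scM g : MatV N n A)) a b = X a b * g := by
  rw [scM, Matrix.scalar_apply, Matrix.mul_diagonal]

theorem scM_mul_apply {n : ℕ} (X : MatV N n A) (g : A) (a b : Fin n → Fin N) :
    ((scM g : MatV N n A) * X) a b = g * X a b := by
  rw [scM, Matrix.scalar_apply, Matrix.diagonal_mul]

theorem scM_zero {n : ℕ} : (scM (0 : A) : MatV N n A) = 0 := map_zero _

theorem scM_smul {n : ℕ} (c : ℂ) (g : A) : (scM (c • g) : MatV N n A) = c • scM g := by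
  ext a b
  simp only [scM, Matrix.scalar_apply, Matrix.smul_apply, Matrix.diagonal_apply]
  split_ifs <;> simp

theorem scM_commute_cmap {n : ℕ} (g : A) (X : MatV N n ℂ) : Commute (scM g) (cmap X : MatV N n A) := by
  refine Matrix.ext fun a b => ?_
  rw [scM_mul_apply, mul_scM_apply]
  exact (cmap_commute_apply X a b g).symm.eq

theorem emb_scM {m n : ℕ} (f : Fin m ↪ Fin n) (g : A) : emb f (scM g : MatV N m A) = scM g := by
  ext a b
  rw [emb_apply, scM, scM, Matrix.scalar_apply, Matrix.scalar_apply, Matrix.diagonal_apply,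
    Matrix.diagonal_apply]
  by_cases hab : a = b
  · subst hab; simp
  · rw [if_neg hab]
    split_ifs with h1 h2
    · exfalso
      apply hab
      funext i
      by_cases hi : i ∈ Set.range f
      · obtain ⟨j, rfl⟩ := hi; exact congrFun h2 j
      · exact h1 i hi
    · rfl
    · rfl

theorem ext1_scM {n : ℕ} (g : A) : ext1 (scM g : MatV N n A) = scM g := by
  rw [ext1_eq_emb, emb_scM]

theorem shiftF_scM {F : MatV N 2 ℂ} (hF : IsUnit F.det) (n : ℕ) (g : A) :
    shiftF A hF n (scM g) = scM g := by
  refine shiftF_eq_of_intertwine hF ?_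
  rw [ext1_scM]
  exact (chain_commute n fun j _ => scM_commute_cmap g _).symm.eq

theorem ptrace_mul_scM (D : Matrix (Fin N) (Fin N) ℂ) {n : ℕ} (X : MatV N (n + 1) A) (g : A) :
    ptrace (cmap D) (X * scM g) = ptrace (cmap D) X * scM g := by
  rw [← ext1_scM, ptrace_mul_ext1]

theorem ptrace_scM_mul (D : Matrix (Fin N) (Fin N) ℂ) {n : ℕ} (X : MatV N (n + 1) A) (g : A) :
    ptrace (cmap D) (scM g * X) = scM g * ptrace (cmap D) X := by
  rw [← ext1_scM, ptrace_ext1_mul]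

theorem trTailL_mul_scM (D : Matrix (Fin N) (Fin N) ℂ) {n : ℕ} (X : MatV N (n + 1) A) (g : A) :
    trTailL A D n (X * scM g) = trTailL A D n X * scM g := by
  induction n with
  | zero => rfl
  | succ n ih => rw [trTailL_succ, ptrace_mul_scM, ih, ← trTailL_succ]

theorem trTailL_lift1_mul (D : Matrix (Fin N) (Fin N) ℂ) {n : ℕ} (M : Matrix (Fin N) (Fin N) A)
    (X : MatV N (n + 1) A) :
    trTailL A D n (lift1 0 M * X) = lift1 0 M * trTailL A D n X := by
  induction n with
  | zero => rfl
  | succ n ih =>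
    rw [trTailL_succ, ← ext1_lift1 (by omega), ptrace_ext1_mul, ih, ← trTailL_succ]

variable {q μ : ℂ} {R F Ψ : MatV N 2 ℂ} {M : Matrix (Fin N) (Fin N) A}
  (hq0 : q ≠ 0) (hq : q - q⁻¹ ≠ 0) (hμ : μ ≠ 0) (hη : loopVal q μ ≠ 0)
  (hR : IsBraid R) (hdet : IsUnit R.det) (hb : IsBMW q μ R) (hΨ : SkewPair R Ψ)
  (hF : IsUnit F.det)

theorem gElt_eq : gElt q μ R F Ψ M
    = (loopVal q μ)⁻¹ • trAll (cmap (Dof Ψ)) 2 (Mprod F M 2 * cmap (lift2 0 (bmwK q μ R))) := by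
  rw [gElt, loopVal, inv_div, mul_comm μ]

theorem gElt_of_contractor_eq_zero (hK : bmwK q μ R = 0) : gElt q μ R F Ψ M = 0 := by
  have : (cmap (lift2 0 (bmwK q μ R)) : MatV N 2 A) = 0 := by
    change (op A (bmwK q μ R) 0 : MatV N 2 A) = 0
    rw [hK, op_two]
    ext; simp [cmap]
  rw [gElt, this, mul_zero]
  simp [trAll, ptrace]

include hq0 hq hμ hη hR hdet hb hΨ

theorem scM_mul_ptrace_contractor (n : ℕ) :
    scM (gElt q μ R F Ψ M) *
        ptrace (cmap (Dof Ψ)) (op A (bmwK q μ R) n : MatV N (n + 2) A)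
      = μ • scM (gElt q μ R F Ψ M) := by
  by_cases hK : bmwK q μ R = 0
  · rw [gElt_of_contractor_eq_zero hK, scM_zero, zero_mul, smul_zero]
  · rw [ptrace_contractor hq0 hq hμ hR hdet hb hΨ hK, mul_smul_comm, mul_one]

theorem scM_mul_ptrace_one (n : ℕ) :
    scM (gElt q μ R F Ψ M) * ptrace (cmap (Dof Ψ)) (1 : MatV N (n + 1) A)
      = (μ * loopVal q μ) • scM (gElt q μ R F Ψ M) := by
  by_cases hK : bmwK q μ R = 0
  · rw [gElt_of_contractor_eq_zero hK, scM_zero, zero_mul, smul_zero]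
  · rw [ptrace_one hq0 hq hμ hR hdet hb hΨ hK, mul_smul_comm, mul_one]

theorem contraction_base (hM : QMArel R F M) :
    (Mcopy F M 0 * Mcopy F M 1 * op A (bmwK q μ R) 0 : MatV N 2 A)
      = μ⁻¹ ^ 2 • (scM (gElt q μ R F Ψ M) * op A (bmwK q μ R) 0) := by
  by_cases hK : bmwK q μ R = 0
  · have : (op A (bmwK q μ R) 0 : MatV N 2 A) = 0 := by
      rw [hK, op_two]; ext; simp [cmap]
    rw [this, mul_zero, mul_zero, smul_zero]
  have fam := bmwFam_op (A := A) hR hdet hb 2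
  set X : MatV N 2 A := Mcopy F M 0 * Mcopy F M 1 with hX
  have hXK : X * op A (bmwK q μ R) 0 = op A (bmwK q μ R) 0 * X :=
    fam.intertwine (by omega) (by omega) (op_mul_Mcopy_zero hM le_rfl).symm.eq
  obtain ⟨e, f, w, hef, -, -⟩ := contractor_rank_one hΨ hb.2.1 hK
  obtain ⟨θ', hθ'⟩ : ∃ θ', op A (bmwK q μ R) 0 * X * op A (bmwK q μ R) 0
      = scM θ' * op A (bmwK q μ R) 0 := by
    refine ⟨∑ d, ∑ c, f c • e d • X c d, ?_⟩
    rw [op_two]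
    ext a b
    rw [scM_mul_apply]
    simp only [Matrix.mul_apply, cmap, Matrix.map_apply, hef, Finset.sum_mul]
    refine Finset.sum_congr rfl fun d _ => Finset.sum_congr rfl fun c _ => ?_
    simp only [Algebra.algebraMap_eq_smul_one, smul_mul_assoc, mul_smul_comm, one_mul, mul_one,
      smul_smul]
    congr 1; ring
  set η := loopVal q μ
  have hθ : X * op A (bmwK q μ R) 0 = scM (η⁻¹ • θ') * op A (bmwK q μ R) 0 := by
    rw [← hXK, mul_assoc, fam.ksq hμ hq hq0 (p := 0) (by omega), mul_smul_comm] at hθ'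
    rw [scM_smul, smul_mul_assoc, ← hθ', smul_smul, inv_mul_cancel₀ hη, one_smul]
  have hg : gElt q μ R F Ψ M = μ ^ 2 • η⁻¹ • θ' := by
    have hp : Mprod F M 2 = X := by rw [Mprod, Mprod, Mprod, one_mul]
    rw [gElt_eq, hp]
    change (loopVal q μ)⁻¹ • trAll (cmap (Dof Ψ)) 2 (X * op A (bmwK q μ R) 0) = _
    rw [hθ]
    change (loopVal q μ)⁻¹ • (ptrace (cmap (Dof Ψ)) (ptrace (cmap (Dof Ψ)) _)) _ _ = _
    rw [ptrace_scM_mul, ptrace_contractor hq0 hq hμ hR hdet hb hΨ hK, mul_smul_comm, ptrace_smul,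
      ptrace_scM_mul, ptrace_one hq0 hq hμ hR hdet hb hΨ hK, mul_smul_comm, Matrix.smul_apply,
      Matrix.smul_apply, scM_mul_apply, Matrix.one_apply, if_pos rfl, mul_one, smul_smul, smul_smul]
    congr 1
    change η⁻¹ * μ * (μ * η) = μ ^ 2
    field_simp
  rw [hθ, hg, scM_smul (μ ^ 2), smul_mul_assoc, smul_smul, ← mul_pow, inv_mul_cancel₀ hμ, one_pow,
    one_smul]

theorem contraction_at (hM : QMArel R F M) (hF : IsUnit F.det) (hFb : IsBraid F)
    (hmov : Movable F R) {n i : ℕ} (hi : i + 1 < n) :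
    (Mcopy F M i * Mcopy F M (i + 1) * op A (bmwK q μ R) i : MatV N n A)
      = μ⁻¹ ^ 2 • (scM (gElt q μ R F Ψ M) * op A (bmwK q μ R) i) := by
  induction i generalizing n with
  | zero =>
    induction n, hi using Nat.le_induction with
    | base => exact contraction_base hq0 hq hμ hη hR hdet hb hΨ hM
    | succ n hn ih =>
      have := congrArg (emb (Fin.castSuccEmb (n := n))) ih
      rw [map_smul] at this
      simpa only [map_mul, ← ext1_eq_emb, ext1_op (A := A) (show 0 + 1 < n from hn),
        ext1_Mcopy M (show 0 < n by omega), ext1_Mcopy M (show 0 + 1 < n from hn), ext1_scM] using this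
  | succ i ih =>
    obtain ⟨m, rfl⟩ : ∃ m, n = m + 1 := ⟨n - 1, by omega⟩
    have := congrArg (shiftF A hF m) (ih (n := m) (by omega))
    rw [map_smul] at this
    simpa only [map_mul, shiftF_op hF (hmov.bmwK q μ) (show i + 1 < m by omega),
      shiftF_Mcopy hF hFb M (show i < m by omega), shiftF_Mcopy hF hFb M (show i + 1 < m by omega),
      shiftF_scM] using this

end Contraction

section Shifted

variable {N : ℕ} {A : Type*} [Ring A] [Algebra ℂ A] [NeZero N]

theorem lift1_toN (X : MatV N 1 A) : lift1 0 (toN X) = X := by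
  ext a b
  have key : ∀ c : Fin 1 → Fin N, (fun _ => idx c 0) = c := by
    intro c; funext t; rw [Subsingleton.elim t 0]; simp [idx]
  rw [lift1, if_pos (fun m => by omega), toN, key, key]

theorem toN_lift1 (X : Matrix (Fin N) (Fin N) A) : toN (lift1 0 X) = X := by
  ext i j
  rw [toN, lift1, if_pos (fun m => by omega)]
  simp [idx]

theorem toN_mul (X Y : MatV N 1 A) : toN (X * Y) = toN X * toN Y := by
  ext i j
  simp only [toN, Matrix.mul_apply]
  refine Fintype.sum_equiv (Equiv.funUnique (Fin 1) (Fin N)) _ _ fun c => ?_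
  have : (fun _ => (Equiv.funUnique (Fin 1) (Fin N)) c) = c := by
    funext t; rw [Subsingleton.elim t 0]; rfl
  rw [this]

theorem toN_add (X Y : MatV N 1 A) : toN (X + Y) = toN X + toN Y := rfl

theorem toN_smul (c : ℂ) (X : MatV N 1 A) : toN (c • X) = c • toN X := rfl

theorem toN_mul_scM (X : MatV N 1 A) (g : A) : toN (X * scM g) = rmulE (toN X) g := by
  ext i j
  exact mul_scM_apply X g _ _

theorem trAll_succ_eq (D : Matrix (Fin N) (Fin N) A) (j : ℕ) (X : MatV N (j + 1) A) :
    trAll D (j + 1) X = ptrace D (trTail D j X) (fun i => i.elim0) (fun i => i.elim0) := by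
  induction j with
  | zero => rfl
  | succ j ih => exact ih _

variable {F : MatV N 2 ℂ} (hF : IsUnit F.det) {R Ψ : MatV N 2 ℂ} (hΨ : SkewPair R Ψ)
  (hR : Movable F R)

include hΨ hR

theorem trTailL_shiftF_mul_op (j : ℕ) (X : MatV N (j + 1) A) (Z : MatV N 2 ℂ) :
    trTailL A (Dof Ψ) (j + 1) (shiftF A hF (j + 1) X * op A Z 0)
      = ptrace (cmap (Dof Ψ)) (shiftF A hF 1 (trTailL A (Dof Ψ) j X) * op A Z 0) := by
  induction j with
  | zero => rfl
  | succ j ih =>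
    rw [trTailL_succ, ← ext1_op (by omega), ptrace_mul_ext1, ptrace_shiftF hF hΨ hR, ih,
      ← trTailL_succ]

theorem trTailL_shiftF (j : ℕ) (X : MatV N (j + 1) A) :
    trTailL A (Dof Ψ) (j + 1) (shiftF A hF (j + 1) X)
      = scM (trAll (cmap (Dof Ψ)) (j + 1) X) := by
  have h := trTailL_shiftF_mul_op hF hΨ hR j X 1
  rw [op_one (by omega), op_one (by omega), mul_one, mul_one, ptrace_shiftF hF hΨ hR] at h
  rw [h, trAll_succ_eq, ← trTailL_apply, shiftF_apply, chain, chainRev, one_mul, mul_one]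
  ext a b
  rw [ext1, scM, Matrix.scalar_apply, Matrix.diagonal_apply]
  refine if_congr ?_ ?_ rfl
  · constructor
    · intro h; funext t; rw [show t = Fin.last 0 from Subsingleton.elim (α := Fin 1) _ _]; exact h
    · intro h; rw [h]
  · congr 1 <;> funext t <;> exact t.elim0

omit hΨ hR in
theorem shiftF_one (X : MatV N 1 A) :
    shiftF A hF 1 X = op A F 0 * lift1 0 (toN X) * op A F⁻¹ 0 := by
  rw [shiftF_apply, chain, chain, chainRev, chainRev, one_mul, mul_one]
  congr 2
  conv_lhs => rw [← lift1_toN X]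
  exact ext1_lift1 (by omega) _

theorem toN_trTailL_shiftF_mul_op (j : ℕ) (X : MatV N (j + 1) A) :
    toN (trTailL A (Dof Ψ) (j + 1) (shiftF A hF (j + 1) X * op A R 0))
      = phi R F Ψ (toN (trTailL A (Dof Ψ) j X)) := by
  rw [trTailL_shiftF_mul_op hF hΨ hR, shiftF_one, phi]

theorem toN_trTailL_shiftF_mul_contractor (q μ : ℂ) (j : ℕ) (X : MatV N (j + 1) A) :
    toN (trTailL A (Dof Ψ) (j + 1) (shiftF A hF (j + 1) X * op A (bmwK q μ R) 0))
      = xi q μ R F Ψ (toN (trTailL A (Dof Ψ) j X)) := by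
  rw [trTailL_shiftF_mul_op hF hΨ hR, shiftF_one, xi]

end Shifted

section Setup

variable {N : ℕ} {A : Type*} [Ring A] [Algebra ℂ A] [NeZero N]

/-- A quantum matrix for a compatible pair whose first member is of BMW type. -/
structure Setup (q μ : ℂ) (k : ℕ) (R F Ψ : MatV N 2 ℂ) (M : Matrix (Fin N) (Fin N) A) : Prop where
  gen : Generic q μ k
  braid : IsBraid R
  det : IsUnit R.det
  bmw : IsBMW q μ R
  skew : SkewPair R Ψ
  detF : IsUnit F.det
  braidF : IsBraid F
  compat : Compatible R F
  rel : QMArel R F M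

/-- The family of the operators `X` placed in all neighbouring pairs of tensor factors. -/
abbrev opF (A : Type*) [Ring A] [Algebra ℂ A] (n : ℕ) (X : MatV N 2 ℂ) (s : ℕ) : ℕ → MatV N n A :=
  fun j => op A X (j + s)

namespace Setup

variable {q μ : ℂ} {k : ℕ} {R F Ψ : MatV N 2 ℂ} {M : Matrix (Fin N) (Fin N) A}
  (S : Setup q μ k R F Ψ M)

include S

theorem fam (n : ℕ) : BMWFam q μ n (opF A n R 0) (opF A n R⁻¹ 0) (opF A n (bmwK q μ R) 0) :=
  bmwFam_op S.braid S.det S.bmw n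

theorem cyc_op {j p : ℕ} (hp : 1 ≤ p) (hpj : p < j) :
    (op A R p : MatV N (j + 1) A) ∈ cycAlg (trTailL A (Dof Ψ) j) :=
  op_mem_cycAlg (tensorSq_commute S.skew (Matrix.nonsing_inv_mul R S.det)
    (Matrix.mul_nonsing_inv R S.det) S.braid) hp hpj

theorem cyc_contractor {j p : ℕ} (hp : 1 ≤ p) (hpj : p < j) :
    (op A (bmwK q μ R) p : MatV N (j + 1) A) ∈ cycAlg (trTailL A (Dof Ψ) j) := by
  have h := S.cyc_op hp hpj
  rw [bmwK, op_smul (by omega), op_mul (by omega), sub_eq_add_neg (q • 1) R, ← neg_one_smul ℂ R,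
    op_add (by omega), op_add (by omega), op_smul (by omega), op_smul (by omega),
    op_smul (by omega), op_one (by omega)]
  have one := (cycAlg (trTailL A (Dof Ψ) j)).one_mem
  exact Subalgebra.smul_mem _ (mul_mem (add_mem (Subalgebra.smul_mem _ one _)
    (Subalgebra.smul_mem _ h _)) (add_mem (Subalgebra.smul_mem _ one _) h)) _

theorem cyc_asymB {j i s : ℕ} (hs : 1 ≤ s) (hj : i + s ≤ j + 1) :
    asymB q μ (opF A (j + 1) R s) (opF A (j + 1) (bmwK q μ R) s) i
      ∈ cycAlg (trTailL A (Dof Ψ) j) :=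
  asymB_mem q μ _ i (fun _ _ => S.cyc_op (by omega) (by omega))
    (fun _ _ => S.cyc_contractor (by omega) (by omega))

theorem contractor_commute_Mprod {n i j : ℕ} (hi : i + 1 < j) (hj : j ≤ n) :
    Commute (op A (bmwK q μ R) i : MatV N n A) (Mprod F M j) :=
  ((S.fam n).intertwine (p := i) (s := i) (by omega) (by omega)
    (op_commute_Mprod S.detF S.rel S.braidF S.compat hi hj).symm.eq).symm

theorem asymB_commute_Mprod {n i s j : ℕ} (hi : i + s ≤ j) (hj : j ≤ n) :
    Commute (Mprod F M j) (asymB q μ (opF A n R s) (opF A n (bmwK q μ R) s) i) :=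
  commute_asymB q μ i
    (fun _ _ => (op_commute_Mprod S.detF S.rel S.braidF S.compat (by omega) hj).symm)
    (fun _ _ => (S.contractor_commute_Mprod (by omega) hj).symm)

theorem shiftF_asymB {n i s : ℕ} (hi : i + s ≤ n) :
    shiftF A S.detF n (asymB q μ (opF A n R s) (opF A n (bmwK q μ R) s) i)
      = asymB q μ (opF A (n + 1) R (s + 1)) (opF A (n + 1) (bmwK q μ R) (s + 1)) i := by
  rw [map_asymB]
  exact asymB_congr q μ i (fun j hj => shiftF_op S.detF S.compat.2 (by omega))
    (fun j hj => shiftF_op S.detF (Movable.bmwK S.compat.2 q μ) (by omega))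

end Setup
end Setup

section FirstRecursion

variable {N : ℕ} {A : Type*} [Ring A] [Algebra ℂ A] [NeZero N]

namespace Setup

variable {q μ : ℂ} {k : ℕ} {R F Ψ : MatV N 2 ℂ} {M : Matrix (Fin N) (Fin N) A}
  (S : Setup q μ k R F Ψ M)

theorem _root_.QMA.cmap_asym_opF (i : ℕ) : (cmap (asym q μ R i) : MatV N i A)
    = asymB q μ (opF A i R 0) (opF A i (bmwK q μ R) 0) i := cmap_asym q μ R i

theorem _root_.QMA.Mwedge_succ (i : ℕ) : Mwedge q μ R F Ψ M (i + 1)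
    = toN (trTailL A (Dof Ψ) i (Mprod F M (i + 1) *
        asymB q μ (opF A (i + 1) R 0) (opF A (i + 1) (bmwK q μ R) 0) (i + 1))) := by
  rw [Mwedge, trTailL_apply, cmap_asym_opF]

theorem _root_.QMA.aElt_succ (i : ℕ) : aElt q μ R F Ψ M (i + 1)
    = trAll (cmap (Dof Ψ)) (i + 1) (Mprod F M (i + 1) *
        asymB q μ (opF A (i + 1) R 0) (opF A (i + 1) (bmwK q μ R) 0) (i + 1)) := by
  rw [aElt, cmap_asym_opF]

include S

theorem trTailL_Mprod_mul_asymB (i : ℕ) (X : MatV N (i + 2) A) :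
    toN (trTailL A (Dof Ψ) (i + 1) (Mprod F M (i + 2) *
      (asymB q μ (opF A (i + 2) R 1) (opF A (i + 2) (bmwK q μ R) 1) (i + 1) * X)))
      = M * toN (trTailL A (Dof Ψ) (i + 1) (shiftF A S.detF (i + 1) (Mprod F M (i + 1) *
          asymB q μ (opF A (i + 1) R 0) (opF A (i + 1) (bmwK q μ R) 0) (i + 1)) * X)) := by
  rw [Mprod_succ' S.detF S.braidF M le_rfl, mul_assoc, trTailL_lift1_mul, toN_mul, toN_lift1,
    map_mul (shiftF _ _ _), S.shiftF_asymB (n := i + 1) (s := 0) (i := i + 1) le_rfl, mul_assoc]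

theorem trace_asymB_one (i : ℕ) :
    toN (trTailL A (Dof Ψ) (i + 1) (Mprod F M (i + 2) *
      (asymB q μ (opF A (i + 2) R 1) (opF A (i + 2) (bmwK q μ R) 1) (i + 1) * 1)))
      = rmulE M (aElt q μ R F Ψ M (i + 1)) := by
  rw [S.trTailL_Mprod_mul_asymB, mul_one, trTailL_shiftF S.detF S.skew S.compat.2, ← aElt_succ]
  conv_lhs => rw [← toN_lift1 M, ← toN_mul, toN_mul_scM, toN_lift1]

theorem trace_asymB_op (i : ℕ) :
    toN (trTailL A (Dof Ψ) (i + 1) (Mprod F M (i + 2) *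
      (asymB q μ (opF A (i + 2) R 1) (opF A (i + 2) (bmwK q μ R) 1) (i + 1) * op A R 0)))
      = M * phi R F Ψ (Mwedge q μ R F Ψ M (i + 1)) := by
  rw [S.trTailL_Mprod_mul_asymB, toN_trTailL_shiftF_mul_op S.detF S.skew S.compat.2, ← Mwedge_succ]

theorem trace_asymB_contractor (i : ℕ) :
    toN (trTailL A (Dof Ψ) (i + 1) (Mprod F M (i + 2) *
      (asymB q μ (opF A (i + 2) R 1) (opF A (i + 2) (bmwK q μ R) 1) (i + 1) *
        op A (bmwK q μ R) 0)))
      = M * xi q μ R F Ψ (Mwedge q μ R F Ψ M (i + 1)) := by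
  rw [S.trTailL_Mprod_mul_asymB, toN_trTailL_shiftF_mul_contractor S.detF S.skew S.compat.2,
    ← Mwedge_succ]

theorem trace_mirror {i : ℕ} (hi : i + 1 ≤ k) (m : ℕ) :
    toN (trTailL A (Dof Ψ) (i + 1) (Mprod F M (i + 2) *
      (asymB q μ (opF A (i + 2) R 1) (opF A (i + 2) (bmwK q μ R) 1) (i + 1) *
        sig q μ (opF A (i + 2) R 0) (opF A (i + 2) (bmwK q μ R) 0) m 0 *
        asymB q μ (opF A (i + 2) R 1) (opF A (i + 2) (bmwK q μ R) 1) (i + 1))))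
      = rmulE M (aElt q μ R F Ψ M (i + 1)) +
        sx q m • (M * phi R F Ψ (Mwedge q μ R F Ψ M (i + 1))) +
        sy q μ m • (M * xi q μ R F Ψ (Mwedge q μ R F Ψ M (i + 1))) := by
  rw [← S.trace_asymB_one, ← S.trace_asymB_op, ← S.trace_asymB_contractor]
  set a := asymB q μ (opF A (i + 2) R 1) (opF A (i + 2) (bmwK q μ R) 1) (i + 1) with ha
  have hcyc : a ∈ cycAlg (trTailL A (Dof Ψ) (i + 1)) := S.cyc_asymB le_rfl le_rfl
  have hcomm : Commute (Mprod F M (i + 2)) a := S.asymB_commute_Mprod le_rfl le_rfl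
  have hidem : a * a = a :=
    ((S.fam (i + 2)).shift (n := i + 1) (s := 1)).asymB_mul_asymB S.gen hi le_rfl le_rfl
  rw [← mul_assoc, hcyc, ← mul_assoc, ← mul_assoc, ← hcomm.eq, mul_assoc (Mprod F M (i + 2)),
    hidem, mul_assoc, sig, mul_add, mul_add, mul_add, mul_add, mul_smul_comm, mul_smul_comm,
    mul_smul_comm, mul_smul_comm, map_add, map_add, map_smul, map_smul, toN_add, toN_add, toN_smul,
    toN_smul]

theorem wedge_succ {i : ℕ} (hi1 : 1 ≤ i) (hi : i + 1 ≤ k) :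
    nq q (i + 1) • Mwedge q μ R F Ψ M (i + 1)
      = q ^ i • (rmulE M (aElt q μ R F Ψ M i) +
        sx q i • (M * phi R F Ψ (Mwedge q μ R F Ψ M i)) +
        sy q μ i • (M * xi q μ R F Ψ (Mwedge q μ R F Ψ M i))) := by
  obtain ⟨i, rfl⟩ := Nat.exists_eq_add_of_le' hi1
  have hn : nq q (i + 2) ≠ 0 := S.gen.nq_ne _ (by omega) hi
  rw [Mwedge_succ, (S.fam (i + 2)).asymB_mirror S.gen hi1 hi (by omega), mul_smul_comm, map_smul,
    toN_smul, smul_smul, mul_div_cancel₀ _ hn]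
  exact congrArg _ (S.trace_mirror (by omega) (i + 1))

theorem wedge_height {i : ℕ} (hi1 : 1 ≤ i) (hik : i = k) (hcut : HeightCut q μ R k) :
    rmulE M (aElt q μ R F Ψ M i) +
        sx q i • (M * phi R F Ψ (Mwedge q μ R F Ψ M i)) +
        sy q μ i • (M * xi q μ R F Ψ (Mwedge q μ R F Ψ M i)) = 0 := by
  subst hik
  obtain ⟨i, rfl⟩ := Nat.exists_eq_add_of_le' hi1
  rw [← S.trace_mirror le_rfl (i + 1)]
  have := (S.fam (i + 2)).mirror_eq_zero S.gen hi1 le_rfl (by omega) (i + 1)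
    (heightCut_asymB (A := A) hcut)
  refine (congrArg (fun Z => toN (trTailL A (Dof Ψ) (i + 1) (Mprod F M (i + 2) * Z))) this).trans ?_
  rw [mul_zero, map_zero]; rfl

end Setup
end FirstRecursion

section TraceRecursion

variable {B C : Type*} [Ring B] [Algebra ℂ B] [AddCommGroup C] [Module ℂ C]

theorem cycle_of_commute {τ : B →ₗ[ℂ] C} {m c : B} (hc : c ∈ cycAlg τ) (hm : Commute m c) (Z : B) :
    τ (m * (Z * c)) = τ (m * (c * Z)) := by
  rw [← mul_assoc, hc, ← mul_assoc, ← hm.eq, mul_assoc]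

theorem Generic.loop_ne {q μ : ℂ} {k : ℕ} (G : Generic q μ k) : loopVal q μ ≠ 0 :=
  div_ne_zero (mul_ne_zero (sub_ne_zero.mpr G.muq.symm) (by rw [add_comm]; exact G.muq'))
    (mul_ne_zero G.lam G.mu0)

namespace BMWFam

variable {q μ : ℂ} {k i : ℕ} {r r' κ : ℕ → B} (h : BMWFam q μ (i + 3) r r' κ) (G : Generic q μ k)
  (hi1 : 1 ≤ i) {τ : B →ₗ[ℂ] C} {m : B} (hm : ∀ j, j + 1 < i + 3 → Commute m (r j))
  (hτ : ∀ j, 1 ≤ j → j + 1 < i + 3 → r j ∈ cycAlg τ)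

include h

theorem kappa_mem (T : Subalgebra ℂ B) {j : ℕ} (hj : j + 1 < i + 3) (hT : r j ∈ T) : κ j ∈ T := by
  rw [h.kdef j hj]
  exact T.smul_mem (T.mul_mem (T.sub_mem (T.smul_mem T.one_mem _) hT)
    (T.add_mem (T.smul_mem T.one_mem _) hT)) _

include hi1 in
theorem cross_mul_of_commute {x : B} (hx : ∀ j, 2 ≤ j → j + 1 < i + 3 → Commute x (r j)) :
    cross (fun j => r (j + 1)) i * x
      = r 2 * r 1 * x * r' 1 * r' 2 * cross (fun j => r (j + 1)) i := by
  obtain ⟨i, rfl⟩ := Nat.exists_eq_add_of_le' hi1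
  rw [cross, chain_succ', chain_succ']
  have c1 : Commute (r 1) (chain (fun j => r (j + 1 + 1 + 1)) i) :=
    chain_commute i fun j hj => h.comm _ _ (by omega) (by omega)
  have c2 : Commute x (chain (fun j => r (j + 1 + 1 + 1)) i) :=
    chain_commute i fun j hj => hx _ (by omega) (by omega)
  have c3 : Commute x (chain (fun j => r (j + 1 + 1)) i) :=
    chain_commute i fun j hj => hx _ (by omega) (by omega)
  simp only [zero_add, Nat.reduceAdd]
  generalize chain (fun j => r (j + 1 + 1 + 1)) i = P at *
  generalize chain (fun j => r (j + 1 + 1)) i = Q at *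
  calc r 2 * P * (r 1 * Q) * x = r 2 * (P * r 1) * (Q * x) := by noncomm_ring
    _ = r 2 * r 1 * (P * x) * Q := by rw [← c1.eq, ← c3.eq]; noncomm_ring
    _ = r 2 * r 1 * x * P * Q := by rw [← c2.eq]; noncomm_ring
    _ = r 2 * r 1 * x * (r' 1 * r 1) * P * Q := by rw [h.inv' 1 (by omega), mul_one]
    _ = r 2 * r 1 * x * r' 1 * (r 1 * P) * Q := by noncomm_ring
    _ = r 2 * r 1 * x * r' 1 * (r' 2 * r 2) * (P * r 1) * Q := by
      rw [h.inv' 2 (by omega), mul_one, c1.eq]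
    _ = _ := by noncomm_ring

include hi1 hm hτ G

theorem trace_cross {x : B} (hx : ∀ j, 2 ≤ j → j + 1 < i + 3 → Commute x (r j)) :
    τ (m * asymB q μ (fun j => r (j + 1)) (fun j => κ (j + 1)) i * x * κ (i + 1))
      = loopVal q μ • τ (m * (asymB q μ (fun j => r (j + 3)) (fun j => κ (j + 3)) i *
          (κ 1 * κ 2 * x))) := by
  have h1 := h.shift (n := i + 2) (s := 1)
  set a := asymB q μ (fun j => r (j + 1)) (fun j => κ (j + 1)) i
  set b := asymB q μ (fun j => r (j + 3)) (fun j => κ (j + 3)) i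
  set c := cross (fun j => r (j + 1)) i
  set c' := crossRev (fun j => r' (j + 1)) i
  have ec : c * c' = 1 := cross_mul_crossRev i fun j hj => h1.inv j (by omega)
  have ec' : c' * c = 1 := crossRev_mul_cross i fun j hj => h1.inv' j (by omega)
  have e1 : c * a = b * c := h1.cross_mul_asymB (l := i) (by omega)
  have e2 : κ 1 * c = c * κ (i + 1) := h1.kappa_mul_cross (l := i) (by omega)
  have e3 : c * x = r 2 * r 1 * x * r' 1 * r' 2 * c := h.cross_mul_of_commute hi1 hx
  have hxκ : ∀ j, 2 ≤ j → j + 1 < i + 3 → Commute x (κ j) := fun j hj hn =>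
    h.commute_kappa hn (hx j hj hn)
  have cm : Commute m c := (chain_commute i fun j hj => hm _ (by omega)).mul_right
    (chain_commute i fun j hj => hm _ (by omega))
  have ccyc : c ∈ cycAlg τ := by
    have : ∀ s, 1 ≤ s → ∀ l, l + s < i + 3 → chain (fun j => r (j + s)) l ∈ cycAlg τ := by
      intro s hs l hl
      induction l with
      | zero => exact (cycAlg τ).one_mem
      | succ l ih => exact (cycAlg τ).mul_mem (ih (by omega)) (hτ _ (by omega) (by omega))
    exact (cycAlg τ).mul_mem (this 2 (by omega) i (by omega)) (this 1 le_rfl i (by omega))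
  have kcyc : κ 1 ∈ cycAlg τ := h.kappa_mem _ (by omega) (hτ 1 le_rfl (by omega))
  have km : Commute m (κ 1) := h.commute_kappa (by omega) (hm 1 (by omega))
  have kb : Commute (κ 1) b := commute_asymB q μ i
    (fun j hj => (h.commute_kappa (by omega) (h.comm 1 (j + 3) (by omega) (by omega)).symm).symm)
    (fun j hj => (h.commute_kappa (by omega) (h.commute_kappa (p := j + 3) (by omega)
      (h.comm 1 (j + 3) (by omega) (by omega))).symm).symm)
  have step : c * (a * x * κ (i + 1) * c') = b * (κ 1 * x * κ 2) * κ 1 := by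
    calc c * (a * x * κ (i + 1) * c') = c * a * (x * κ (i + 1)) * c' := by noncomm_ring
      _ = b * (c * κ (i + 1)) * x * c' := by
        rw [(hxκ (i + 1) (by omega) (by omega)).eq, e1]; noncomm_ring
      _ = b * κ 1 * (c * x) * c' := by rw [← e2]; noncomm_ring
      _ = b * (κ 1 * r 2 * r 1) * x * r' 1 * r' 2 * (c * c') := by rw [e3]; noncomm_ring
      _ = b * κ 1 * (κ 2 * x) * r' 1 * r' 2 := by
        rw [ec, mul_one, h.k_r_r (p := 1) (by omega)]; noncomm_ring
      _ = b * κ 1 * x * (κ 2 * r' 1 * r' 2) := by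
        rw [← (hxκ 2 le_rfl (by omega)).eq]; noncomm_ring
      _ = b * (κ 1 * x * κ 2) * κ 1 := by rw [← h.kk' 1 (by omega)]; noncomm_ring
  calc τ (m * a * x * κ (i + 1)) = τ (m * (a * x * κ (i + 1) * c' * c)) := by
        rw [mul_assoc _ c' c, ec', mul_one]; simp only [mul_assoc]
    _ = τ (m * (c * (a * x * κ (i + 1) * c'))) := cycle_of_commute ccyc cm _
    _ = τ (m * (κ 1 * (b * (κ 1 * x * κ 2)))) := by rw [step, cycle_of_commute kcyc km]
    _ = τ (m * (b * ((κ 1 * κ 1) * (x * κ 2)))) := by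
      rw [← mul_assoc (κ 1) b, kb.eq]; simp only [mul_assoc]
    _ = _ := by
      rw [h.ksq G.mu0 G.lam G.q0 (p := 1) (by omega), (hxκ 2 le_rfl (by omega)).eq, smul_mul_assoc,
        mul_smul_comm, mul_smul_comm, map_smul]
      simp only [mul_assoc]

theorem trace_asymB (hik : i + 1 ≤ k) :
    nq q (i + 1) • loopVal q μ •
        τ (m * (asymB q μ (fun j => r (j + 2)) (fun j => κ (j + 2)) (i + 1) * (κ 1 * r 0)))
      = q ^ i • (((1 + sx q i * (q - q⁻¹)) * μ⁻¹) •
          τ (m * asymB q μ (fun j => r (j + 1)) (fun j => κ (j + 1)) i * 1 * κ (i + 1)) +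
        sx q i •
          τ (m * asymB q μ (fun j => r (j + 1)) (fun j => κ (j + 1)) i * κ 0 * κ (i + 1)) +
        (sy q μ i - sx q i * (q - q⁻¹)) •
          τ (m * asymB q μ (fun j => r (j + 1)) (fun j => κ (j + 1)) i * r 0 * κ (i + 1))) := by
  have hx : ∀ j, 2 ≤ j → j + 1 < i + 3 → Commute (r 0) (r j) := fun j hj hn =>
    h.comm 0 j (by omega) hn
  have hx' : ∀ j, 2 ≤ j → j + 1 < i + 3 → Commute (κ 0) (r j) := fun j hj hn =>
    (h.commute_kappa (by omega) (hx j hj hn).symm).symm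
  rw [h.trace_cross G hi1 hm hτ (x := 1) fun _ _ _ => Commute.one_left _,
    h.trace_cross G hi1 hm hτ hx, h.trace_cross G hi1 hm hτ hx']
  have hn : nq q (i + 1) ≠ 0 := G.nq_ne _ (by omega) hik
  have hη := G.loop_ne
  have hs2 := h.shift (n := i + 1) (s := 2)
  have hs3 := h.shift (n := i) (s := 3)
  have e0 := hs2.asymB_mirror G hi1 hik (by omega)
  set b := asymB q μ (fun j => r (j + 3)) (fun j => κ (j + 3)) i with hb
  have idem : b * b = b := hs3.asymB_mul_asymB G (by omega) le_rfl le_rfl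
  have rb : ∀ p, p < 2 → Commute (r p) b := fun p hp => commute_asymB q μ i
    (fun j hj => h.comm p (j + 3) (by omega) (by omega))
    (fun j hj => h.commute_kappa (p := j + 3) (by omega) (h.comm p (j + 3) (by omega) (by omega)))
  have κb : ∀ p, p < 2 → Commute (κ p) b := fun p hp =>
    (h.commute_kappa (by omega) (rb p hp).symm).symm
  have κm : ∀ p, p + 1 < i + 3 → Commute m (κ p) := fun p hp => h.commute_kappa hp (hm p hp)
  have bm : Commute m b := commute_asymB q μ i
    (fun j hj => hm (j + 3) (by omega)) (fun j hj => κm (j + 3) (by omega))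
  have bcyc : b ∈ cycAlg τ := asymB_mem q μ _ i (fun j hj => hτ (j + 3) (by omega) (by omega))
    (fun j hj => h.kappa_mem _ (by omega) (hτ (j + 3) (by omega) (by omega)))
  have cyc : ∀ c, c ∈ cycAlg τ → Commute m c → Commute c b → ∀ Z,
      τ (m * (b * (Z * c))) = τ (m * (b * (c * Z))) := by
    intro c hc hmc hcb Z
    rw [← mul_assoc b, cycle_of_commute hc hmc, ← mul_assoc c, hcb.eq, mul_assoc]
  have cκ := cyc (κ 1) (h.kappa_mem _ (by omega) (hτ 1 le_rfl (by omega))) (κm 1 (by omega))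
    (κb 1 (by omega))
  have cr' := cyc (r' 1) (cycAlg_inv_mem (hτ 1 le_rfl (by omega)) (h.inv 1 (by omega))
    (h.inv' 1 (by omega))) (h.commute_inv (by omega) (hm 1 (by omega)))
    (h.commute_inv (by omega) (rb 1 (by omega)).symm).symm
  have swap : ∀ x, Commute x b → Commute x (κ 2) →
      τ (m * (b * (κ 2 * (κ 1 * x)))) = τ (m * (b * (κ 1 * κ 2 * x))) := by
    intro x hxb hxκ
    rw [← mul_assoc b, ← cycle_of_commute ((cycAlg τ).mul_mem bcyc (h.kappa_mem _ (by omega)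
      (hτ 2 (by omega) (by omega)))) (bm.mul_right (κm 2 (by omega)))]
    congr 2
    calc κ 1 * x * (b * κ 2) = κ 1 * (x * b) * κ 2 := by noncomm_ring
      _ = b * κ 1 * (x * κ 2) := by rw [hxb.eq, ← mul_assoc, (κb 1 (by omega)).eq]; noncomm_ring
      _ = _ := by rw [hxκ.eq]; noncomm_ring
  have k0 : κ 1 * r 0 = κ 1 * κ 0 * r' 1 := by
    rw [h.kk 0 (by omega), mul_assoc _ (r (0 + 1)), h.inv 1 (by omega), mul_one]
  have sq : loopVal q μ • κ 1 = κ 1 * κ 1 := (h.ksq G.mu0 G.lam G.q0 (p := 1) (by omega)).symm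
  have t0 : τ (m * (b * (κ 1 * κ 0))) = τ (m * (b * (κ 1 * κ 2 * 1))) := by
    refine smul_right_injective C hη ?_
    have e1 : loopVal q μ • τ (m * (b * (κ 1 * κ 0))) = τ (m * (b * κ 1)) := by
      rw [← map_smul, ← mul_smul_comm, ← mul_smul_comm, ← smul_mul_assoc, sq, mul_assoc, ← cκ,
        h.kkk_succ (p := 0) (by omega)]
    have e2 : loopVal q μ • τ (m * (b * (κ 1 * κ 2 * 1))) = τ (m * (b * κ 1)) := by
      rw [mul_one, ← map_smul, ← mul_smul_comm, ← mul_smul_comm, ← smul_mul_assoc, sq, mul_assoc,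
        ← cκ, h.kkk 1 (by omega)]
    exact e1.trans e2.symm
  have t1 : τ (m * (b * (κ 1 * r 0))) = μ⁻¹ • τ (m * (b * (κ 1 * κ 2 * 1))) := by
    rw [k0, cr', ← mul_assoc (r' 1), h.r'k G.mu0 (p := 1) (by omega), smul_mul_assoc, mul_smul_comm,
      mul_smul_comm, map_smul, t0]
  have t2 : τ (m * (b * (κ 2 * (κ 1 * r 0)))) = τ (m * (b * (κ 1 * κ 2 * r 0))) :=
    swap _ (rb 0 (by omega)) (h.commute_kappa (by omega) (hx 2 le_rfl (by omega)))
  have t3 : τ (m * (b * (κ 2 * (κ 1 * κ 0)))) = τ (m * (b * (κ 1 * κ 2 * κ 0))) :=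
    swap _ (κb 0 (by omega)) (h.commute_kappa (by omega) (hx' 2 le_rfl (by omega)))
  have rκ : r 2 * κ 1 = r' 1 * κ 2 * κ 1 := by
    rw [mul_assoc, ← h.r_r_k_eq (p := 1) (by omega), ← mul_assoc, ← mul_assoc, h.inv' 1 (by omega),
      one_mul]
  have r'sq : r' 1 * r' 1 = 1 - (q - q⁻¹) • r' 1 + ((q - q⁻¹) * μ⁻¹) • κ 1 := by
    have e := congrArg (· * r' 1) (h.r'_eq G.mu0 G.lam G.q0 (p := 1) (by omega))
    refine e.trans ?_
    rw [add_mul, sub_mul, h.inv 1 (by omega), smul_mul_assoc, smul_mul_assoc, one_mul,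
      h.kr' G.mu0 (p := 1) (by omega), smul_smul]
  have t4 : τ (m * (b * (r 2 * (κ 1 * r 0)))) = τ (m * (b * (κ 1 * κ 2 * κ 0))) -
      (q - q⁻¹) • τ (m * (b * (κ 1 * κ 2 * r 0))) +
      ((q - q⁻¹) * μ⁻¹) • τ (m * (b * (κ 1 * κ 2 * 1))) := by
    have e1 : r' 1 * (r 2 * (κ 1 * κ 0)) = κ 2 * (κ 1 * κ 0) - (q - q⁻¹) • (r' 1 * (κ 2 * (κ 1 * κ 0)))
        + ((q - q⁻¹) * μ⁻¹) • (κ 1 * κ 0) := by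
      have e2 : κ 1 * (κ 2 * (κ 1 * κ 0)) = κ 1 * κ 0 := by
        rw [← mul_assoc (κ 2), ← mul_assoc, ← mul_assoc, h.kkk 1 (by omega)]
      calc r' 1 * (r 2 * (κ 1 * κ 0)) = r' 1 * (r 2 * κ 1) * κ 0 := by noncomm_ring
        _ = r' 1 * r' 1 * (κ 2 * (κ 1 * κ 0)) := by rw [rκ]; simp only [mul_assoc]
        _ = _ := by
          rw [r'sq, add_mul, sub_mul, smul_mul_assoc, smul_mul_assoc, one_mul, e2]
    rw [k0, ← mul_assoc (r 2), cr', e1, mul_add, mul_add, mul_sub, mul_sub]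
    simp only [mul_smul_comm, map_add, map_sub, map_smul]
    rw [t3, t0, ← cr', mul_assoc (κ 2), ← k0, t2]
  have e3 : τ (m * (asymB q μ (fun j => r (j + 2)) (fun j => κ (j + 2)) (i + 1) * (κ 1 * r 0)))
      = (q ^ i / nq q (i + 1)) • (τ (m * (b * (κ 1 * r 0))) +
        sx q i • τ (m * (b * (r 2 * (κ 1 * r 0)))) +
        sy q μ i • τ (m * (b * (κ 2 * (κ 1 * r 0))))) := by
    rw [e0, smul_mul_assoc, mul_smul_comm, map_smul]
    congr 1
    have e4 : Commute b (κ 1 * r 0) := ((κb 1 (by omega)).mul_left (rb 0 (by omega))).symm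
    change τ (m * (b * (1 + sx q i • r 2 + sy q μ i • κ 2) * b * (κ 1 * r 0))) = _
    rw [mul_assoc _ b, e4.eq, mul_assoc b, ← mul_assoc _ (κ 1 * r 0), ← mul_assoc b,
      cycle_of_commute bcyc bm, ← mul_assoc b b, idem, add_mul, add_mul, one_mul]
    simp only [mul_add, map_add, smul_mul_assoc, mul_smul_comm, map_smul]
    rw [e4.eq]
  rw [e3, t1, t2, t4]
  match_scalars <;> field_simp
  ring
end BMWFam
end TraceRecursion

section SecondRecursion

variable {N : ℕ} {A : Type*} [Ring A] [Algebra ℂ A] [NeZero N]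

namespace Setup

variable {q μ : ℂ} {k : ℕ} {R F Ψ : MatV N 2 ℂ} {M : Matrix (Fin N) (Fin N) A}
  (S : Setup q μ k R F Ψ M)

include S

theorem trTailL_contract {i : ℕ} {Z : MatV N (i + 1) A}
    (hZ : Commute (scM (gElt q μ R F Ψ M)) (ext1 (ext1 Z)))
    (hK : Commute (op A (bmwK q μ R) (i + 1)) (ext1 (ext1 Z))) :
    trTailL A (Dof Ψ) (i + 2) (Mprod F M (i + 3) * ext1 (ext1 Z) * op A (bmwK q μ R) (i + 1))
      = loopVal q μ • (trTailL A (Dof Ψ) i (Mprod F M (i + 1) * Z) * scM (gElt q μ R F Ψ M)) := by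
  set g := gElt q μ R F Ψ M
  have hμ := S.gen.mu0
  have e1 : (ext1 (ext1 (Mprod F M (i + 1) * Z)) : MatV N (i + 3) A)
      = Mprod F M (i + 1) * ext1 (ext1 Z) := by
    simp only [ext1_eq_emb, map_mul]
    rw [← ext1_eq_emb, ← ext1_eq_emb, ext1_Mprod M le_rfl, ext1_Mprod M (by omega)]
  have e2 : Mprod F M (i + 3) * ext1 (ext1 Z) * op A (bmwK q μ R) (i + 1)
      = μ⁻¹ ^ 2 • (ext1 (ext1 (Mprod F M (i + 1) * Z)) *
          (scM g * op A (bmwK q μ R) (i + 1))) := by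
    rw [mul_assoc, ← hK.eq, Mprod, Mprod, mul_assoc (Mprod F M (i + 1)), ← mul_assoc _ (op _ _ _),
      mul_assoc (Mprod F M (i + 1)),
      contraction_at S.gen.q0 S.gen.lam hμ S.gen.loop_ne S.braid S.det S.bmw S.skew S.rel S.detF
        S.braidF S.compat.2 (i := i + 1) (by omega), e1, mul_smul_comm, smul_mul_assoc,
        mul_assoc (Mprod F M (i + 1)),
      mul_assoc (scM g), hK.eq, ← mul_assoc (scM g), hZ.eq, mul_assoc (ext1 _), mul_assoc]
  have e3 := scM_mul_ptrace_contractor (M := M) (F := F) S.gen.q0 S.gen.lam hμ S.gen.loop_ne S.braid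
    S.det S.bmw S.skew (i + 1)
  have e4 := scM_mul_ptrace_one (M := M) (F := F) S.gen.q0 S.gen.lam hμ S.gen.loop_ne S.braid
    S.det S.bmw S.skew (i + 1)
  rw [e2, map_smul, trTailL_succ, trTailL_succ, ptrace_ext1_mul, ptrace_scM_mul, e3,
    mul_smul_comm, ptrace_smul, map_smul, ptrace_ext1_mul, ← mul_one (scM g), ptrace_scM_mul, e4,
    mul_smul_comm, map_smul, trTailL_mul_scM, smul_smul, smul_smul]
  congr 1
  field_simp

omit S in
theorem _root_.QMA.ext1_asymB_opF {n i s : ℕ} (hi : i + s ≤ n) :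
    ext1 (asymB q μ (opF A n R s) (opF A n (bmwK q μ R) s) i)
      = asymB q μ (opF A (n + 1) R s) (opF A (n + 1) (bmwK q μ R) s) i := by
  rw [ext1_eq_emb, map_asymB]
  refine asymB_congr q μ i (fun j hj => ?_) (fun j hj => ?_) <;> rw [← ext1_eq_emb] <;>
    exact ext1_op (by omega) _

theorem trTailL_asymB_contract (i : ℕ) {x : MatV N (i + 2) A} {X : MatV N 2 ℂ}
    (hx : x = op A X 0) :
    toN (trTailL A (Dof Ψ) (i + 3) (Mprod F M (i + 4) *
      asymB q μ (opF A (i + 4) R 1) (opF A (i + 4) (bmwK q μ R) 1) (i + 1) * op A X 0 *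
        op A (bmwK q μ R) (i + 2)))
      = loopVal q μ • rmulE (toN (trTailL A (Dof Ψ) (i + 1) (Mprod F M (i + 2) *
          (asymB q μ (opF A (i + 2) R 1) (opF A (i + 2) (bmwK q μ R) 1) (i + 1) * x))))
          (gElt q μ R F Ψ M) := by
  subst hx
  have e : (ext1 (ext1 (asymB q μ (opF A (i + 2) R 1) (opF A (i + 2) (bmwK q μ R) 1) (i + 1) *
      op A X 0)) : MatV N (i + 4) A)
      = asymB q μ (opF A (i + 4) R 1) (opF A (i + 4) (bmwK q μ R) 1) (i + 1) * op A X 0 := by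
    rw [← ext1_asymB_opF (n := i + 3) (by omega), ← ext1_asymB_opF (n := i + 2) (by omega),
      ← ext1_op (n := i + 3) (by omega), ← ext1_op (n := i + 2) (by omega)]
    simp only [ext1_eq_emb, map_mul]
  have h := S.trTailL_contract (i := i + 1) (Z := asymB q μ (opF A (i + 2) R 1)
    (opF A (i + 2) (bmwK q μ R) 1) (i + 1) * op A X 0) ?_ ?_
  · rw [mul_assoc (Mprod F M (i + 4)), ← e, h, toN_smul, toN_mul_scM]
  · rw [e]
    exact (commute_asymB q μ _ (fun _ _ => scM_commute_cmap _ _)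
      (fun _ _ => scM_commute_cmap _ _)).mul_right (scM_commute_cmap _ _)
  · rw [e]
    exact (commute_asymB q μ _ (fun _ _ => (op_commute (by omega) (by omega) _ _).symm)
      (fun _ _ => (op_commute (by omega) (by omega) _ _).symm)).mul_right
      (op_commute (by omega) (by omega) _ _).symm

theorem star_xi_eq_trace (i : ℕ) :
    M * phi R F Ψ (M * xi q μ R F Ψ (Mwedge q μ R F Ψ M (i + 1)))
      = toN (trTailL A (Dof Ψ) (i + 2) (Mprod F M (i + 3) *
          (asymB q μ (opF A (i + 3) R 2) (opF A (i + 3) (bmwK q μ R) 2) (i + 1) *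
            (op A (bmwK q μ R) 1 * op A R 0)))) := by
  rw [← S.trace_asymB_contractor, ← toN_trTailL_shiftF_mul_op S.detF S.skew S.compat.2,
    Mprod_succ' S.detF S.braidF M (n := i + 2) le_rfl, mul_assoc, trTailL_lift1_mul, toN_mul, toN_lift1,
    map_mul (shiftF _ _ _), map_mul (shiftF _ _ _),
    S.shiftF_asymB (n := i + 2) (s := 1) (i := i + 1) (by omega),
    shiftF_op S.detF (Movable.bmwK S.compat.2 q μ) (by omega), mul_assoc, mul_assoc]

theorem wedge_xi_succ {i : ℕ} (hi1 : 1 ≤ i) (hi : i + 1 ≤ k) :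
    nq q (i + 1) • (M * phi R F Ψ (M * xi q μ R F Ψ (Mwedge q μ R F Ψ M (i + 1))))
      = q ^ i • (((1 + sx q i * (q - q⁻¹)) * μ⁻¹) •
            rmulE (rmulE M (aElt q μ R F Ψ M i)) (gElt q μ R F Ψ M) +
          sx q i • rmulE (M * xi q μ R F Ψ (Mwedge q μ R F Ψ M i)) (gElt q μ R F Ψ M) +
          (sy q μ i - sx q i * (q - q⁻¹)) •
            rmulE (M * phi R F Ψ (Mwedge q μ R F Ψ M i)) (gElt q μ R F Ψ M)) := by
  refine smul_right_injective _ S.gen.loop_ne ?_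
  change loopVal q μ • _ = loopVal q μ • _
  obtain ⟨i, rfl⟩ := Nat.exists_eq_add_of_le' hi1
  have h := congrArg toN ((S.fam (i + 4)).trace_asymB S.gen (i := i + 1)
    (τ := trTailL A (Dof Ψ) (i + 3)) (m := Mprod F M (i + 4)) hi1
    (fun j hj => (op_commute_Mprod S.detF S.rel S.braidF S.compat (by omega) le_rfl).symm)
    (fun j hj1 hj => S.cyc_op hj1 (by omega)) hi)
  have e1 := S.trTailL_asymB_contract i (op_one (by omega)).symm
  have e2 := S.trTailL_asymB_contract i (X := R) rfl
  have e3 := S.trTailL_asymB_contract i (X := bmwK q μ R) rfl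
  rw [S.trace_asymB_one, op_one (by omega)] at e1
  rw [S.trace_asymB_op] at e2
  rw [S.trace_asymB_contractor] at e3
  rw [S.star_xi_eq_trace, smul_comm]
  refine h.trans ?_
  refine (congrArg₂ (fun x y => q ^ (i + 1) • (x + y)) (congrArg₂ (· + ·)
    (congrArg (((1 + sx q (i + 1) * (q - q⁻¹)) * μ⁻¹) • ·) e1) (congrArg (sx q (i + 1) • ·) e3))
    (congrArg ((sy q μ (i + 1) - sx q (i + 1) * (q - q⁻¹)) • ·) e2)).trans ?_
  module

end Setup
end SecondRecursion

section Star

variable {N : ℕ} {A : Type*} [Ring A] [Algebra ℂ A] [NeZero N]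

theorem lift1_add {n : ℕ} (p : ℕ) (X Y : Matrix (Fin N) (Fin N) A) :
    (lift1 p (X + Y) : MatV N n A) = lift1 p X + lift1 p Y := by
  ext a b
  rw [Matrix.add_apply, lift1, lift1, lift1]
  split_ifs
  · rfl
  · rw [add_zero]

theorem lift1_smul {n : ℕ} (p : ℕ) (c : ℂ) (X : Matrix (Fin N) (Fin N) A) :
    (lift1 p (c • X) : MatV N n A) = c • lift1 p X := by
  ext a b
  rw [Matrix.smul_apply, lift1, lift1]
  split_ifs
  · rfl
  · rw [smul_zero]

theorem lift1_rmulE {n : ℕ} (p : ℕ) (X : Matrix (Fin N) (Fin N) A) (g : A) :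
    (lift1 p (rmulE X g) : MatV N n A) = lift1 p X * scM g := by
  ext a b
  rw [mul_scM_apply, lift1, lift1]
  split_ifs
  · rfl
  · rw [zero_mul]

theorem toN_one : toN (1 : MatV N 1 A) = 1 := by
  ext i j
  rw [toN, Matrix.one_apply, Matrix.one_apply]
  refine if_congr ?_ rfl rfl
  exact ⟨fun h => congrFun h 0, fun h => by rw [h]⟩

theorem lift1_zero_one : (lift1 0 (1 : Matrix (Fin N) (Fin N) A) : MatV N 1 A) = 1 := by
  rw [← toN_one, lift1_toN]

variable (R F Ψ : MatV N 2 ℂ)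

theorem phi_add (X Y : Matrix (Fin N) (Fin N) A) :
    phi R F Ψ (X + Y) = phi R F Ψ X + phi R F Ψ Y := by
  rw [phi, lift1_add, mul_add, add_mul, add_mul, ptrace_add, toN_add]; rfl

theorem phi_smul (c : ℂ) (X : Matrix (Fin N) (Fin N) A) :
    phi R F Ψ (c • X) = c • phi R F Ψ X := by
  rw [phi, lift1_smul, mul_smul_comm, smul_mul_assoc, smul_mul_assoc, ptrace_smul, toN_smul]; rfl

theorem phi_rmulE (X : Matrix (Fin N) (Fin N) A) (g : A) :
    phi R F Ψ (rmulE X g) = rmulE (phi R F Ψ X) g := by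
  rw [phi, lift1_rmulE, ← mul_assoc, mul_assoc _ (scM g), (scM_commute_cmap g _).eq, ← mul_assoc,
    mul_assoc _ (scM g), (scM_commute_cmap g _).eq, ← mul_assoc, ptrace_mul_scM, toN_mul_scM]; rfl

theorem mul_rmulE (M X : Matrix (Fin N) (Fin N) A) (g : A) : M * rmulE X g = rmulE (M * X) g := by
  refine Matrix.ext fun a b => ?_
  simp only [rmulE, Matrix.mul_apply, Finset.sum_mul, mul_assoc]

/-- Star-multiplication by `M` as a linear map. -/
noncomputable def starL (M : Matrix (Fin N) (Fin N) A) :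
    Module.End ℂ (Matrix (Fin N) (Fin N) A) where
  toFun X := M * phi R F Ψ X
  map_add' X Y := by rw [phi_add, mul_add]
  map_smul' c X := by rw [phi_smul, mul_smul_comm]; rfl

theorem starL_apply (M X : Matrix (Fin N) (Fin N) A) :
    starL R F Ψ M X = M * phi R F Ψ X := rfl

theorem starL_pow_rmulE (M X : Matrix (Fin N) (Fin N) A) (g : A) (m : ℕ) :
    (starL R F Ψ M ^ m) (rmulE X g) = rmulE ((starL R F Ψ M ^ m) X) g := by
  induction m with
  | zero => rfl
  | succ m ih =>
    rw [pow_succ', Module.End.mul_apply, ih, starL_apply, phi_rmulE, mul_rmulE]; rfl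

theorem starPow_eq (M : Matrix (Fin N) (Fin N) A) (m : ℕ) :
    starPow R F Ψ M m = (starL R F Ψ M ^ m) 1 := by
  induction m with
  | zero => rfl
  | succ m ih => rw [starPow, ih, pow_succ']; rfl

/-- Entrywise multiplication by `g` on the right as a linear map. -/
noncomputable def rmulL (g : A) : Module.End ℂ (Matrix (Fin N) (Fin N) A) where
  toFun X := rmulE X g
  map_add' X Y := by ext a b; exact add_mul _ _ _
  map_smul' c X := by ext a b; exact smul_mul_assoc _ _ _

theorem rmulL_apply (g : A) (X : Matrix (Fin N) (Fin N) A) : rmulL g X = rmulE X g := rfl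

theorem rmulL_pow_apply (g : A) (r : ℕ) (X : Matrix (Fin N) (Fin N) A) :
    (rmulL g ^ r) X = rmulE X (g ^ r) := by
  induction r with
  | zero => ext a b; simp [rmulE]
  | succ r ih =>
    rw [pow_succ', Module.End.mul_apply, ih, rmulL_apply]
    ext a b
    rw [rmulE, rmulE, rmulE, pow_succ, mul_assoc]

end Star

namespace Setup

variable {N : ℕ} {A : Type*} [Ring A] [Algebra ℂ A] [NeZero N]
  {q μ : ℂ} {k : ℕ} {R F Ψ : MatV N 2 ℂ} {M : Matrix (Fin N) (Fin N) A}
  (S : Setup q μ k R F Ψ M)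

theorem _root_.QMA.Mwedge_one : Mwedge q μ R F Ψ M 1 = M := by
  rw [Mwedge_succ]
  change toN (1 * lift1 0 M * 1) = M
  rw [one_mul, mul_one, toN_lift1]

include S

theorem phi_one : phi R F Ψ (1 : Matrix (Fin N) (Fin N) A) = 1 := by
  have h1 : (lift1 0 (1 : Matrix (Fin N) (Fin N) A) : MatV N 2 A) = 1 := by
    rw [← ext1_lift1 (n := 1) (by omega), lift1_zero_one, ext1_eq_emb, map_one]
  have h2 : (op A F 0 * op A F⁻¹ 0 : MatV N 2 A) = 1 := by
    rw [← op_mul (by omega), Matrix.mul_nonsing_inv F S.detF, op_one (by omega)]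
  have h3 : phi R F Ψ (1 : Matrix (Fin N) (Fin N) A)
      = toN (ptrace (cmap (Dof Ψ)) (op A F 0 * lift1 0 1 * op A F⁻¹ 0 * op A R 0)) := rfl
  rw [h3, h1, mul_one, h2, one_mul, ptrace_op_last S.skew, toN_one]

theorem starL_one : starL R F Ψ M 1 = M := by rw [starL_apply, S.phi_one, mul_one]

theorem wedge_xi_one :
    M * xi q μ R F Ψ (Mwedge q μ R F Ψ M 1) = μ⁻¹ • rmulE 1 (gElt q μ R F Ψ M) := by
  rw [← S.trace_asymB_contractor 0, asymB, one_mul, Mprod, Mprod, Mprod, one_mul,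
    contraction_at S.gen.q0 S.gen.lam S.gen.mu0 S.gen.loop_ne S.braid S.det S.bmw S.skew S.rel S.detF
      S.braidF S.compat.2 (by omega), map_smul, trTailL_succ, ptrace_scM_mul,
    scM_mul_ptrace_contractor S.gen.q0 S.gen.lam S.gen.mu0 S.gen.loop_ne S.braid
      S.det S.bmw S.skew 0]
  have h : toN (scM (gElt q μ R F Ψ M) : MatV N 1 A) = rmulE 1 (gElt q μ R F Ψ M) := by
    rw [← one_mul (scM (gElt q μ R F Ψ M) : MatV N 1 A), toN_mul_scM, toN_one]
  rw [map_smul, toN_smul, toN_smul, smul_smul, trTailL_apply, trTail, h, pow_two, mul_assoc,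
    inv_mul_cancel₀ S.gen.mu0, mul_one]

end Setup

section Descent

variable {E : Type*} [AddCommGroup E] [Module ℂ E]

theorem sum_add_shifted_sum (A B : ℕ → E) (x y : ℕ → ℂ) (l : ℕ) (hx : x (l + 1) = 0)
    (hy : y 0 = 0) :
    ∑ r ∈ Finset.range (l + 1), (x r • A r + y (r + 1) • B (r + 1))
      = ∑ r ∈ Finset.range (l + 2), (x r • A r + y r • B r) := by
  rw [Finset.sum_add_distrib, Finset.sum_add_distrib, Finset.sum_range_succ _ (l + 1), hx,
    Finset.sum_range_succ' (fun r => y r • B r), hy]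
  simp

variable (q : ℂ) (k : ℕ) (γ : Module.End ℂ E) (p a b : ℕ → ℕ → E)

/-- The combination of descendants reached after `l` steps of the descent. -/
noncomputable def descent (l : ℕ) : E :=
  ∑ r ∈ Finset.range (l + 1),
    (((-1) ^ l * ((q ^ 2) ^ (l + 1) - (q ^ 2) ^ r) / ((q ^ 2) ^ (l + 1) - 1)) •
        (γ ^ r) (a (k + l - 2 * r) (k - l))
      + ((-1) ^ (l + 1) * ((q ^ 2) ^ (r + 1) - 1) / (q * ((q ^ 2) ^ (l + 1) - 1))) •
        (γ ^ r) (b (k + l - 2 * r) (k - l)))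

/-- The contribution of the power sums split off in step `l` of the descent. -/
noncomputable def split (l : ℕ) : E :=
  ∑ r ∈ Finset.range (l + 1),
    ((-1) ^ l * q ^ (k - l) * (q ^ 2) ^ r) • (γ ^ r) (p (k + l - 2 * r) (k - l))

variable {q k γ p a b} (hq : q ≠ 0)
  (ha : ∀ m, a m 0 = 0) (hb : ∀ m, b m 0 = 0)
  (h1 : ∀ i l m, i + l + 1 = k → a m (i + 1) = q ^ i • p (m + 1) i - a (m + 1) i
    + ((q ^ 2 - 1) / (q * ((q ^ 2) ^ (l + 2) - 1))) • b (m + 1) i)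
  (h2 : ∀ i l m, i + l + 1 = k → i ≤ m → b (m + 1) (i + 1) = γ (-(q ^ (k + l + 2)) • p m i
    + ((q ^ 2 - 1) * (q ^ 2) ^ (l + 2) / (q * ((q ^ 2) ^ (l + 2) - 1))) • a m i - b m i))

include hq ha hb h1 h2

theorem descent_succ {l : ℕ} (hl : l + 1 ≤ k) (hv : (q ^ 2) ^ (l + 1) - 1 ≠ 0)
    (hv' : l + 1 = k ∨ (q ^ 2) ^ (l + 2) - 1 ≠ 0) :
    descent q k γ a b l = descent q k γ a b (l + 1) - split q k γ p (l + 1) := by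
  obtain ⟨i, rfl⟩ : ∃ i, k = i + l + 1 := ⟨k - (l + 1), by omega⟩
  have e1 : i + l + 1 - l = i + 1 := by omega
  have e2 : i + l + 1 - (l + 1) = i := by omega
  rw [descent, descent, split, ← Finset.sum_sub_distrib, e1, e2]
  set u := q ^ 2 with hu
  set e : ℂ := (u - 1) / (q * (u ^ (l + 2) - 1)) with he
  set d : ℂ := (u - 1) * u ^ (l + 2) / (q * (u ^ (l + 2) - 1)) with hd
  set π : ℕ → E := fun r => (γ ^ r) (p (i + l + 1 + (l + 1) - 2 * r) i) with hπ
  set α : ℕ → E := fun r => (γ ^ r) (a (i + l + 1 + (l + 1) - 2 * r) i) with hα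
  set β : ℕ → E := fun r => (γ ^ r) (b (i + l + 1 + (l + 1) - 2 * r) i) with hβ
  set x : ℕ → ℂ := fun r => (-1) ^ l * (u ^ (l + 1) - u ^ r) / (u ^ (l + 1) - 1) with hx
  set y : ℕ → ℂ := fun r => (-1) ^ (l + 1) * (u ^ r - 1) / (q * (u ^ (l + 1) - 1)) with hy
  have key := sum_add_shifted_sum (fun r => q ^ i • π r - α r + e • β r)
    (fun r => -(q ^ (i + l + 1 + l + 2)) • π r + d • α r - β r) x y l (by simp [hx]) (by simp [hy])
  refine Eq.trans (Finset.sum_congr rfl fun r hr => ?_) (key.trans ?_)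
  · have hr' : r ≤ l := by simpa [Nat.lt_succ_iff] using hr
    have g1 : (γ ^ r) (a (i + l + 1 + l - 2 * r) (i + 1)) = q ^ i • π r - α r + e • β r := by
      rw [h1 i l _ rfl, show i + l + 1 + l - 2 * r + 1 = i + l + 1 + (l + 1) - 2 * r by omega,
        map_add, map_sub, map_smul, map_smul]
    have g2 : (γ ^ r) (b (i + l + 1 + l - 2 * r) (i + 1))
        = -(q ^ (i + l + 1 + l + 2)) • π (r + 1) + d • α (r + 1) - β (r + 1) := by
      rw [show i + l + 1 + l - 2 * r = i + l + 1 + (l + 1) - 2 * (r + 1) + 1 by omega,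
        h2 i l _ rfl (by omega), ← Module.End.mul_apply, ← pow_succ, map_sub, map_add, map_smul,
        map_smul]
    rw [g1, g2]
  · refine Finset.sum_congr rfl fun r _ => ?_
    have hπc : x r * q ^ i - y r * q ^ (i + l + 1 + l + 2)
        = -((-1) ^ (l + 1) * q ^ i * u ^ r) := by
      have : q ^ (i + l + 1 + l + 2) = q ^ i * u ^ (l + 1) * q := by rw [hu]; ring
      rw [this, hx, hy]
      field_simp
      ring
    rcases hv' with hk | hv'
    · obtain rfl : i = 0 := by omega
      have hα0 : α r = 0 := by rw [hα]; simp [ha]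
      have hβ0 : β r = 0 := by rw [hβ]; simp [hb]
      change _ = _ • α r + _ • β r - _ • π r
      rw [hα0, hβ0]
      rw [eq_neg_iff_add_eq_zero.mp hπc |> eq_neg_of_add_eq_zero_right]
      module
    · have hαc : -x r + y r * d
          = (-1) ^ (l + 1) * (u ^ (l + 1 + 1) - u ^ r) / (u ^ (l + 1 + 1) - 1) := by
        have : u ^ (l + 2) = u ^ (l + 1) * q ^ 2 := by rw [← hu]; ring
        have h' : u ^ (l + 1) * q ^ 2 - 1 ≠ 0 := this ▸ hv'
        rw [hd, hx, hy, show l + 1 + 1 = l + 2 from rfl, this]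
        dsimp only
        rw [pow_succ (-1 : ℂ) l]
        field_simp
        rw [hu]
        ring
      have hβc : x r * e - y r
          = (-1) ^ (l + 1 + 1) * (u ^ (r + 1) - 1) / (q * (u ^ (l + 1 + 1) - 1)) := by
        have this : u ^ (l + 2) = u ^ (l + 1) * q ^ 2 := by rw [← hu]; ring
        have h' : u ^ (l + 1) * q ^ 2 - 1 ≠ 0 := this ▸ hv'
        rw [he, hx, hy, show l + 1 + 1 = l + 2 from rfl, this, pow_succ u r]
        dsimp only
        rw [pow_succ (-1 : ℂ) (l + 1), pow_succ (-1 : ℂ) l]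
        field_simp
        rw [hu]
        ring
      change _ = _ • α r + _ • β r - _ • π r
      rw [← hαc, ← hβc, eq_neg_iff_add_eq_zero.mp hπc |> eq_neg_of_add_eq_zero_right]
      module

theorem sum_split_eq_descent (hk : 1 ≤ k) (hv : ∀ l, 1 ≤ l → l ≤ k → (q ^ 2) ^ l - 1 ≠ 0)
    (h0 : q ^ k • p k k - a k k + q⁻¹ • b k k = 0) :
    ∑ l ∈ Finset.range (k + 1), split q k γ p l = 0 := by
  have key : ∀ l, l ≤ k → ∑ j ∈ Finset.range (l + 1), split q k γ p j = descent q k γ a b l := by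
    intro l
    induction l with
    | zero =>
      intro _
      have h := hv 1 le_rfl hk
      have e : (-1 : ℂ) ^ 1 * ((q ^ 2) ^ 1 - 1) / (q * ((q ^ 2) ^ 1 - 1)) = -q⁻¹ := by
        rw [mul_div_mul_right _ _ h, pow_one, neg_div, one_div]
      simp only [descent, split, zero_add, Finset.range_one, Finset.sum_singleton, pow_zero,
        Nat.sub_zero, mul_zero, add_zero, one_mul, mul_one, Module.End.one_apply]
      rw [e, div_self h, one_smul, neg_smul, ← sub_eq_add_neg, ← sub_eq_zero, ← h0]
      abel
    | succ l ih =>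
      intro hl
      rw [Finset.sum_range_succ, ih (by omega), descent_succ hq ha hb h1 h2 hl (hv _ (by omega) hl),
        sub_add_cancel]
      rcases Nat.lt_or_ge k (l + 2) with h | h
      · exact Or.inl (by omega)
      · exact Or.inr (hv _ (by omega) h)
  rw [key k le_rfl, descent]
  refine Finset.sum_eq_zero fun r _ => ?_
  rw [Nat.sub_self, ha, hb, map_zero, smul_zero, smul_zero, add_zero]

end Descent

section Reindex

theorem sum_descent_index {E : Type*} [AddCommMonoid E] (k : ℕ) (t : ℕ → ℕ → ℕ → E) :
    ∑ i ∈ Finset.range (2 * k + 1), ∑ s ∈ Finset.range (min i (2 * k - i) / 2 + 1),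
        t i (min i (2 * k - i) - 2 * s) (s + (i - k))
      = ∑ l ∈ Finset.range (k + 1), ∑ r ∈ Finset.range (l + 1), t (k - l + 2 * r) (k - l) r := by
  rw [Finset.sum_sigma', Finset.sum_sigma']
  refine Finset.sum_bij'
    (fun x _ => ⟨k - (min x.1 (2 * k - x.1) - 2 * x.2), x.2 + (x.1 - k)⟩)
    (fun x _ => ⟨k - x.1 + 2 * x.2, x.2 - (k - x.1 + 2 * x.2 - k)⟩) ?_ ?_ ?_ ?_ ?_
  · rintro ⟨i, s⟩ h
    simp only [Finset.mem_sigma, Finset.mem_range] at h ⊢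
    omega
  · rintro ⟨l, r⟩ h
    simp only [Finset.mem_sigma, Finset.mem_range] at h ⊢
    omega
  · rintro ⟨i, s⟩ h
    simp only [Finset.mem_sigma, Finset.mem_range] at h
    simp only [Sigma.mk.injEq, heq_eq_eq]
    omega
  · rintro ⟨l, r⟩ h
    simp only [Finset.mem_sigma, Finset.mem_range] at h
    simp only [Sigma.mk.injEq, heq_eq_eq]
    omega
  · rintro ⟨i, s⟩ h
    simp only [Finset.mem_sigma, Finset.mem_range] at h
    congr 1 <;> dsimp only <;> omega

variable {N : ℕ} {A : Type*} [Ring A] [Algebra ℂ A] [NeZero N]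

theorem rmulE_sum {ι : Type*} (s : Finset ι) (X : Matrix (Fin N) (Fin N) A) (c : ι → A) :
    rmulE X (∑ i ∈ s, c i) = ∑ i ∈ s, rmulE X (c i) := by
  refine Matrix.ext fun a b => ?_
  rw [Matrix.sum_apply]
  exact Finset.mul_sum _ _ _

theorem rmulE_rmulE (X : Matrix (Fin N) (Fin N) A) (c d : A) :
    rmulE (rmulE X c) d = rmulE X (c * d) := by
  refine Matrix.ext fun a b => ?_
  exact mul_assoc _ _ _

theorem eps_eq_sum (q μ : ℂ) (R F Ψ : MatV N 2 ℂ) (M : Matrix (Fin N) (Fin N) A) (k i : ℕ) :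
    eps q μ R F Ψ M k i = ∑ s ∈ Finset.range (min i (2 * k - i) / 2 + 1),
      aElt q μ R F Ψ M (min i (2 * k - i) - 2 * s) * gElt q μ R F Ψ M ^ (s + (i - k)) := by
  rw [eps]
  split_ifs with h
  · rw [min_eq_left (by omega), Nat.sub_eq_zero_of_le h]
    rfl
  · rw [min_eq_right (by omega), Finset.sum_mul]
    exact Finset.sum_congr rfl fun s _ => by rw [mul_assoc, ← pow_add]

theorem sum_starPow_eps (q μ : ℂ) (R F Ψ : MatV N 2 ℂ) (M : Matrix (Fin N) (Fin N) A) (k : ℕ) :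
    ∑ i ∈ Finset.range (2 * k + 1),
        (-q) ^ i • rmulE (starPow R F Ψ M (2 * k - i)) (eps q μ R F Ψ M k i)
      = (-1 : ℂ) ^ k • ∑ l ∈ Finset.range (k + 1), split q k (rmulL (gElt q μ R F Ψ M))
          (fun m i => rmulE (starPow R F Ψ M m) (aElt q μ R F Ψ M i)) l := by
  rw [Finset.smul_sum]
  simp only [eps_eq_sum, rmulE_sum, Finset.smul_sum]
  rw [sum_descent_index k fun i j r =>
    (-q) ^ i • rmulE (starPow R F Ψ M (2 * k - i)) (aElt q μ R F Ψ M j * gElt q μ R F Ψ M ^ r)]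
  refine Finset.sum_congr rfl fun l hl => ?_
  rw [split, Finset.smul_sum]
  refine Finset.sum_congr rfl fun r hr => ?_
  rw [Finset.mem_range] at hl hr
  obtain ⟨j, rfl⟩ : ∃ j, k = j + l := ⟨k - l, by omega⟩
  rw [Nat.add_sub_cancel, show 2 * (j + l) - (j + 2 * r) = j + l + l - 2 * r by omega,
    rmulL_pow_apply, rmulE_rmulE, smul_smul]
  congr 1
  have h : (-1 : ℂ) ^ l * (-1) ^ l = 1 := by rw [← mul_pow]; norm_num
  rw [neg_pow q, pow_add (-1 : ℂ) j l, pow_add (-1 : ℂ) j (2 * r), pow_mul (-1 : ℂ) 2 r]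
  linear_combination (-(-1) ^ j * q ^ j * (q ^ 2) ^ r) * h

end Reindex

namespace Setup

variable {N : ℕ} {A : Type*} [Ring A] [Algebra ℂ A] [NeZero N]
  {q μ : ℂ} {k : ℕ} {R F Ψ : MatV N 2 ℂ} {M : Matrix (Fin N) (Fin N) A}
  (S : Setup q μ k R F Ψ M)

/-- The descendants of the wedge powers under star-multiplication by `M`. -/
noncomputable def _root_.QMA.descA (q μ : ℂ) (R F Ψ : MatV N 2 ℂ) (M : Matrix (Fin N) (Fin N) A)
    (m i : ℕ) : Matrix (Fin N) (Fin N) A :=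
  nq q i • (starL R F Ψ M ^ m) (Mwedge q μ R F Ψ M i)

/-- The descendants of the contracted wedge powers under star-multiplication by `M`. -/
noncomputable def _root_.QMA.descB (q μ : ℂ) (R F Ψ : MatV N 2 ℂ) (M : Matrix (Fin N) (Fin N) A) :
    ℕ → ℕ → Matrix (Fin N) (Fin N) A
  | 0, _ => 0
  | m + 1, i => nq q i • (starL R F Ψ M ^ m) (M * xi q μ R F Ψ (Mwedge q μ R F Ψ M i))

theorem _root_.QMA.nq_zero (q : ℂ) : nq q 0 = 0 := by simp [nq]

theorem _root_.QMA.starPow_succ_eq (m : ℕ) (h : starL R F Ψ M 1 = M) :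
    starPow R F Ψ M (m + 1) = (starL R F Ψ M ^ m) M := by
  rw [starPow_eq, pow_succ, Module.End.mul_apply, h]

end Setup

namespace Generic

variable {q μ : ℂ} {k : ℕ} (G : Generic q μ k)
include G

theorem nq_one : nq q 1 = 1 := by
  rw [nq, Nat.cast_one, zpow_one, _root_.zpow_neg_one, div_self G.lam]

theorem nq_mul_pow (i : ℕ) : nq q i * (q ^ i * (q - q⁻¹)) = (q ^ 2) ^ i - 1 := by
  have h0 := G.q0
  have h2 := G.lam
  rw [nq, _root_.zpow_neg, zpow_natCast, mul_comm (q ^ i), ← mul_assoc, div_mul_cancel₀ _ h2]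
  field_simp
  ring

theorem sq_pow_sub_one_ne {i : ℕ} (hi : 1 ≤ i) (hk : i ≤ k) : (q ^ 2) ^ i - 1 ≠ 0 := by
  rw [← G.nq_mul_pow]
  exact mul_ne_zero (G.nq_ne i hi hk) (mul_ne_zero (pow_ne_zero _ G.q0) G.lam)

theorem pow_mul_sx (i : ℕ) : q ^ i * sx q i = -nq q i := by
  have h0 := G.q0
  have h2 := G.lam
  rw [nq, sx, _root_.zpow_neg, _root_.zpow_neg, mul_comm 2 (i : ℤ), _root_.zpow_mul,
    zpow_natCast, zpow_ofNat]
  field_simp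
  ring

theorem pow_mul_one_add_sx (i : ℕ) : q ^ i * (1 + sx q i * (q - q⁻¹)) = (q ^ i)⁻¹ := by
  have h0 := G.q0
  have h2 := G.lam
  rw [sx, div_mul_cancel₀ _ h2, _root_.zpow_neg, mul_comm 2 (i : ℤ), _root_.zpow_mul,
    zpow_natCast, zpow_ofNat]
  field_simp
  ring

theorem symplectic_inv (hμ : μ = -q ^ (-1 - 2 * (k : ℤ))) : μ⁻¹ = -(q ^ (2 * k + 1)) := by
  rw [hμ, inv_neg, ← _root_.zpow_neg, ← zpow_natCast]
  congr 2
  push_cast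
  ring

theorem symplectic_den (hμ : μ = -q ^ (-1 - 2 * (k : ℤ))) {i t : ℕ} (h : i + t = k) :
    μ + q ^ (1 - 2 * (i : ℤ)) = -μ * ((q ^ 2) ^ (t + 1) - 1) := by
  have e : q ^ (1 - 2 * (i : ℤ)) = q ^ (-1 - 2 * (k : ℤ)) * (q ^ 2) ^ (t + 1) := by
    rw [← pow_mul, ← zpow_natCast, ← zpow_add₀ G.q0, ← h]
    congr 1
    push_cast
    ring
  rw [e, hμ]
  ring

theorem pow_mul_sy (hμ : μ = -q ^ (-1 - 2 * (k : ℤ))) {i t : ℕ} (hi : 1 ≤ i) (h : i + t = k) :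
    q ^ i * sy q μ i = (q ^ 2 - 1) / (q * ((q ^ 2) ^ (t + 1) - 1)) * nq q i := by
  have h0 := G.q0
  have hd := G.den i hi (by omega)
  have hs := G.sy_mul hi (by omega)
  rw [G.symplectic_den hμ h] at hd hs
  have hv := right_ne_zero_of_mul hd
  have hy : sy q μ i * ((q ^ 2) ^ (t + 1) - 1) = -((q - q⁻¹) * sx q i) := by
    apply mul_left_cancel₀ (neg_ne_zero.mpr G.mu0)
    linear_combination hs
  have hx := G.pow_mul_sx i
  rw [div_mul_eq_mul_div, eq_div_iff (mul_ne_zero h0 hv)]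
  have hq : q * (q - q⁻¹) = q ^ 2 - 1 := by field_simp
  linear_combination q ^ i * q * hy - (q * (q - q⁻¹)) * hx + nq q i * hq

theorem pow_mul_sy_sub (hμ : μ = -q ^ (-1 - 2 * (k : ℤ))) {i t : ℕ} (hi : 1 ≤ i) (h : i + t = k) :
    q ^ i * (sy q μ i - sx q i * (q - q⁻¹))
      = (q ^ 2 - 1) * (q ^ 2) ^ (t + 1) / (q * ((q ^ 2) ^ (t + 1) - 1)) * nq q i := by
  have h0 := G.q0
  have hd := G.den i hi (by omega)
  rw [G.symplectic_den hμ h] at hd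
  have hv := right_ne_zero_of_mul hd
  have hq : q - q⁻¹ = (q ^ 2 - 1) / q := by field_simp
  have hx := G.pow_mul_sx i
  rw [mul_sub, G.pow_mul_sy hμ hi h, ← mul_assoc, hx, hq]
  field_simp
  ring

end Generic

namespace Setup

variable {N : ℕ} {A : Type*} [Ring A] [Algebra ℂ A] [NeZero N]
  {q μ : ℂ} {k : ℕ} {R F Ψ : MatV N 2 ℂ} {M : Matrix (Fin N) (Fin N) A}
  (S : Setup q μ k R F Ψ M)
include S

theorem starPow_succ (m : ℕ) : starPow R F Ψ M (m + 1) = (starL R F Ψ M ^ m) M :=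
  starPow_succ_eq m S.starL_one

theorem descA_succ (hμ : μ = -q ^ (-1 - 2 * (k : ℤ))) (i l m : ℕ) (h : i + l + 1 = k) :
    descA q μ R F Ψ M m (i + 1)
      = q ^ i • rmulE (starPow R F Ψ M (m + 1)) (aElt q μ R F Ψ M i) - descA q μ R F Ψ M (m + 1) i
        + ((q ^ 2 - 1) / (q * ((q ^ 2) ^ (l + 2) - 1))) • descB q μ R F Ψ M (m + 1) i := by
  rcases Nat.eq_zero_or_pos i with rfl | hi
  · rw [descA, descA, descB, nq_zero, zero_smul, zero_smul, smul_zero, S.gen.nq_one, Mwedge_one,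
      S.starPow_succ, aElt]
    refine Matrix.ext fun a b => ?_
    simp [rmulE]
  · rw [descA, ← map_smul, S.wedge_succ hi (by omega), descA, descB, S.starPow_succ, smul_smul,
      ← S.gen.pow_mul_sy hμ hi (by omega : i + (l + 1) = k),
      ← neg_eq_iff_eq_neg.mpr (S.gen.pow_mul_sx i), ← starL_apply, map_smul, map_add, map_add,
      map_smul, map_smul, starL_pow_rmulE, pow_succ (starL R F Ψ M) m, Module.End.mul_apply]
    module

theorem descA_height (hμ : μ = -q ^ (-1 - 2 * (k : ℤ))) (hk : 1 ≤ k) (hcut : HeightCut q μ R k) :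
    q ^ k • rmulE (starPow R F Ψ M k) (aElt q μ R F Ψ M k) - descA q μ R F Ψ M k k
        + q⁻¹ • descB q μ R F Ψ M k k = 0 := by
  obtain ⟨m, hm⟩ : ∃ m, k = m + 1 := ⟨k - 1, by omega⟩
  have hv := S.gen.sq_pow_sub_one_ne le_rfl hk
  have he : q⁻¹ = (q ^ 2 - 1) / (q * ((q ^ 2) ^ (0 + 1) - 1)) := by
    rw [zero_add, pow_one] at *
    field_simp
  have h := congrArg (fun X => q ^ k • (starL R F Ψ M ^ m) X) (S.wedge_height hk rfl hcut)
  simp only [map_zero, smul_zero] at h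
  rw [← h, ← starL_apply]
  have e1 : starPow R F Ψ M k = (starL R F Ψ M ^ m) M := by rw [hm, S.starPow_succ]
  have e2 : descA q μ R F Ψ M k k
      = nq q k • (starL R F Ψ M ^ m) (starL R F Ψ M (Mwedge q μ R F Ψ M k)) := by
    rw [descA, ← Module.End.mul_apply, ← pow_succ, ← hm]
  have e3 : descB q μ R F Ψ M k k
      = nq q k • (starL R F Ψ M ^ m) (M * xi q μ R F Ψ (Mwedge q μ R F Ψ M k)) := by
    conv_lhs => rw [show descB q μ R F Ψ M k k = descB q μ R F Ψ M (m + 1) k by rw [← hm], descB]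
  rw [e1, e2, e3, he, smul_smul, ← S.gen.pow_mul_sy hμ hk (by omega : k + 0 = k),
      ← neg_eq_iff_eq_neg.mpr (S.gen.pow_mul_sx k), map_add, map_add, map_smul, map_smul,
      starL_pow_rmulE]
  module

theorem descB_succ (hμ : μ = -q ^ (-1 - 2 * (k : ℤ))) (i l m : ℕ) (h : i + l + 1 = k)
    (him : i ≤ m) :
    descB q μ R F Ψ M (m + 1) (i + 1)
      = rmulL (gElt q μ R F Ψ M)
        (-(q ^ (k + l + 2)) • rmulE (starPow R F Ψ M m) (aElt q μ R F Ψ M i)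
          + ((q ^ 2 - 1) * (q ^ 2) ^ (l + 2) / (q * ((q ^ 2) ^ (l + 2) - 1))) •
            descA q μ R F Ψ M m i - descB q μ R F Ψ M m i) := by
  have hμi := S.gen.symplectic_inv hμ
  rcases Nat.eq_zero_or_pos i with rfl | hi
  · have hb : descB q μ R F Ψ M m 0 = 0 := by
      cases m with
      | zero => rfl
      | succ m => rw [descB, nq_zero, zero_smul]
    have h1 : rmulE (starPow R F Ψ M m) 1 = starPow R F Ψ M m :=
      Matrix.ext fun a b => mul_one _
    rw [descB, S.gen.nq_one, one_smul, zero_add, S.wedge_xi_one, hb, descA, nq_zero, zero_smul,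
      smul_zero, sub_zero, add_zero, aElt, h1, map_smul, map_smul, starL_pow_rmulE, ← starPow_eq,
      rmulL_apply, hμi, show 2 * k + 1 = k + l + 2 by omega]
  · obtain ⟨m, rfl⟩ : ∃ n, m = n + 1 := ⟨m - 1, by omega⟩
    have hp : q ^ i * ((1 + sx q i * (q - q⁻¹)) * μ⁻¹) = -(q ^ (k + l + 2)) := by
      rw [← mul_assoc, S.gen.pow_mul_one_add_sx, hμi,
        show 2 * k + 1 = k + l + 2 + i by omega, pow_add q (k + l + 2) i]
      have := pow_ne_zero i S.gen.q0
      field_simp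
    rw [descB, pow_succ, Module.End.mul_apply, starL_apply, ← map_smul,
      S.wedge_xi_succ hi (by omega), ← hp, descA, descB, smul_smul _ (nq q i),
      ← S.gen.pow_mul_sy_sub hμ hi (by omega : i + (l + 1) = k),
      ← neg_eq_iff_eq_neg.mpr (S.gen.pow_mul_sx i), S.starPow_succ, ← starL_apply]
    simp only [map_smul, map_add, map_sub, starL_pow_rmulE, rmulL_apply, pow_succ (starL R F Ψ M) m,
      Module.End.mul_apply]
    module

theorem cayley_hamilton (hμ : μ = -q ^ (-1 - 2 * (k : ℤ))) (hk : 1 ≤ k)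
    (hcut : HeightCut q μ R k) :
    ∑ i ∈ Finset.range (2 * k + 1),
        (-q) ^ i • rmulE (starPow R F Ψ M (2 * k - i)) (eps q μ R F Ψ M k i) = 0 := by
  rw [sum_starPow_eps, sum_split_eq_descent (a := descA q μ R F Ψ M) (b := descB q μ R F Ψ M)
    S.gen.q0 ?_ ?_ (S.descA_succ hμ) (S.descB_succ hμ) hk
    (fun l h1 h2 => S.gen.sq_pow_sub_one_ne h1 h2) (S.descA_height hμ hk hcut), smul_zero]
  · intro m
    rw [descA, nq_zero, zero_smul]
  · intro m
    cases m with
    | zero => rfl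
    | succ m => rw [descB, nq_zero, zero_smul]

end Setup

end QMA

namespace QMA

/-- **Cayley–Hamilton theorem for symplectic quantum matrix algebras**
(Theorem 4.4 of Ogievetsky–Pyatov, "Cayley-Hamilton Theorem for Symplectic
Quantum Matrix Algebras").

Let `{R, F}` be a compatible pair of R-matrices on `V = ℂ^N` in which `F` is strict skew
invertible and `R` is skew invertible of `Sp(2k)` type (height `k` and `μ = -q^{-1-2k}`).
Then the matrix `M` of generators of the quantum matrix algebra `M(R,F)` (equivalently: any
`N × N` matrix with entries in an associative unital `ℂ`-algebra `A` satisfying the defining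
relation `R₁ M_{(1)} M_{(2)} = M_{(1)} M_{(2)} R₁`) satisfies
`∑_{i=0}^{2k} (-q)^i M^{[2k-i]} ε_i = 0`, where `ε_0 = 1`,
`ε_i = ∑_{j=0}^{⌊i/2⌋} a_{i-2j} g^j` for `1 ≤ i ≤ k` and `ε_{k+i} = ε_{k-i} g^i` for
`1 ≤ i ≤ k`. -/
theorem symplectic_cayley_hamilton
    {N : ℕ} [NeZero N] (k : ℕ) (hk : 2 ≤ k) (q μ : ℂ)
    (hq0 : q ≠ 0) (hq1 : q ≠ 1) (hqm1 : q ≠ -1)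
    (hμ0 : μ ≠ 0) (hμq : μ ≠ q) (hμq' : μ ≠ -q⁻¹)
    (hiq : ∀ i : ℕ, 2 ≤ i → i ≤ k → nq q i ≠ 0)
    (hμi : ∀ i : ℕ, 1 ≤ i → i ≤ k → μ ≠ -q ^ (1 - 2 * (i : ℤ)))
    (R F ΨR ΨF : MatV N 2 ℂ)
    (hRbraid : IsBraid R) (hRdet : IsUnit R.det)
    (hFbraid : IsBraid F) (hFdet : IsUnit F.det)
    (hcomp : Compatible R F)
    (hΨR : SkewPair R ΨR) (hΨF : SkewPair F ΨF)
    (hFstrict : IsUnit (Dof ΨF).det)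
    (hbmw : IsBMW q μ R)
    (hheight : HasHeight q μ R k)
    (hμval : μ = -q ^ (-1 - 2 * (k : ℤ)))
    (A : Type*) [Ring A] [Algebra ℂ A]
    (M : Matrix (Fin N) (Fin N) A)
    (hM : QMArel R F M) :
    ∑ i ∈ Finset.range (2 * k + 1),
        (-q) ^ i • rmulE (starPow R F ΨR M (2 * k - i)) (eps q μ R F ΨR M k i) = 0 := by
  have hq2 : q ^ 2 - 1 ≠ 0 := by
    intro h
    have h' : (q - 1) * (q + 1) = 0 := by linear_combination h
    rcases mul_eq_zero.mp h' with h | h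
    · exact hq1 (sub_eq_zero.mp h)
    · exact hqm1 (eq_neg_of_add_eq_zero_left h)
  have hlam : q - q⁻¹ ≠ 0 := by
    intro h
    refine hq2 ?_
    have e : q ^ 2 - 1 = q * (q - q⁻¹) := by field_simp
    rw [e, h, mul_zero]
  have hgen : Generic q μ k :=
    { q0 := hq0
      lam := hlam
      mu0 := hμ0
      muq := hμq
      muq' := fun h => hμq' (eq_neg_of_add_eq_zero_left h)
      nq_ne := fun i h1 h2 => by
        rcases Nat.lt_or_ge 1 i with h | h
        · exact hiq i h h2
        · obtain rfl : i = 1 := le_antisymm h h1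
          rw [nq, Nat.cast_one, zpow_one, _root_.zpow_neg_one, div_self hlam]
          exact one_ne_zero
      den := fun i h1 h2 h => hμi i h1 h2 (eq_neg_of_add_eq_zero_left h) }
  have S : Setup q μ k R F ΨR M :=
    ⟨hgen, hRbraid, hRdet, hbmw, hΨR, hFdet, hFbraid, hcomp, hM⟩
  exact S.cayley_hamilton hμval (by omega) hheight.2.2

end QMA
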